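/- Let p be any C¹ function on (0,∞) and let (ρ₋, v₋), (ρ₊, v₊) be Riemann data such that there exists at least one admissible fan subsolution (ρ̄, v̄, ū) of the 2D isentropic Euler system with these data, with associated fan partition P₋, P₁, P₂, P₊ and constants C₁, C₂. Then there exist infinitely many bounded admissible weak solutions (ρ, v) of the Euler system with the same Riemann initial data such that ρ = ρ̄ almost everywhere and |v|² = C_i almost everywhere on P_i for i = 1, 2. -/

import Mathlib

open MeasureTheory Matrix

noncomputable section

/-- Space-time point: `(x, t)` with `x ∈ ℝ²` (spatial variable) and `t ∈ ℝ` (time). -/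
abbrev SpaceTime : Type := (Fin 2 → ℝ) × ℝ

/-- A test function: smooth and compactly supported on `ℝ² × ℝ`. -/
def IsTest (φ : SpaceTime → ℝ) : Prop :=
  ContDiff ℝ (⊤ : ℕ∞) φ ∧ HasCompactSupport φ

/-- Time partial derivative `∂_t φ`. -/
def pdt (φ : SpaceTime → ℝ) (q : SpaceTime) : ℝ := fderiv ℝ φ q (0, 1)

/-- Spatial partial derivative `∂_{x_i} φ`. -/
def pdx (i : Fin 2) (φ : SpaceTime → ℝ) (q : SpaceTime) : ℝ :=
  fderiv ℝ φ q (Pi.single i 1, 0)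

/-- The set of space-time points with positive time, i.e. `ℝ² × (0,∞)`. -/
def posTime : Set SpaceTime := {q | 0 < q.2}

/-- Riemann initial data for the density. -/
def riemannRho (ρm ρp : ℝ) (x : Fin 2 → ℝ) : ℝ := if x 1 < 0 then ρm else ρp

/-- Riemann initial data for the velocity. -/
def riemannV (vm vp : Fin 2 → ℝ) (x : Fin 2 → ℝ) : Fin 2 → ℝ :=
  if x 1 < 0 then vm else vp

/-- Squared euclidean norm `|v|²` of a vector `v ∈ ℝ²`. -/
def sq2 (v : Fin 2 → ℝ) : ℝ := ∑ i, v i ^ 2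

/-- `(ρ, v)` is a weak solution (in the sense of distributions, with the initial data
`(ρ0, v0)` entering through the `t = 0` boundary term) of the compressible isentropic
Euler system `∂_t ρ + div_x (ρ v) = 0`, `∂_t (ρ v) + div_x (ρ v ⊗ v) + ∇_x p(ρ) = 0`
on `ℝ² × (0,∞)`, with pressure law `p`. -/
def IsWeakSolution (p : ℝ → ℝ) (ρ0 : (Fin 2 → ℝ) → ℝ) (v0 : (Fin 2 → ℝ) → Fin 2 → ℝ)
    (ρ : SpaceTime → ℝ) (v : SpaceTime → Fin 2 → ℝ) : Prop :=
  (∀ φ : SpaceTime → ℝ, IsTest φ →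
    (∫ q in posTime, (ρ q * pdt φ q + ∑ i, ρ q * v q i * pdx i φ q))
      + (∫ x, ρ0 x * φ (x, 0)) = 0) ∧
  (∀ j : Fin 2, ∀ φ : SpaceTime → ℝ, IsTest φ →
    (∫ q in posTime,
        (ρ q * v q j * pdt φ q + (∑ i, ρ q * v q j * v q i * pdx i φ q)
          + p (ρ q) * pdx j φ q))
      + (∫ x, ρ0 x * v0 x j * φ (x, 0)) = 0)

/-- `(ρ, v)` satisfies the weak form of the entropy (energy) inequality with pressure `p`,
internal energy `ε`, and initial data `(ρ0, v0)`: for every nonnegative test function `φ`,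
`∫∫ [(ρε(ρ)+ρ|v|²/2) ∂_t φ + (ρε(ρ)+ρ|v|²/2+p(ρ)) v · ∇_x φ] + ∫ (ρ⁰ε(ρ⁰)+ρ⁰|v⁰|²/2) φ(·,0) ≥ 0`. -/
def IsAdmissibleSolution (p ε : ℝ → ℝ) (ρ0 : (Fin 2 → ℝ) → ℝ)
    (v0 : (Fin 2 → ℝ) → Fin 2 → ℝ)
    (ρ : SpaceTime → ℝ) (v : SpaceTime → Fin 2 → ℝ) : Prop :=
  ∀ φ : SpaceTime → ℝ, IsTest φ → (∀ q, 0 ≤ φ q) →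
    0 ≤ (∫ q in posTime,
          ((ρ q * ε (ρ q) + ρ q * sq2 (v q) / 2) * pdt φ q
            + ∑ i, (ρ q * ε (ρ q) + ρ q * sq2 (v q) / 2 + p (ρ q)) * v q i * pdx i φ q))
        + (∫ x, (ρ0 x * ε (ρ0 x) + ρ0 x * sq2 (v0 x) / 2) * φ (x, 0))

/-- Internal energy density associated with the pressure law `p(ρ) = ρ^γ` via
`p(r) = r² ε'(r)`: `ε(ρ) = ρ^(γ-1)/(γ-1)` for `γ > 1` and `ε(ρ) = log ρ` for `γ = 1`. -/
def intEnergy (γ : ℝ) (r : ℝ) : ℝ :=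
  if γ = 1 then Real.log r else r ^ (γ - 1) / (γ - 1)

/-- The pressure law `p(ρ) = ρ^γ`. -/
def pressure (γ : ℝ) (r : ℝ) : ℝ := r ^ γ

/-- `(ρ, v)` is a bounded admissible weak solution of the 2D isentropic Euler system
with pressure `p`, internal energy `ε`, and initial data `(ρ0, v0)`: it is measurable,
takes values in `(0,∞) × ℝ²`, is (essentially) bounded, is a weak solution, and
satisfies the weak energy inequality. -/
def IsBddAdmissibleSolutionGen (p ε : ℝ → ℝ) (ρ0 : (Fin 2 → ℝ) → ℝ)
    (v0 : (Fin 2 → ℝ) → Fin 2 → ℝ)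
    (ρ : SpaceTime → ℝ) (v : SpaceTime → Fin 2 → ℝ) : Prop :=
  Measurable ρ ∧ Measurable v ∧ (∀ q, 0 < ρ q) ∧
  (∃ M : ℝ, ∀ q, ρ q ≤ M ∧ ∀ i, |v q i| ≤ M) ∧
  IsWeakSolution p ρ0 v0 ρ v ∧ IsAdmissibleSolution p ε ρ0 v0 ρ v

/-- `(ρ, v)` is a bounded admissible weak solution of the 2D isentropic Euler system with
pressure `p(ρ) = ρ^γ` and Riemann initial data given by `(ρm, vm)` for `x₂ < 0` and
`(ρp, vp)` for `x₂ > 0`. -/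
def IsBddAdmissibleRiemannSolution (γ ρm ρp : ℝ) (vm vp : Fin 2 → ℝ)
    (ρ : SpaceTime → ℝ) (v : SpaceTime → Fin 2 → ℝ) : Prop :=
  IsBddAdmissibleSolutionGen (pressure γ) (intEnergy γ)
    (riemannRho ρm ρp) (riemannV vm vp) ρ v

/-- A matrix in `𝒮₀^{2×2}`: symmetric and trace-free. -/
def IsS0 (u : Matrix (Fin 2) (Fin 2) ℝ) : Prop := u.IsSymm ∧ u.trace = 0

/-- The outer product `v ⊗ v` of a vector `v ∈ ℝ²`. -/
def outer (v : Fin 2 → ℝ) : Matrix (Fin 2) (Fin 2) ℝ := vecMulVec v v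

/-- The traceless part `v ⊗ v − ½|v|² Id` used for the states `u₋, u₊`. -/
def uPM (v : Fin 2 → ℝ) : Matrix (Fin 2) (Fin 2) ℝ :=
  outer v - (sq2 v / 2) • (1 : Matrix (Fin 2) (Fin 2) ℝ)

/-- The piecewise constant field on the fan partition determined by `ν₋ < ν₁ < ν₊`,
taking values `am, a1, a2, ap` on `P₋, P₁, P₂, P₊` respectively. -/
def fanField {α : Type} (νm ν1 νp : ℝ) (am a1 a2 ap : α) (q : SpaceTime) : α :=
  if q.1 1 < νm * q.2 then am else if q.1 1 < ν1 * q.2 then a1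
  else if q.1 1 < νp * q.2 then a2 else ap

/-- The region `P₁ = {(x,t) : t > 0, ν₋ t < x₂ < ν₁ t}` of a fan partition. -/
def fanP1 (νm ν1 : ℝ) : Set SpaceTime :=
  {q | 0 < q.2 ∧ νm * q.2 < q.1 1 ∧ q.1 1 < ν1 * q.2}

/-- The region `P₂ = {(x,t) : t > 0, ν₁ t < x₂ < ν₊ t}` of a fan partition. -/
def fanP2 (ν1 νp : ℝ) : Set SpaceTime :=
  {q | 0 < q.2 ∧ ν1 * q.2 < q.1 1 ∧ q.1 1 < νp * q.2}

/-- Fan subsolution to the 2D isentropic compressible Euler system with pressure law `p`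
and Riemann initial data `(ρm, vm)`, `(ρp, vp)`, built from the fan partition determined
by `ν₋ < ν₁ < ν₊`, middle states `(ρ₁, v₁, u₁)`, `(ρ₂, v₂, u₂)` and constants `C₁, C₂`:
the subsolution conditions `(Cᵢ/2)Id − vᵢ⊗vᵢ + uᵢ > 0` hold, and the relaxed continuity
and momentum equations hold in the sense of distributions (with the Riemann initial data
in the `t = 0` boundary terms). -/
def IsFanSubsolution (p : ℝ → ℝ) (ρm ρp : ℝ) (vm vp : Fin 2 → ℝ)
    (νm ν1 νp ρ1 ρ2 : ℝ) (v1 v2 : Fin 2 → ℝ) (u1 u2 : Matrix (Fin 2) (Fin 2) ℝ)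
    (C1 C2 : ℝ) : Prop :=
  νm < ν1 ∧ ν1 < νp ∧ 0 < ρ1 ∧ 0 < ρ2 ∧ IsS0 u1 ∧ IsS0 u2 ∧ 0 < C1 ∧ 0 < C2 ∧
  ((C1 / 2) • (1 : Matrix (Fin 2) (Fin 2) ℝ) - outer v1 + u1).PosDef ∧
  ((C2 / 2) • (1 : Matrix (Fin 2) (Fin 2) ℝ) - outer v2 + u2).PosDef ∧
  -- continuity equation ∂_t ρ̄ + div_x (ρ̄ v̄) = 0
  (∀ φ : SpaceTime → ℝ, IsTest φ →
    (∫ q in posTime,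
        (fanField νm ν1 νp ρm ρ1 ρ2 ρp q * pdt φ q
          + ∑ i, fanField νm ν1 νp (ρm * vm i) (ρ1 * v1 i) (ρ2 * v2 i) (ρp * vp i) q
              * pdx i φ q))
      + (∫ x, riemannRho ρm ρp x * φ (x, 0)) = 0) ∧
  -- momentum equation ∂_t(ρ̄ v̄) + div_x(ρ̄ ū) + ∇_x(p(ρ̄) + ½(ρ̄|v̄|²𝟙_{P₊∪P₋} + Σ Cᵢρᵢ𝟙_{Pᵢ})) = 0
  (∀ j : Fin 2, ∀ φ : SpaceTime → ℝ, IsTest φ →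
    (∫ q in posTime,
        (fanField νm ν1 νp (ρm * vm j) (ρ1 * v1 j) (ρ2 * v2 j) (ρp * vp j) q * pdt φ q
          + (∑ i, fanField νm ν1 νp (ρm * uPM vm j i) (ρ1 * u1 j i) (ρ2 * u2 j i)
                (ρp * uPM vp j i) q * pdx i φ q)
          + fanField νm ν1 νp (p ρm + ρm * sq2 vm / 2) (p ρ1 + C1 * ρ1 / 2)
              (p ρ2 + C2 * ρ2 / 2) (p ρp + ρp * sq2 vp / 2) q * pdx j φ q))
      + (∫ x, riemannRho ρm ρp x * riemannV vm vp x j * φ (x, 0)) = 0)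

/-- The total energy density of a fan subsolution:
`ρ̄ε(ρ̄) + ρ̄|v̄|²/2` on `P₋ ∪ P₊` and `ρᵢε(ρᵢ) + ρᵢCᵢ/2` on `Pᵢ`. -/
def fanEnergy (ε : ℝ → ℝ) (ρm ρp : ℝ) (vm vp : Fin 2 → ℝ)
    (νm ν1 νp ρ1 ρ2 C1 C2 : ℝ) (q : SpaceTime) : ℝ :=
  fanField νm ν1 νp (ρm * ε ρm + ρm * sq2 vm / 2) (ρ1 * ε ρ1 + ρ1 * C1 / 2)
    (ρ2 * ε ρ2 + ρ2 * C2 / 2) (ρp * ε ρp + ρp * sq2 vp / 2) q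

/-- Admissible fan subsolution: a fan subsolution which moreover satisfies the relaxed
energy inequality in the sense of distributions on `ℝ² × (0,∞)`. -/
def IsAdmissibleFanSubsolution (p ε : ℝ → ℝ) (ρm ρp : ℝ) (vm vp : Fin 2 → ℝ)
    (νm ν1 νp ρ1 ρ2 : ℝ) (v1 v2 : Fin 2 → ℝ) (u1 u2 : Matrix (Fin 2) (Fin 2) ℝ)
    (C1 C2 : ℝ) : Prop :=
  IsFanSubsolution p ρm ρp vm vp νm ν1 νp ρ1 ρ2 v1 v2 u1 u2 C1 C2 ∧
  (∀ φ : SpaceTime → ℝ, IsTest φ → (∀ q, 0 ≤ φ q) → tsupport φ ⊆ posTime →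
    0 ≤ ∫ q in posTime,
        (fanEnergy ε ρm ρp vm vp νm ν1 νp ρ1 ρ2 C1 C2 q * pdt φ q
          + ∑ i, (fanEnergy ε ρm ρp vm vp νm ν1 νp ρ1 ρ2 C1 C2 q
                + fanField νm ν1 νp (p ρm) (p ρ1) (p ρ2) (p ρp) q)
              * fanField νm ν1 νp (vm i) (v1 i) (v2 i) (vp i) q * pdx i φ q))

instance isAddHaarMeasure_volume_spaceTime : (volume : Measure SpaceTime).IsAddHaarMeasure := by
  rw [Measure.volume_eq_prod]; infer_instance

/-- The derivative of `f` in the direction `w`. -/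
def dirDeriv (w : SpaceTime) (f : SpaceTime → ℝ) : SpaceTime → ℝ := fun y => fderiv ℝ f y w

/-- The first spatial unit vector. -/
def dirX : SpaceTime := (Pi.single 0 1, 0)

/-- The second spatial unit vector. -/
def dirY : SpaceTime := (Pi.single 1 1, 0)

/-- The unit vector in the time direction. -/
def dirT : SpaceTime := (0, 1)

/-- Smooth functions on space-time. -/
abbrev Smooth (f : SpaceTime → ℝ) : Prop := ContDiff ℝ (⊤ : ℕ∞) f

theorem Smooth.differentiableAt {f : SpaceTime → ℝ} (hf : Smooth f) (y : SpaceTime) :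
    DifferentiableAt ℝ f y :=
  (hf.differentiable (by simp)) y

theorem Smooth.dirDeriv {f : SpaceTime → ℝ} (hf : Smooth f) (w : SpaceTime) :
    Smooth (dirDeriv w f) :=
  (hf.fderiv_right (m := (⊤ : ℕ∞)) (by simp)).clm_apply contDiff_const

theorem dirDeriv_add {f g : SpaceTime → ℝ} (hf : Smooth f) (hg : Smooth g) (w : SpaceTime) :
    dirDeriv w (fun y => f y + g y) = fun y => dirDeriv w f y + dirDeriv w g y := by
  funext y
  simp only [_root_.dirDeriv]
  rw [fderiv_fun_add (hf.differentiableAt y) (hg.differentiableAt y)]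
  rfl

theorem dirDeriv_const_mul {f : SpaceTime → ℝ} (hf : Smooth f) (c : ℝ) (w : SpaceTime) :
    dirDeriv w (fun y => c * f y) = fun y => c * dirDeriv w f y := by
  funext y
  simp only [_root_.dirDeriv]
  rw [fderiv_const_mul (hf.differentiableAt y)]
  rfl

theorem dirDeriv_comm {f : SpaceTime → ℝ} (hf : Smooth f) (a b : SpaceTime) :
    dirDeriv a (dirDeriv b f) = dirDeriv b (dirDeriv a f) := by
  have key : ∀ a b y, dirDeriv a (dirDeriv b f) y = fderiv ℝ (fderiv ℝ f) y a b := by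
    intro a b y
    have hd : DifferentiableAt ℝ (fderiv ℝ f) y :=
      ((hf.fderiv_right (m := (⊤ : ℕ∞)) (by simp)).differentiable (by simp)) y
    change fderiv ℝ (fun y => fderiv ℝ f y b) y a = _
    rw [fderiv_clm_apply hd (differentiableAt_const b)]
    simp
  funext y
  rw [key, key]
  exact (hf.contDiffAt (x := y)).isSymmSndFDerivAt
    (by simpa using WithTop.coe_le_coe.2 (le_top (a := (2 : ℕ∞)))) a b

theorem tsupport_dirDeriv_subset (f : SpaceTime → ℝ) (w : SpaceTime) :
    tsupport (dirDeriv w f) ⊆ tsupport f := by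
  refine closure_minimal (fun y hy => ?_) (isClosed_tsupport f)
  by_contra hc
  apply hy
  have : fderiv ℝ f y = 0 := by
    by_contra h0
    exact hc (support_fderiv_subset ℝ h0)
  simp [dirDeriv, this]

theorem hasCompactSupport_dirDeriv {f : SpaceTime → ℝ} (hf : HasCompactSupport f) (w : SpaceTime) :
    HasCompactSupport (dirDeriv w f) :=
  hf.of_isClosed_subset (isClosed_tsupport _) (tsupport_dirDeriv_subset f w)

/-- Integration by parts against a compactly supported function. -/
theorem integral_mul_dirDeriv {f φ : SpaceTime → ℝ} (hf : Smooth f) (hφ : Smooth φ)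
    (hc : HasCompactSupport φ) (w : SpaceTime) :
    ∫ y, f y * dirDeriv w φ y = -∫ y, dirDeriv w f y * φ y := by
  have hcd := hasCompactSupport_dirDeriv hc w
  refine integral_mul_fderiv_eq_neg_fderiv_mul_of_integrable ?_ ?_ ?_
    (fun y _ => hf.differentiableAt y) (fun y _ => hφ.differentiableAt y)
  · exact ((hf.dirDeriv w).continuous.mul hφ.continuous).integrable_of_hasCompactSupport
      (hc.mul_left)
  · exact (hf.continuous.mul (hφ.dirDeriv w).continuous).integrable_of_hasCompactSupport
      (hcd.mul_left)
  · exact (hf.continuous.mul hφ.continuous).integrable_of_hasCompactSupport (hc.mul_left)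

/-- The state space: `(v₁, v₂, u₁₁, u₁₂)`. -/
abbrev State : Type := EuclideanSpace ℝ (Fin 4)

/-- The solution `(v, u)` of `div v = 0`, `∂_t v + div u = 0` with scalar potential `g`. -/
def waveOp (g : SpaceTime → ℝ) (y : SpaceTime) : State :=
  !₂[-(dirDeriv dirY (dirDeriv dirX (dirDeriv dirX g)) y
        + dirDeriv dirY (dirDeriv dirY (dirDeriv dirY g)) y),
    dirDeriv dirX (dirDeriv dirX (dirDeriv dirX g)) y
        + dirDeriv dirX (dirDeriv dirY (dirDeriv dirY g)) y,
    2 * dirDeriv dirX (dirDeriv dirY (dirDeriv dirT g)) y,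
    dirDeriv dirY (dirDeriv dirY (dirDeriv dirT g)) y
        - dirDeriv dirX (dirDeriv dirX (dirDeriv dirT g)) y]

theorem continuous_waveOp {g : SpaceTime → ℝ} (hg : Smooth g) : Continuous (waveOp g) := by
  have h : ∀ a b c, Continuous (dirDeriv a (dirDeriv b (dirDeriv c g))) :=
    fun a b c => (((hg.dirDeriv c).dirDeriv b).dirDeriv a).continuous
  unfold waveOp
  refine (PiLp.continuous_toLp 2 _).comp ?_
  refine continuous_pi fun i => ?_
  fin_cases i
  · exact ((h _ _ _).add (h _ _ _)).neg
  · exact (h _ _ _).add (h _ _ _)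
  · exact continuous_const.mul (h _ _ _)
  · exact (h _ _ _).sub (h _ _ _)

theorem waveOp_eq_zero {g : SpaceTime → ℝ} {y : SpaceTime} (hy : y ∉ tsupport g) :
    waveOp g y = 0 := by
  have h : ∀ a b c, dirDeriv a (dirDeriv b (dirDeriv c g)) y = 0 := fun a b c => by
    by_contra h0
    exact hy (tsupport_dirDeriv_subset _ _ (tsupport_dirDeriv_subset _ _
      (tsupport_dirDeriv_subset _ _ (subset_tsupport _ h0))))
  ext i
  fin_cases i <;> simp [waveOp, h]

theorem waveOp_add {f g : SpaceTime → ℝ} (hf : Smooth f) (hg : Smooth g) (y : SpaceTime) :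
    waveOp (fun y => f y + g y) y = waveOp f y + waveOp g y := by
  have h : ∀ a b c, dirDeriv a (dirDeriv b (dirDeriv c (fun y => f y + g y))) y
      = dirDeriv a (dirDeriv b (dirDeriv c f)) y + dirDeriv a (dirDeriv b (dirDeriv c g)) y :=
    fun a b c => by
      rw [dirDeriv_add hf hg, dirDeriv_add (hf.dirDeriv c) (hg.dirDeriv c),
        dirDeriv_add ((hf.dirDeriv c).dirDeriv b) ((hg.dirDeriv c).dirDeriv b)]
  ext i
  fin_cases i <;> simp [waveOp, h] <;> ring

theorem hasCompactSupport_waveOp {g : SpaceTime → ℝ} (hc : HasCompactSupport g) :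
    HasCompactSupport (waveOp g) :=
  HasCompactSupport.intro hc fun _ hy => waveOp_eq_zero hy

/-- `ζ = (v, u)` solves `div v = 0` and `∂_t v + div u = 0` in the sense of distributions. -/
def IsDistribSolution (ζ : SpaceTime → State) : Prop :=
  ∀ φ : SpaceTime → ℝ, IsTest φ →
    (∫ y, (ζ y 0 * dirDeriv dirX φ y + ζ y 1 * dirDeriv dirY φ y) = 0) ∧
    (∫ y, (ζ y 0 * dirDeriv dirT φ y + ζ y 2 * dirDeriv dirX φ y + ζ y 3 * dirDeriv dirY φ y)
      = 0) ∧
    (∫ y, (ζ y 1 * dirDeriv dirT φ y + ζ y 3 * dirDeriv dirX φ y - ζ y 2 * dirDeriv dirY φ y)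
      = 0)

theorem isDistribSolution_waveOp {g : SpaceTime → ℝ} (hg : Smooth g) :
    IsDistribSolution (waveOp g) := by
  rintro φ ⟨hφ, hc⟩
  replace hφ : Smooth φ := hφ
  have key : ∀ {f₁ f₂ f₃ : SpaceTime → ℝ}, Smooth f₁ → Smooth f₂ → Smooth f₃ →
      (∀ y, dirDeriv dirT f₁ y + dirDeriv dirX f₂ y + dirDeriv dirY f₃ y = 0) →
      ∫ y, (f₁ y * dirDeriv dirT φ y + f₂ y * dirDeriv dirX φ y + f₃ y * dirDeriv dirY φ y)
        = 0 := by
    intro f₁ f₂ f₃ h₁ h₂ h₃ h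
    have hi : ∀ {f : SpaceTime → ℝ} (w : SpaceTime), Smooth f →
        Integrable (fun y => f y * dirDeriv w φ y) := fun w hf =>
      (hf.continuous.mul (hφ.dirDeriv w).continuous).integrable_of_hasCompactSupport
        ((hasCompactSupport_dirDeriv hc w).mul_left)
    have hj : ∀ {f : SpaceTime → ℝ} (w : SpaceTime), Smooth f →
        Integrable (fun y => dirDeriv w f y * φ y) := fun w hf =>
      ((hf.dirDeriv w).continuous.mul hφ.continuous).integrable_of_hasCompactSupport hc.mul_left
    have h12 := (hi dirT h₁).add (hi dirX h₂)
    have h12' := (hj dirT h₁).add (hj dirX h₂)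
    simp only [Pi.add_def] at h12 h12'
    rw [integral_add h12 (hi _ h₃), integral_add (hi _ h₁) (hi _ h₂),
      integral_mul_dirDeriv h₁ hφ hc, integral_mul_dirDeriv h₂ hφ hc,
      integral_mul_dirDeriv h₃ hφ hc, ← neg_add, ← neg_add,
      ← integral_add (hj _ h₁) (hj _ h₂), ← integral_add h12' (hj _ h₃)]
    simp only [← add_mul, h, zero_mul, integral_zero, neg_zero]
  have h3 : ∀ a b c, Smooth (dirDeriv a (dirDeriv b (dirDeriv c g))) :=
    fun a b c => ((hg.dirDeriv c).dirDeriv b).dirDeriv a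
  have s0 : Smooth fun y => waveOp g y 0 := ((h3 _ _ _).add (h3 _ _ _)).neg
  have s1 : Smooth fun y => waveOp g y 1 := (h3 _ _ _).add (h3 _ _ _)
  have s2 : Smooth fun y => waveOp g y 2 := contDiff_const.mul (h3 _ _ _)
  have s3 : Smooth fun y => waveOp g y 3 := (h3 _ _ _).sub (h3 _ _ _)
  have d0 : ∀ w, dirDeriv w (fun y => waveOp g y 0) = fun y =>
      -1 * (dirDeriv w (dirDeriv dirY (dirDeriv dirX (dirDeriv dirX g))) y
        + dirDeriv w (dirDeriv dirY (dirDeriv dirY (dirDeriv dirY g))) y) := fun w => by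
    have := dirDeriv_const_mul ((h3 dirY dirX dirX).add (h3 dirY dirY dirY)) (-1) w
    rw [dirDeriv_add (h3 _ _ _) (h3 _ _ _)] at this
    rw [← this]
    congr 1; funext y; simp [waveOp]
  have d1 : ∀ w, dirDeriv w (fun y => waveOp g y 1) = fun y =>
      (dirDeriv w (dirDeriv dirX (dirDeriv dirX (dirDeriv dirX g))) y
        + dirDeriv w (dirDeriv dirX (dirDeriv dirY (dirDeriv dirY g))) y) := fun w => by
    rw [← dirDeriv_add (h3 _ _ _) (h3 _ _ _)]
    congr 1
  have d2 : ∀ w, dirDeriv w (fun y => waveOp g y 2) = fun y =>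
      2 * dirDeriv w (dirDeriv dirX (dirDeriv dirY (dirDeriv dirT g))) y := fun w => by
    rw [← dirDeriv_const_mul (h3 _ _ _)]
    congr 1
  have d3 : ∀ w, dirDeriv w (fun y => waveOp g y 3) = fun y =>
      (dirDeriv w (dirDeriv dirY (dirDeriv dirY (dirDeriv dirT g))) y
        + -1 * dirDeriv w (dirDeriv dirX (dirDeriv dirX (dirDeriv dirT g))) y) := fun w => by
    have := dirDeriv_add (h3 dirY dirY dirT) (contDiff_const.mul (h3 dirX dirX dirT) (f := fun _ => -1)) w
    rw [dirDeriv_const_mul (h3 _ _ _)] at this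
    rw [← this]
    congr 1; funext y; simp [waveOp]; ring
  have d2' : dirDeriv dirY (fun y => -1 * waveOp g y 2) = fun y =>
      -1 * (2 * dirDeriv dirY (dirDeriv dirX (dirDeriv dirY (dirDeriv dirT g))) y) := by
    rw [dirDeriv_const_mul s2, d2]
  have hz : Smooth fun _ : SpaceTime => (0 : ℝ) := contDiff_const
  have dz : ∀ w y, dirDeriv w (fun _ : SpaceTime => (0 : ℝ)) y = 0 := fun w y => by
    simp [dirDeriv]
  have c1 := dirDeriv_comm hg dirX dirY
  have c2 := dirDeriv_comm hg dirX dirT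
  have c3 := dirDeriv_comm hg dirY dirT
  have e1 : ∀ c, dirDeriv dirX (dirDeriv dirY (dirDeriv c g))
      = dirDeriv dirY (dirDeriv dirX (dirDeriv c g)) :=
    fun c => dirDeriv_comm (hg.dirDeriv c) _ _
  have e2 : ∀ c, dirDeriv dirX (dirDeriv dirT (dirDeriv c g))
      = dirDeriv dirT (dirDeriv dirX (dirDeriv c g)) :=
    fun c => dirDeriv_comm (hg.dirDeriv c) _ _
  have e3 : ∀ c, dirDeriv dirY (dirDeriv dirT (dirDeriv c g))
      = dirDeriv dirT (dirDeriv dirY (dirDeriv c g)) :=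
    fun c => dirDeriv_comm (hg.dirDeriv c) _ _
  have f1 : ∀ b c, dirDeriv dirX (dirDeriv dirY (dirDeriv b (dirDeriv c g)))
      = dirDeriv dirY (dirDeriv dirX (dirDeriv b (dirDeriv c g))) :=
    fun b c => dirDeriv_comm ((hg.dirDeriv c).dirDeriv b) _ _
  have f2 : ∀ b c, dirDeriv dirX (dirDeriv dirT (dirDeriv b (dirDeriv c g)))
      = dirDeriv dirT (dirDeriv dirX (dirDeriv b (dirDeriv c g))) :=
    fun b c => dirDeriv_comm ((hg.dirDeriv c).dirDeriv b) _ _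
  have f3 : ∀ b c, dirDeriv dirY (dirDeriv dirT (dirDeriv b (dirDeriv c g)))
      = dirDeriv dirT (dirDeriv dirY (dirDeriv b (dirDeriv c g))) :=
    fun b c => dirDeriv_comm ((hg.dirDeriv c).dirDeriv b) _ _
  refine ⟨?_, ?_, ?_⟩
  · have := key hz s0 s1 fun y => by
      rw [d0, d1, dz]; simp only [c1, e1, f1]; ring
    simpa using this
  · exact key s0 s2 s3 fun y => by
      rw [d0, d2, d3]; simp only [c1, c2, c3, e1, e2, e3, f2, f3]; ring
  · have := key s1 s3 (contDiff_const.mul s2) fun y => by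
      rw [d1, d3, d2']; simp only [c1, c2, c3, e1, e2, e3, f2, f3]; ring
    convert this using 2
    funext y; ring

theorem smooth_sin_mul (ℓ : SpaceTime →L[ℝ] ℝ) (N : ℝ) : Smooth fun y => Real.sin (N * ℓ y) :=
  Real.contDiff_sin.comp (contDiff_const.mul ℓ.contDiff)

theorem smooth_cos_mul (ℓ : SpaceTime →L[ℝ] ℝ) (N : ℝ) : Smooth fun y => Real.cos (N * ℓ y) :=
  Real.contDiff_cos.comp (contDiff_const.mul ℓ.contDiff)

theorem dirDeriv_mul_sin {ψ : SpaceTime → ℝ} (hψ : Smooth ψ) (ℓ : SpaceTime →L[ℝ] ℝ) (N : ℝ)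
    (w : SpaceTime) :
    dirDeriv w (fun y => ψ y * Real.sin (N * ℓ y)) = fun y =>
      dirDeriv w ψ y * Real.sin (N * ℓ y) + N * ℓ w * (ψ y * Real.cos (N * ℓ y)) := by
  funext y
  have h1 : HasFDerivAt (fun y => N * ℓ y) (N • ℓ) y := ℓ.hasFDerivAt.const_mul N
  have h2 := (hψ.differentiableAt y).hasFDerivAt.fun_mul h1.sin
  simp only [dirDeriv]
  rw [h2.fderiv]
  simp
  ring

theorem dirDeriv_mul_cos {ψ : SpaceTime → ℝ} (hψ : Smooth ψ) (ℓ : SpaceTime →L[ℝ] ℝ) (N : ℝ)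
    (w : SpaceTime) :
    dirDeriv w (fun y => ψ y * Real.cos (N * ℓ y)) = fun y =>
      dirDeriv w ψ y * Real.cos (N * ℓ y) + -(N * ℓ w) * (ψ y * Real.sin (N * ℓ y)) := by
  funext y
  have h1 : HasFDerivAt (fun y => N * ℓ y) (N • ℓ) y := ℓ.hasFDerivAt.const_mul N
  have h2 := (hψ.differentiableAt y).hasFDerivAt.fun_mul h1.cos
  simp only [dirDeriv]
  rw [h2.fderiv]
  simp
  ring

theorem dirDeriv_dirDeriv_mul_sin {ψ : SpaceTime → ℝ} (hψ : Smooth ψ) (ℓ : SpaceTime →L[ℝ] ℝ)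
    (N : ℝ) (b c : SpaceTime) :
    dirDeriv b (dirDeriv c fun y => ψ y * Real.sin (N * ℓ y)) = fun y =>
      (dirDeriv b (dirDeriv c ψ) y * Real.sin (N * ℓ y)
          + N * ℓ b * (dirDeriv c ψ y * Real.cos (N * ℓ y)))
        + N * ℓ c * (dirDeriv b ψ y * Real.cos (N * ℓ y)
          + -(N * ℓ b) * (ψ y * Real.sin (N * ℓ y))) := by
  have hs := smooth_sin_mul ℓ N
  have hk := smooth_cos_mul ℓ N
  rw [dirDeriv_mul_sin hψ, dirDeriv_add ((hψ.dirDeriv c).mul hs)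
    (contDiff_const.mul (hψ.mul hk)), dirDeriv_const_mul (hψ.mul hk),
    dirDeriv_mul_sin (hψ.dirDeriv c), dirDeriv_mul_cos hψ]

theorem dirDeriv₃_mul_sin {ψ : SpaceTime → ℝ} (hψ : Smooth ψ) (ℓ : SpaceTime →L[ℝ] ℝ)
    (N : ℝ) (a b c y : SpaceTime) :
    dirDeriv a (dirDeriv b (dirDeriv c fun y => ψ y * Real.sin (N * ℓ y))) y =
      dirDeriv a (dirDeriv b (dirDeriv c ψ)) y * Real.sin (N * ℓ y)
        + N * (ℓ a * dirDeriv b (dirDeriv c ψ) y + ℓ b * dirDeriv a (dirDeriv c ψ) y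
          + ℓ c * dirDeriv a (dirDeriv b ψ) y) * Real.cos (N * ℓ y)
        - N ^ 2 * (ℓ a * ℓ b * dirDeriv c ψ y + ℓ a * ℓ c * dirDeriv b ψ y
          + ℓ b * ℓ c * dirDeriv a ψ y) * Real.sin (N * ℓ y)
        - N ^ 3 * (ℓ a * ℓ b * ℓ c) * ψ y * Real.cos (N * ℓ y) := by
  have hs := smooth_sin_mul ℓ N
  have hk := smooth_cos_mul ℓ N
  have h1 : ∀ w, Smooth fun y => dirDeriv w ψ y * Real.cos (N * ℓ y) :=
    fun w => (hψ.dirDeriv w).mul hk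
  have h0 : Smooth fun y => ψ y * Real.sin (N * ℓ y) := hψ.mul hs
  have h2 : Smooth fun y => dirDeriv b (dirDeriv c ψ) y * Real.sin (N * ℓ y) :=
    ((hψ.dirDeriv c).dirDeriv b).mul hs
  have h3 : Smooth fun y => N * ℓ b * (dirDeriv c ψ y * Real.cos (N * ℓ y)) :=
    contDiff_const.mul (h1 c)
  have h4 : Smooth fun y => -(N * ℓ b) * (ψ y * Real.sin (N * ℓ y)) := contDiff_const.mul h0
  rw [dirDeriv_dirDeriv_mul_sin hψ, dirDeriv_add (h2.add h3) (contDiff_const.mul ((h1 b).add h4)),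
    dirDeriv_add h2 h3, dirDeriv_const_mul ((h1 b).add h4), dirDeriv_add (h1 b) h4,
    dirDeriv_const_mul (h1 c), dirDeriv_const_mul h0, dirDeriv_mul_sin hψ,
    dirDeriv_mul_cos (hψ.dirDeriv b), dirDeriv_mul_cos (hψ.dirDeriv c),
    dirDeriv_mul_sin ((hψ.dirDeriv c).dirDeriv b)]
  ring

/-- A localized plane-wave potential with frequency `N`, phase `ℓ` and cutoff `χ`. -/
def wavePotential (χ : SpaceTime → ℝ) (ℓ : SpaceTime →L[ℝ] ℝ) (N : ℝ) (y : SpaceTime) : ℝ :=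
  -(N ^ 3)⁻¹ * (χ y * Real.sin (N * ℓ y))

theorem smooth_wavePotential {χ : SpaceTime → ℝ} (hχ : Smooth χ) (ℓ : SpaceTime →L[ℝ] ℝ)
    (N : ℝ) : Smooth (wavePotential χ ℓ N) :=
  contDiff_const.mul (hχ.mul (smooth_sin_mul ℓ N))

theorem tsupport_wavePotential_subset (χ : SpaceTime → ℝ) (ℓ : SpaceTime →L[ℝ] ℝ) (N : ℝ) :
    tsupport (wavePotential χ ℓ N) ⊆ tsupport χ := by
  refine closure_mono fun y hy hχ => hy ?_
  simp [wavePotential, hχ]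

theorem exists_bound_of_smooth {χ : SpaceTime → ℝ} (hχ : Smooth χ) (hc : HasCompactSupport χ) :
    ∃ K : ℝ, 0 ≤ K ∧ ∀ y, |χ y| ≤ K := by
  obtain ⟨K, hK⟩ := hc.exists_bound_of_continuous hχ.continuous
  exact ⟨K, (abs_nonneg _).trans (hK 0), hK⟩

theorem exists_dirDeriv₃_wavePotential_bound {χ : SpaceTime → ℝ} (hχ : Smooth χ)
    (hc : HasCompactSupport χ) (ℓ : SpaceTime →L[ℝ] ℝ) (a b c : SpaceTime) :
    ∃ B : ℝ, ∀ N : ℝ, 1 ≤ N → ∀ y,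
      |dirDeriv a (dirDeriv b (dirDeriv c (wavePotential χ ℓ N))) y
        - ℓ a * ℓ b * ℓ c * (χ y * Real.cos (N * ℓ y))| ≤ B / N := by
  have hc1 : ∀ w, HasCompactSupport (dirDeriv w χ) := hasCompactSupport_dirDeriv hc
  have hc2 : ∀ w v, HasCompactSupport (dirDeriv w (dirDeriv v χ)) :=
    fun w v => hasCompactSupport_dirDeriv (hc1 v) w
  have hs2 : ∀ w v, Smooth (dirDeriv w (dirDeriv v χ)) := fun w v => (hχ.dirDeriv v).dirDeriv w
  obtain ⟨Ka, -, ha⟩ := exists_bound_of_smooth (hχ.dirDeriv a) (hc1 a)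
  obtain ⟨Kb, -, hb⟩ := exists_bound_of_smooth (hχ.dirDeriv b) (hc1 b)
  obtain ⟨Kc, -, hc'⟩ := exists_bound_of_smooth (hχ.dirDeriv c) (hc1 c)
  obtain ⟨Kbc, -, hbc⟩ := exists_bound_of_smooth (hs2 b c) (hc2 b c)
  obtain ⟨Kac, -, hac⟩ := exists_bound_of_smooth (hs2 a c) (hc2 a c)
  obtain ⟨Kab, -, hab⟩ := exists_bound_of_smooth (hs2 a b) (hc2 a b)
  obtain ⟨Kabc, -, habc⟩ := exists_bound_of_smooth ((hs2 b c).dirDeriv a)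
    (hasCompactSupport_dirDeriv (hc2 b c) a)
  refine ⟨Kabc + (|ℓ a| * Kbc + |ℓ b| * Kac + |ℓ c| * Kab)
    + (|ℓ a| * |ℓ b| * Kc + |ℓ a| * |ℓ c| * Kb + |ℓ b| * |ℓ c| * Ka), fun N hN y => ?_⟩
  have hN0 : 0 < N := by linarith
  have hu1 : N⁻¹ ≤ 1 := inv_le_one_of_one_le₀ hN
  have hu0 : 0 < N⁻¹ := inv_pos.2 hN0
  have hps : Smooth fun y => χ y * Real.sin (N * ℓ y) := hχ.mul (smooth_sin_mul ℓ N)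
  have hpw : wavePotential χ ℓ N = fun y => -(N ^ 3)⁻¹ * (χ y * Real.sin (N * ℓ y)) := rfl
  rw [hpw, dirDeriv_const_mul hps, dirDeriv_const_mul (hps.dirDeriv c),
    dirDeriv_const_mul ((hps.dirDeriv c).dirDeriv b)]
  beta_reduce
  rw [dirDeriv₃_mul_sin hχ]
  have hs := Real.abs_sin_le_one (N * ℓ y)
  have hk := Real.abs_cos_le_one (N * ℓ y)
  set s := Real.sin (N * ℓ y)
  set k := Real.cos (N * ℓ y)
  have hmul : ∀ {p q r : ℝ}, |p| ≤ r → |q| ≤ 1 → |p * q| ≤ r := fun {p q r} hp hq => by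
    rw [abs_mul]
    nlinarith [abs_nonneg p, abs_nonneg q]
  have e1 : |dirDeriv a (dirDeriv b (dirDeriv c χ)) y * (N⁻¹ ^ 2 * s)| ≤ Kabc := by
    refine hmul (habc y) ?_
    rw [abs_mul, abs_of_nonneg (by positivity)]
    exact mul_le_one₀ (pow_le_one₀ hu0.le hu1) (abs_nonneg _) hs
  have e2 : |(ℓ a * dirDeriv b (dirDeriv c χ) y + ℓ b * dirDeriv a (dirDeriv c χ) y
          + ℓ c * dirDeriv a (dirDeriv b χ) y) * (N⁻¹ * k)|
      ≤ |ℓ a| * Kbc + |ℓ b| * Kac + |ℓ c| * Kab := by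
    refine hmul ?_ ?_
    · refine (abs_add_three _ _ _).trans ?_
      rw [abs_mul, abs_mul, abs_mul]
      gcongr
      exacts [hbc y, hac y, hab y]
    · rw [abs_mul, abs_of_nonneg hu0.le]
      exact mul_le_one₀ hu1 (abs_nonneg _) hk
  have e3 : |(ℓ a * ℓ b * dirDeriv c χ y + ℓ a * ℓ c * dirDeriv b χ y
          + ℓ b * ℓ c * dirDeriv a χ y) * s|
      ≤ |ℓ a| * |ℓ b| * Kc + |ℓ a| * |ℓ c| * Kb + |ℓ b| * |ℓ c| * Ka := by
    refine hmul ?_ hs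
    refine (abs_add_three _ _ _).trans ?_
    simp only [abs_mul]
    gcongr
    exacts [hc' y, hb y, ha y]
  rw [div_eq_mul_inv, mul_comm _ N⁻¹]
  have e := mul_le_mul_of_nonneg_left (add_le_add (add_le_add e1 e2) e3) hu0.le
  refine le_trans ?_ e
  rw [← abs_neg (_ * s)]
  refine le_trans (le_of_eq ?_) (mul_le_mul_of_nonneg_left (abs_add_three _ _ _) hu0.le)
  conv_rhs => rw [← abs_of_pos hu0, ← abs_mul, ← abs_neg]
  rw [abs_of_pos hu0]
  congr 1
  field_simp
  ring

/-- The amplitude of the plane waves with phase `ℓ`. -/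
def waveAmp (ℓ : SpaceTime →L[ℝ] ℝ) : State :=
  !₂[-(ℓ dirY * ℓ dirX * ℓ dirX + ℓ dirY * ℓ dirY * ℓ dirY),
    ℓ dirX * ℓ dirX * ℓ dirX + ℓ dirX * ℓ dirY * ℓ dirY,
    2 * (ℓ dirX * ℓ dirY * ℓ dirT),
    ℓ dirY * ℓ dirY * ℓ dirT - ℓ dirX * ℓ dirX * ℓ dirT]

theorem State.norm_le_of_abs_le {z : State} {r : ℝ} (h : ∀ i, |z i| ≤ r) : ‖z‖ ≤ 2 * r := by
  have hr : 0 ≤ r := (abs_nonneg _).trans (h 0)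
  rw [EuclideanSpace.norm_eq]
  refine Real.sqrt_le_iff.2 ⟨by positivity, ?_⟩
  calc ∑ i, ‖z i‖ ^ 2 ≤ ∑ _i : Fin 4, r ^ 2 :=
        Finset.sum_le_sum fun i _ => pow_le_pow_left₀ (norm_nonneg _) (h i) 2
    _ = (2 * r) ^ 2 := by simp; ring

theorem exists_waveOp_wavePotential_bound {χ : SpaceTime → ℝ} (hχ : Smooth χ)
    (hc : HasCompactSupport χ) (ℓ : SpaceTime →L[ℝ] ℝ) :
    ∃ B : ℝ, ∀ N : ℝ, 1 ≤ N → ∀ y,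
      ‖waveOp (wavePotential χ ℓ N) y - (χ y * Real.cos (N * ℓ y)) • waveAmp ℓ‖ ≤ B / N := by
  have h := exists_dirDeriv₃_wavePotential_bound hχ hc ℓ
  choose B hB using h
  set M := ∑ a ∈ ({dirX, dirY, dirT} : Finset SpaceTime),
    ∑ b ∈ ({dirX, dirY, dirT} : Finset SpaceTime),
    ∑ c ∈ ({dirX, dirY, dirT} : Finset SpaceTime), |B a b c| with hM
  have hle : ∀ a b c, a ∈ ({dirX, dirY, dirT} : Finset SpaceTime) →
      b ∈ ({dirX, dirY, dirT} : Finset SpaceTime) →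
      c ∈ ({dirX, dirY, dirT} : Finset SpaceTime) → B a b c ≤ M := by
    intro a b c ha hb hc
    refine (le_abs_self _).trans ?_
    refine (Finset.single_le_sum (f := fun c => |B a b c|) (fun _ _ => abs_nonneg _) hc).trans ?_
    refine (Finset.single_le_sum (f := fun b => ∑ c ∈ ({dirX, dirY, dirT} : Finset SpaceTime),
      |B a b c|) (fun _ _ => Finset.sum_nonneg fun _ _ => abs_nonneg _) hb).trans ?_
    exact Finset.single_le_sum (f := fun a => ∑ b ∈ ({dirX, dirY, dirT} : Finset SpaceTime),
      ∑ c ∈ ({dirX, dirY, dirT} : Finset SpaceTime), |B a b c|)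
      (fun _ _ => Finset.sum_nonneg fun _ _ => Finset.sum_nonneg fun _ _ => abs_nonneg _) ha
  refine ⟨2 * (2 * M), fun N hN y => ?_⟩
  have hN0 : 0 < N := by linarith
  have hB' : ∀ a b c, a ∈ ({dirX, dirY, dirT} : Finset SpaceTime) →
      b ∈ ({dirX, dirY, dirT} : Finset SpaceTime) →
      c ∈ ({dirX, dirY, dirT} : Finset SpaceTime) →
      |dirDeriv a (dirDeriv b (dirDeriv c (wavePotential χ ℓ N))) y
        - ℓ a * ℓ b * ℓ c * (χ y * Real.cos (N * ℓ y))| ≤ M / N := fun a b c ha hb hc =>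
    (hB a b c N hN y).trans (div_le_div_of_nonneg_right (hle a b c ha hb hc) hN0.le)
  rw [mul_div_assoc]
  refine State.norm_le_of_abs_le fun i => ?_
  rw [mul_div_assoc]
  have h1 := abs_le.1 (hB' dirY dirX dirX (by simp) (by simp) (by simp))
  have h2 := abs_le.1 (hB' dirY dirY dirY (by simp) (by simp) (by simp))
  have h3 := abs_le.1 (hB' dirX dirX dirX (by simp) (by simp) (by simp))
  have h4 := abs_le.1 (hB' dirX dirY dirY (by simp) (by simp) (by simp))
  have h5 := abs_le.1 (hB' dirX dirY dirT (by simp) (by simp) (by simp))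
  have h6 := abs_le.1 (hB' dirY dirY dirT (by simp) (by simp) (by simp))
  have h7 := abs_le.1 (hB' dirX dirX dirT (by simp) (by simp) (by simp))
  refine abs_le.2 ?_
  fin_cases i <;> simp [waveOp, waveAmp] <;> constructor <;> linarith

/-- The energy gap `C - |v|²`. -/
def gap (C : ℝ) (z : State) : ℝ := C - z 0 ^ 2 - z 1 ^ 2

/-- The square norm of the trace-free part of `u - v ⊗ v`. -/
def defect (z : State) : ℝ := (z 2 - (z 0 ^ 2 - z 1 ^ 2) / 2) ^ 2 + (z 3 - z 0 * z 1) ^ 2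

/-- The states with `v ⊗ v - u < C / 2`. -/
def subStates (C : ℝ) : Set State := {z | 0 < gap C z ∧ defect z < (gap C z / 2) ^ 2}

theorem continuous_gap (C : ℝ) : Continuous (gap C) := by
  unfold gap; fun_prop

theorem continuous_defect : Continuous defect := by
  unfold defect; fun_prop

theorem isOpen_subStates (C : ℝ) : IsOpen (subStates C) :=
  (isOpen_lt continuous_const (continuous_gap C)).inter
    (isOpen_lt continuous_defect (((continuous_gap C).div_const 2).pow 2))

theorem defect_nonneg (z : State) : 0 ≤ defect z := by unfold defect; positivity

theorem gap_le (C : ℝ) (z : State) : gap C z ≤ C := by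
  unfold gap; nlinarith [sq_nonneg (z 0), sq_nonneg (z 1)]

theorem pos_of_mem_subStates {C : ℝ} {z : State} (hz : z ∈ subStates C) : 0 < C :=
  hz.1.trans_le (gap_le C z)

theorem norm_le_of_mem_subStates {C : ℝ} {z : State} (hz : z ∈ subStates C) :
    ‖z‖ ≤ 2 * (C + 1) := by
  have hC := pos_of_mem_subStates hz
  obtain ⟨h1, h2⟩ := hz
  have h3 : z 0 ^ 2 + z 1 ^ 2 ≤ C := by unfold gap at h1; linarith
  have hT := gap_le C z
  have h4 : |z 2 - (z 0 ^ 2 - z 1 ^ 2) / 2| ≤ gap C z / 2 :=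
    abs_le_of_sq_le_sq (by unfold defect at h2; nlinarith [sq_nonneg (z 3 - z 0 * z 1)])
      (by linarith)
  have h5 : |z 3 - z 0 * z 1| ≤ gap C z / 2 :=
    abs_le_of_sq_le_sq (by
      unfold defect at h2; nlinarith [sq_nonneg (z 2 - (z 0 ^ 2 - z 1 ^ 2) / 2)]) (by linarith)
  rw [abs_le] at h4 h5
  refine State.norm_le_of_abs_le fun i => ?_
  rw [abs_le]
  fin_cases i
  · constructor <;> simp <;> nlinarith [sq_nonneg (z 1)]
  · constructor <;> simp <;> nlinarith [sq_nonneg (z 0)]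
  · constructor <;> simp <;> nlinarith [sq_nonneg (z 0), sq_nonneg (z 1)]
  · constructor <;> simp <;>
      nlinarith [sq_nonneg (z 0), sq_nonneg (z 1), sq_nonneg (z 0 - z 1), sq_nonneg (z 0 + z 1)]

/-- The linear phase `w₂ x₁ - w₁ x₂ + τ t`. -/
def phase (w₁ w₂ τ : ℝ) : SpaceTime →L[ℝ] ℝ :=
  (w₂ • (ContinuousLinearMap.proj 0 : (Fin 2 → ℝ) →L[ℝ] ℝ)
    - w₁ • (ContinuousLinearMap.proj 1 : (Fin 2 → ℝ) →L[ℝ] ℝ)).comp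
      (ContinuousLinearMap.fst ℝ (Fin 2 → ℝ) ℝ) + τ • ContinuousLinearMap.snd ℝ (Fin 2 → ℝ) ℝ

theorem waveAmp_phase {w₁ w₂ : ℝ} (hw : w₁ ^ 2 + w₂ ^ 2 = 1) (τ : ℝ) :
    waveAmp (phase w₁ w₂ τ) = !₂[w₁, w₂, -2 * w₁ * w₂ * τ, (w₁ ^ 2 - w₂ ^ 2) * τ] := by
  ext i
  fin_cases i <;> simp [waveAmp, phase, dirX, dirY, dirT]
  · linear_combination w₁ * hw
  · linear_combination w₂ * hw
  · ring
  · ring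

set_option maxHeartbeats 1000000 in
/-- Every strict subsolution state is the midpoint of a segment in a wave direction, whose length
is controlled by the energy gap. -/
theorem exists_wave_segment {C : ℝ} {z : State} (hz : z ∈ subStates C) :
    ∃ (ℓ : SpaceTime →L[ℝ] ℝ) (s : ℝ), ℓ ≠ 0 ∧
      (∀ σ : ℝ, |σ| ≤ 1 → z + σ • s • waveAmp ℓ ∈ subStates C) ∧
      gap C z ^ 2 / (64 * C) ≤ ‖s • waveAmp ℓ‖ ^ 2 := by
  have hC := pos_of_mem_subStates hz
  obtain ⟨hT, hD⟩ := hz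
  set A := z 2 - (z 0 ^ 2 - z 1 ^ 2) / 2 with hA
  set B := z 3 - z 0 * z 1 with hB
  set R := ‖(⟨A, B⟩ : ℂ)‖ with hR
  set θ := Complex.arg ⟨A, B⟩ with hθ
  have hRA : A = R * Real.cos θ := (Complex.norm_mul_cos_arg ⟨A, B⟩).symm
  have hRB : B = R * Real.sin θ := (Complex.norm_mul_sin_arg ⟨A, B⟩).symm
  set w₁ := Real.cos (θ / 2) with hw1
  set w₂ := Real.sin (θ / 2) with hw2
  have hw : w₁ ^ 2 + w₂ ^ 2 = 1 := Real.cos_sq_add_sin_sq _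
  have hc : Real.cos θ = w₁ ^ 2 - w₂ ^ 2 := by
    rw [show θ = 2 * (θ / 2) by ring, Real.cos_two_mul']
  have hs : Real.sin θ = 2 * w₁ * w₂ := by
    rw [show θ = 2 * (θ / 2) by ring, Real.sin_two_mul]; ring
  have hR0 : 0 ≤ R := norm_nonneg _
  have hcs : (w₁ ^ 2 - w₂ ^ 2) ^ 2 + (2 * w₁ * w₂) ^ 2 = 1 := by
    rw [show (1 : ℝ) = (w₁ ^ 2 + w₂ ^ 2) ^ 2 by rw [hw]; ring]; ring
  have hRT : R < gap C z / 2 := by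
    refine lt_of_pow_lt_pow_left₀ 2 (by linarith) (lt_of_eq_of_lt ?_ hD)
    unfold defect
    rw [← hA, ← hB, hRA, hRB, hc, hs]
    linear_combination (-R ^ 2) * hcs
  set τ := -z 0 * w₂ + z 1 * w₁ with hτ
  set α := z 0 * w₁ + z 1 * w₂ with hα
  have hz0 : z 0 = α * w₁ - τ * w₂ := by rw [hα, hτ]; linear_combination (-z 0) * hw
  have hz1 : z 1 = α * w₂ + τ * w₁ := by rw [hα, hτ]; linear_combination (-z 1) * hw
  set S := Real.sqrt C with hS
  have hS0 : 0 < S := Real.sqrt_pos.2 hC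
  have hSC : S ^ 2 = C := Real.sq_sqrt hC.le
  have hTC := gap_le C z
  have hvn : α ^ 2 + τ ^ 2 = z 0 ^ 2 + z 1 ^ 2 := by
    rw [hz0, hz1]; linear_combination (-(α ^ 2 + τ ^ 2)) * hw
  have hαS : |α| ≤ S := by
    refine abs_le_of_sq_le_sq ?_ hS0.le
    have hT' : 0 < C - z 0 ^ 2 - z 1 ^ 2 := hT
    rw [hSC]
    linarith [sq_nonneg τ]
  set s := gap C z / (8 * S) with hsdef
  have hs0 : 0 < s := by positivity
  have hsS : s * S = gap C z / 8 := by rw [hsdef]; field_simp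
  have hss : s ^ 2 ≤ gap C z / 64 := by
    have : s ≤ S / 8 := by
      rw [hsdef, div_le_div_iff₀ (by positivity) (by norm_num)]; nlinarith
    calc s ^ 2 = s * s := sq s
      _ ≤ s * (S / 8) := mul_le_mul_of_nonneg_left this hs0.le
      _ = s * S / 8 := by ring
      _ = gap C z / 64 := by rw [hsS]; ring
  refine ⟨phase w₁ w₂ τ, s, ?_, ?_, ?_⟩
  · intro h0
    have h1 : w₂ = 0 := by
      have := congrArg (fun f : SpaceTime →L[ℝ] ℝ => f dirX) h0
      simpa [phase, dirX] using this
    have h2 : w₁ = 0 := by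
      have := congrArg (fun f : SpaceTime →L[ℝ] ℝ => f dirY) h0
      simpa [phase, dirY] using this
    rw [h1, h2] at hw
    norm_num at hw
  · intro σ hσ
    set r := σ * s with hr
    have hrs : |r| ≤ s := by
      rw [hr, abs_mul, abs_of_pos hs0]; nlinarith
    have hrα : |r * α| ≤ gap C z / 8 := by
      rw [abs_mul, ← hsS]; exact mul_le_mul hrs hαS (abs_nonneg _) hs0.le
    have hr2 : r ^ 2 ≤ gap C z / 64 := by
      rw [← sq_abs r]
      exact (pow_le_pow_left₀ (abs_nonneg _) hrs 2).trans hss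
    set X := r * α + r ^ 2 / 2 with hX
    have hXT : X < gap C z / 4 := by
      have := le_abs_self (r * α)
      linarith
    rw [waveAmp_phase hw, smul_smul, ← hr]
    set z' := z + r • (!₂[w₁, w₂, -2 * w₁ * w₂ * τ, (w₁ ^ 2 - w₂ ^ 2) * τ] : State) with hz'
    have z0 : z' 0 = z 0 + r * w₁ := by simp [hz']
    have z1 : z' 1 = z 1 + r * w₂ := by simp [hz']
    have z2 : z' 2 = z 2 + r * (-2 * w₁ * w₂ * τ) := by simp [hz']
    have z3 : z' 3 = z 3 + r * ((w₁ ^ 2 - w₂ ^ 2) * τ) := by simp [hz']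
    have hg : gap C z' = gap C z - 2 * X := by
      unfold gap; rw [z0, z1, hX, hα]; linear_combination (-r ^ 2) * hw
    have hd : defect z' = (R - X) ^ 2 := by
      have eA : z' 2 - (z' 0 ^ 2 - z' 1 ^ 2) / 2 = (R - X) * (w₁ ^ 2 - w₂ ^ 2) := by
        have : z 2 = R * (w₁ ^ 2 - w₂ ^ 2) + (z 0 ^ 2 - z 1 ^ 2) / 2 := by
          rw [← hc, ← hRA, hA]; ring
        rw [z0, z1, z2, this, hz0, hz1, hX]; ring
      have eB : z' 3 - z' 0 * z' 1 = (R - X) * (2 * w₁ * w₂) := by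
        have : z 3 = R * (2 * w₁ * w₂) + z 0 * z 1 := by
          rw [← hs, ← hRB, hB]; ring
        rw [z0, z1, z3, this, hz0, hz1, hX]; ring
      unfold defect
      rw [eA, eB]
      linear_combination (R - X) ^ 2 * hcs
    refine ⟨by rw [hg]; linarith, ?_⟩
    rw [hd, hg]
    exact sq_lt_sq' (by linarith) (by linarith)
  · rw [waveAmp_phase hw, norm_smul, mul_pow, EuclideanSpace.norm_sq_eq, Real.norm_eq_abs, sq_abs]
    have : gap C z ^ 2 / (64 * C) = s ^ 2 := by
      rw [hsdef, ← hSC]; field_simp; ring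
    rw [this]
    simp [Fin.sum_univ_four]
    refine le_mul_of_one_le_right (by positivity) ?_
    nlinarith [sq_nonneg (2 * w₁ * w₂ * τ), sq_nonneg ((w₁ ^ 2 - w₂ ^ 2) * τ), abs_nonneg w₁]

/-- An integrable continuous positive weight on space-time. -/
def weight (y : SpaceTime) : ℝ := (1 + ‖y‖) ^ (-4 : ℝ)

theorem weight_pos (y : SpaceTime) : 0 < weight y := by
  exact Real.rpow_pos_of_pos (by positivity) _

theorem continuous_weight : Continuous weight := by
  unfold weight
  exact (continuous_const.add continuous_norm).rpow_const fun y =>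
    Or.inl (by have := norm_nonneg y; simp only [Pi.add_apply]; linarith)

theorem integrable_weight : Integrable weight := by
  have h : Module.finrank ℝ SpaceTime = 3 := by simp
  refine integrable_one_add_norm ?_
  rw [h]; norm_num

/-- The finite measure on space-time with density `weight`. -/
def weightMeasure : Measure SpaceTime :=
  volume.withDensity fun y => ENNReal.ofReal (weight y)

theorem measurable_ofReal_weight : Measurable fun y => ENNReal.ofReal (weight y) :=
  continuous_weight.measurable.ennreal_ofReal

instance isFiniteMeasure_weightMeasure : IsFiniteMeasure weightMeasure :=
  isFiniteMeasure_withDensity_ofReal integrable_weight.2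

theorem integral_weightMeasure {E : Type*} [NormedAddCommGroup E] [NormedSpace ℝ E]
    (f : SpaceTime → E) : ∫ y, f y ∂weightMeasure = ∫ y, weight y • f y := by
  rw [weightMeasure, integral_withDensity_eq_integral_toReal_smul measurable_ofReal_weight (by simp)]
  simp [ENNReal.toReal_ofReal (weight_pos _).le]

theorem setIntegral_weightMeasure {s : Set SpaceTime} (hs : MeasurableSet s) (f : SpaceTime → ℝ) :
    ∫ y in s, f y ∂weightMeasure = ∫ y in s, weight y * f y := by
  rw [← integral_indicator hs, integral_weightMeasure, ← integral_indicator hs]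
  congr 1; funext y
  by_cases hy : y ∈ s <;> simp [hy]

theorem integrable_weightMeasure_iff {E : Type*} [NormedAddCommGroup E] [NormedSpace ℝ E]
    {f : SpaceTime → E} : Integrable f weightMeasure ↔ Integrable fun y => weight y • f y := by
  rw [weightMeasure, integrable_withDensity_iff_integrable_smul' measurable_ofReal_weight (by simp)]
  simp [ENNReal.toReal_ofReal (weight_pos _).le]

theorem volume_absolutelyContinuous_weightMeasure : volume ≪ weightMeasure :=
  withDensity_absolutelyContinuous' measurable_ofReal_weight.aemeasurable
    (Filter.Eventually.of_forall fun y => by simpa using weight_pos y)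

theorem tendsto_integral_cos_mul_volume {f : SpaceTime → ℝ} (hf : Integrable f)
    {ℓ : SpaceTime →L[ℝ] ℝ} (hℓ : ℓ ≠ 0) :
    Filter.Tendsto (fun N : ℝ => ∫ y, Real.cos (N * ℓ y) * f y) Filter.atTop (nhds 0) := by
  have h := tendsto_integral_exp_smul_cocompact (fun y => (f y : ℂ)) (volume : Measure SpaceTime)
  have hN : Filter.Tendsto (fun N : ℝ => (N / (2 * Real.pi)) • ℓ) Filter.atTop
      (Filter.cocompact (StrongDual ℝ SpaceTime)) := by
    rw [← Metric.cobounded_eq_cocompact, ← tendsto_norm_atTop_iff_cobounded]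
    simp only [norm_smul]
    refine Filter.Tendsto.atTop_mul_const (norm_pos_iff.2 hℓ) ?_
    exact tendsto_norm_atTop_atTop.comp
      (Filter.tendsto_id.atTop_div_const (by positivity))
  have h2 := (Complex.continuous_re.tendsto 0).comp (h.comp hN)
  simp only [Complex.zero_re] at h2
  refine h2.congr fun N => ?_
  have e : ∀ y, -(((N / (2 * Real.pi)) • ℓ : SpaceTime →L[ℝ] ℝ) y) = -(N * ℓ y) / (2 * Real.pi) :=
    fun y => by
      rw [_root_.smul_apply, smul_eq_mul]; ring
  simp only [Function.comp, e]
  have hint : Integrable fun y =>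
      Real.fourierChar (-(N * ℓ y) / (2 * Real.pi)) • (f y : ℂ) := by
    refine (hf.ofReal (𝕜 := ℂ)).mono ?_ ?_
    · refine AEStronglyMeasurable.smul ?_ (hf.ofReal (𝕜 := ℂ)).1
      refine Continuous.aestronglyMeasurable (continuous_subtype_val.comp
        (Real.continuous_fourierChar.comp ?_))
      exact (continuous_const.mul ℓ.continuous).neg.div_const _
    · exact Filter.Eventually.of_forall fun y => by simp
  rw [← RCLike.re_eq_complex_re, ← integral_re hint]
  congr 1; funext y
  have e2 : 2 * Real.pi * (-(N * ℓ y) / (2 * Real.pi)) = -(N * ℓ y) := by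
    field_simp
  rw [Circle.smul_def, Real.fourierChar_apply, e2, smul_eq_mul, RCLike.re_eq_complex_re,
    Complex.re_mul_ofReal, Complex.exp_ofReal_mul_I_re, Real.cos_neg]

theorem tendsto_integral_cos_mul {f : SpaceTime → ℝ} (hf : Integrable f weightMeasure)
    {ℓ : SpaceTime →L[ℝ] ℝ} (hℓ : ℓ ≠ 0) :
    Filter.Tendsto (fun N : ℝ => ∫ y, Real.cos (N * ℓ y) * f y ∂weightMeasure) Filter.atTop
      (nhds 0) := by
  refine (tendsto_integral_cos_mul_volume (integrable_weightMeasure_iff.1 hf) hℓ).congr fun N => ?_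
  rw [integral_weightMeasure]
  congr 1; funext y
  simp only [smul_eq_mul]; ring

/-- The field generated by the plane wave with cutoff `s * χ`, phase `ℓ` and frequency `N`. -/
def wave (χ : SpaceTime → ℝ) (ℓ : SpaceTime →L[ℝ] ℝ) (s N : ℝ) : SpaceTime → State :=
  waveOp (wavePotential (fun y => s * χ y) ℓ N)

theorem continuous_wave {χ : SpaceTime → ℝ} (hχ : Smooth χ) (ℓ : SpaceTime →L[ℝ] ℝ) (s N : ℝ) :
    Continuous (wave χ ℓ s N) :=
  continuous_waveOp (smooth_wavePotential (contDiff_const.mul hχ) ℓ N)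

theorem hasCompactSupport_wave {χ : SpaceTime → ℝ} (hc : HasCompactSupport χ)
    (ℓ : SpaceTime →L[ℝ] ℝ) (s N : ℝ) : HasCompactSupport (wave χ ℓ s N) :=
  hasCompactSupport_waveOp ((hc.mul_left (f := fun _ => s)).of_isClosed_subset
    (isClosed_tsupport _) (tsupport_wavePotential_subset _ ℓ N))

theorem eventually_norm_wave_sub_le {χ : SpaceTime → ℝ} (hχ : Smooth χ) (hc : HasCompactSupport χ)
    (ℓ : SpaceTime →L[ℝ] ℝ) (s : ℝ) {δ : ℝ} (hδ : 0 < δ) :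
    ∀ᶠ N in Filter.atTop, ∀ y,
      ‖wave χ ℓ s N y - (χ y * Real.cos (N * ℓ y)) • s • waveAmp ℓ‖ ≤ δ := by
  obtain ⟨B, hB⟩ := exists_waveOp_wavePotential_bound (χ := fun y => s * χ y)
    (contDiff_const.mul hχ) hc.mul_left ℓ
  filter_upwards [Filter.eventually_ge_atTop 1, Filter.eventually_ge_atTop (B / δ)]
    with N hN1 hN2 y
  have h1 := hB N hN1 y
  have h2 : B / N ≤ δ := by
    rw [div_le_iff₀ hδ] at hN2
    rw [div_le_iff₀ (by linarith)]
    linarith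
  rw [smul_smul, show χ y * Real.cos (N * ℓ y) * s = s * χ y * Real.cos (N * ℓ y) by ring]
  exact h1.trans h2

theorem tendsto_integral_inner_wave {χ : SpaceTime → ℝ} (hχ : Smooth χ) (hc : HasCompactSupport χ)
    {ℓ : SpaceTime →L[ℝ] ℝ} (hℓ : ℓ ≠ 0) (s : ℝ) {f : SpaceTime → State}
    (hf : Integrable f weightMeasure) :
    Filter.Tendsto (fun N => ∫ y, inner ℝ (wave χ ℓ s N y) (f y) ∂weightMeasure) Filter.atTop
      (nhds 0) := by
  set m := s • waveAmp ℓ with hm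
  obtain ⟨K, hK0, hK⟩ := exists_bound_of_smooth hχ hc
  have hmf : Integrable (fun y => χ y * inner ℝ m (f y)) weightMeasure :=
    (hf.const_inner m).bdd_mul (c := K) hχ.continuous.aestronglyMeasurable
      (Filter.Eventually.of_forall hK)
  have hRL := tendsto_integral_cos_mul hmf hℓ
  have hdiff : Filter.Tendsto (fun N => (∫ y, inner ℝ (wave χ ℓ s N y) (f y) ∂weightMeasure)
      - ∫ y, Real.cos (N * ℓ y) * (χ y * inner ℝ m (f y)) ∂weightMeasure) Filter.atTop
      (nhds 0) := by
    rw [Metric.tendsto_nhds]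
    intro ε hε
    set I := ∫ y, ‖f y‖ ∂weightMeasure with hI
    have hI0 : 0 ≤ I := integral_nonneg fun _ => norm_nonneg _
    filter_upwards [eventually_norm_wave_sub_le hχ hc ℓ s (δ := ε / (I + 1)) (by positivity)]
      with N hN
    have hb : ∃ C, ∀ y, ‖wave χ ℓ s N y‖ ≤ C :=
      (hasCompactSupport_wave hc ℓ s N).exists_bound_of_continuous (continuous_wave hχ ℓ s N)
    obtain ⟨C, hC⟩ := hb
    have i1 : Integrable (fun y => inner ℝ (wave χ ℓ s N y) (f y)) weightMeasure := by
      refine (hf.norm.const_mul C).mono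
        ((continuous_wave hχ ℓ s N).aestronglyMeasurable.inner hf.1)
        (Filter.Eventually.of_forall fun y => ?_)
      refine (norm_inner_le_norm _ _).trans ?_
      rw [Real.norm_eq_abs]
      exact (mul_le_mul_of_nonneg_right (hC y) (norm_nonneg _)).trans (le_abs_self _)
    have i2 : Integrable (fun y => Real.cos (N * ℓ y) * (χ y * inner ℝ m (f y)))
        weightMeasure :=
      hmf.bdd_mul (c := 1) (smooth_cos_mul ℓ N).continuous.aestronglyMeasurable
        (Filter.Eventually.of_forall fun y => Real.abs_cos_le_one _)
    rw [dist_zero_right, ← integral_sub i1 i2]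
    have h2 : ‖∫ y, (inner ℝ (wave χ ℓ s N y) (f y)
        - Real.cos (N * ℓ y) * (χ y * inner ℝ m (f y))) ∂weightMeasure‖
        ≤ ∫ y, ε / (I + 1) * ‖f y‖ ∂weightMeasure := by
      refine norm_integral_le_of_norm_le (hf.norm.const_mul _)
        (Filter.Eventually.of_forall fun y => ?_)
      have e : inner ℝ (wave χ ℓ s N y) (f y) - Real.cos (N * ℓ y) * (χ y * inner ℝ m (f y))
          = inner ℝ (wave χ ℓ s N y - (χ y * Real.cos (N * ℓ y)) • m) (f y) := by
        rw [inner_sub_left, real_inner_smul_left m]; ring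
      rw [e]
      exact (norm_inner_le_norm _ _).trans (mul_le_mul_of_nonneg_right (hN y) (norm_nonneg _))
    refine h2.trans_lt ?_
    rw [integral_const_mul, ← hI, div_mul_eq_mul_div, div_lt_iff₀ (by positivity)]
    nlinarith
  simpa using hdiff.add hRL

theorem eventually_le_integral_norm_wave_sq {χ : SpaceTime → ℝ} (hχ : Smooth χ)
    (hc : HasCompactSupport χ) {ℓ : SpaceTime →L[ℝ] ℝ} (hℓ : ℓ ≠ 0) (s : ℝ)
    (hpos : 0 < ‖s • waveAmp ℓ‖ ^ 2 * ∫ y, χ y ^ 2 ∂weightMeasure) :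
    ∀ᶠ N in Filter.atTop, ‖s • waveAmp ℓ‖ ^ 2 * (∫ y, χ y ^ 2 ∂weightMeasure) / 8
      ≤ ∫ y, ‖wave χ ℓ s N y‖ ^ 2 ∂weightMeasure := by
  set m := s • waveAmp ℓ with hm
  set Q := ∫ y, χ y ^ 2 ∂weightMeasure with hQ
  set M := weightMeasure.real Set.univ with hM
  have hM0 : 0 ≤ M := measureReal_nonneg
  have hm2 : 0 < ‖m‖ ^ 2 := by
    have hQ0 : 0 ≤ Q := integral_nonneg fun _ => sq_nonneg _
    by_contra! h
    nlinarith [sq_nonneg ‖m‖]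
  have hQp : 0 < Q := (mul_pos_iff_of_pos_left hm2).1 hpos
  have hbi : ∀ {g : SpaceTime → ℝ}, Continuous g → HasCompactSupport g →
      Integrable g weightMeasure := fun hg hgc => hg.integrable_of_hasCompactSupport hgc
  have hc2 : HasCompactSupport fun y => χ y ^ 2 := by
    simp only [sq]; exact hc.mul_left
  have hχ2 : Integrable (fun y => χ y ^ 2) weightMeasure := hbi (hχ.continuous.pow 2) hc2
  have hRL := (tendsto_integral_cos_mul hχ2 hℓ).comp
    (Filter.tendsto_id.const_mul_atTop (two_pos : (0 : ℝ) < 2))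
  have hlow := hRL.eventually (lt_mem_nhds (show -(Q / 4) < 0 by linarith))
  set δ := Real.sqrt (‖m‖ ^ 2 * Q / (16 * (M + 1))) with hδ
  have hδ0 : 0 < δ := Real.sqrt_pos.2 (by positivity)
  have hδ2 : δ ^ 2 * M ≤ ‖m‖ ^ 2 * Q / 16 := by
    rw [hδ, Real.sq_sqrt (by positivity), div_mul_eq_mul_div, div_le_div_iff₀ (by positivity)
      (by norm_num)]
    nlinarith
  filter_upwards [hlow, eventually_norm_wave_sub_le hχ hc ℓ s hδ0] with N h1 h2
  simp only [Function.comp, id] at h1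
  have hcos : Continuous fun y => Real.cos (2 * N * ℓ y) := (smooth_cos_mul ℓ (2 * N)).continuous
  have i1 : Integrable (fun y => Real.cos (2 * N * ℓ y) * χ y ^ 2) weightMeasure :=
    hbi (hcos.mul (hχ.continuous.pow 2)) hc2.mul_left
  have hL : Integrable (fun y => ‖wave χ ℓ s N y‖ ^ 2) weightMeasure := by
    refine hbi ((continuous_wave hχ ℓ s N).norm.pow 2) ?_
    simp only [sq]
    exact (hasCompactSupport_wave hc ℓ s N).norm.mul_left
  have hle : ∀ y, ‖m‖ ^ 2 / 4 * (χ y ^ 2 + Real.cos (2 * N * ℓ y) * χ y ^ 2) - δ ^ 2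
      ≤ ‖wave χ ℓ s N y‖ ^ 2 := by
    intro y
    set k := Real.cos (N * ℓ y)
    have hk : Real.cos (2 * N * ℓ y) = 2 * k ^ 2 - 1 := by
      rw [show 2 * N * ℓ y = 2 * (N * ℓ y) by ring, Real.cos_two_mul]
    have h3 := h2 y
    have h4 : ‖(χ y * k) • m‖ ≤ ‖wave χ ℓ s N y‖ + δ := by
      calc ‖(χ y * k) • m‖ = ‖wave χ ℓ s N y - (wave χ ℓ s N y - (χ y * k) • m)‖ := by
            rw [sub_sub_cancel]
        _ ≤ ‖wave χ ℓ s N y‖ + δ := (norm_sub_le _ _).trans (by gcongr)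
    have h5 : ‖(χ y * k) • m‖ ^ 2 = (χ y * k) ^ 2 * ‖m‖ ^ 2 := by
      rw [norm_smul, mul_pow, Real.norm_eq_abs, sq_abs]
    have h6 := pow_le_pow_left₀ (norm_nonneg _) h4 2
    rw [h5] at h6
    rw [hk]
    nlinarith [sq_nonneg (‖wave χ ℓ s N y‖ - δ)]
  have hsum : Integrable (fun y => χ y ^ 2 + Real.cos (2 * N * ℓ y) * χ y ^ 2) weightMeasure :=
    hχ2.add i1
  have h7 := integral_mono ((hsum.const_mul (‖m‖ ^ 2 / 4)).sub
    (integrable_const (δ ^ 2))) hL hle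
  have h8 : ∫ y, (‖m‖ ^ 2 / 4 * (χ y ^ 2 + Real.cos (2 * N * ℓ y) * χ y ^ 2) - δ ^ 2)
      ∂weightMeasure = ‖m‖ ^ 2 / 4 * (Q + ∫ y, Real.cos (2 * N * ℓ y) * χ y ^ 2 ∂weightMeasure)
        - δ ^ 2 * M := by
    rw [integral_sub (hsum.const_mul (‖m‖ ^ 2 / 4)) (integrable_const _),
      integral_const_mul, integral_add hχ2 i1, integral_const, smul_eq_mul, mul_comm M]
  simp only [Pi.sub_apply] at h7
  rw [h8] at h7
  refine le_trans ?_ h7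
  nlinarith

theorem exists_stable_segment {C : ℝ} {Ω : Set SpaceTime} (hΩ : IsOpen Ω) {z : SpaceTime → State}
    (hz : Continuous z) {x : SpaceTime} (hx : x ∈ Ω) (hzx : z x ∈ subStates C) :
    ∃ (ℓ : SpaceTime →L[ℝ] ℝ) (s δ ρ : ℝ), ℓ ≠ 0 ∧ 0 < δ ∧ 0 < ρ ∧
      gap C (z x) ^ 2 / (64 * C) ≤ ‖s • waveAmp ℓ‖ ^ 2 ∧
      ∀ y ∈ Metric.closedBall x ρ, y ∈ Ω ∧
        (∀ σ : ℝ, |σ| ≤ 1 → ∀ e : State, ‖e‖ ≤ δ → z y + (σ • s • waveAmp ℓ + e) ∈ subStates C) ∧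
        weight y * gap C (z y) ^ 2 ≤ 2 * (weight x * gap C (z x) ^ 2) ∧
        weight x / 2 ≤ weight y := by
  obtain ⟨ℓ, s, hℓ, hseg, hlen⟩ := exists_wave_segment hzx
  set m := s • waveAmp ℓ
  have hK : IsCompact ((fun σ : ℝ => z x + σ • m) '' Set.Icc (-1) 1) :=
    isCompact_Icc.image (by fun_prop)
  have hKU : (fun σ : ℝ => z x + σ • m) '' Set.Icc (-1) 1 ⊆ subStates C := by
    rintro _ ⟨σ, hσ, rfl⟩
    exact hseg σ (abs_le.2 hσ)
  obtain ⟨δ, hδ, hδU⟩ := hK.exists_cthickening_subset_open (isOpen_subStates C) hKU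
  have hG : Continuous fun y => weight y * gap C (z y) ^ 2 :=
    continuous_weight.mul (((continuous_gap C).comp hz).pow 2)
  have hGx : 0 < weight x * gap C (z x) ^ 2 := mul_pos (weight_pos x) (pow_pos hzx.1 2)
  have ev : ∀ᶠ y in nhds x, y ∈ Ω ∧ dist (z y) (z x) < δ / 2 ∧
      weight y * gap C (z y) ^ 2 < 2 * (weight x * gap C (z x) ^ 2) ∧ weight x / 2 < weight y := by
    refine (hΩ.eventually_mem hx).and ((Metric.tendsto_nhds.1 (hz.tendsto x) _ (half_pos hδ)).and
      (((hG.tendsto x).eventually (gt_mem_nhds (by linarith))).and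
        ((continuous_weight.tendsto x).eventually (lt_mem_nhds (by linarith [weight_pos x])))))
  obtain ⟨ρ, hρ, hball⟩ := Metric.nhds_basis_closedBall.eventually_iff.1 ev
  refine ⟨ℓ, s, δ / 2, ρ, hℓ, half_pos hδ, hρ, hlen, fun y hy => ?_⟩
  obtain ⟨h1, h2, h3, h4⟩ := hball hy
  refine ⟨h1, fun σ hσ e he => hδU ?_, h3.le, h4.le⟩
  refine Metric.mem_cthickening_of_dist_le _ (z x + σ • m) _ _ ⟨σ, abs_le.1 hσ, rfl⟩ ?_
  have : z y + (σ • m + e) - (z x + σ • m) = (z y - z x) + e := by abel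
  rw [dist_eq_norm, this]
  rw [dist_eq_norm] at h2
  exact (norm_add_le _ _).trans (by linarith)

theorem exists_local_perturbation {C : ℝ} {Ω : Set SpaceTime} (hΩ : IsOpen Ω)
    {z : SpaceTime → State} (hz : Continuous z) (hzU : ∀ y ∈ Ω, z y ∈ subStates C)
    {x : SpaceTime} (hx : x ∈ Ω) :
    ∃ ρ > 0, Metric.closedBall x ρ ⊆ Ω ∧ ∀ r, 0 < r → r ≤ ρ →
      ∀ F : Set (SpaceTime → State), F.Finite → (∀ f ∈ F, Integrable f weightMeasure) →
      ∀ ε > 0, ∃ h, Smooth h ∧ tsupport h ⊆ Metric.closedBall x r ∧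
        (∀ y ∈ Ω, z y + waveOp h y ∈ subStates C) ∧
        (∀ f ∈ F, |∫ y, inner ℝ (waveOp h y) (f y) ∂weightMeasure| ≤ ε) ∧
        ∫ y in Metric.closedBall x r, gap C (z y) ^ 2 ∂weightMeasure
          ≤ 16384 * C * ∫ y, ‖waveOp h y‖ ^ 2 ∂weightMeasure := by
  have hC := pos_of_mem_subStates (hzU x hx)
  obtain ⟨ℓ, s, δ, ρ, hℓ, hδ, hρ, hlen, hball⟩ := exists_stable_segment hΩ hz hx (hzU x hx)
  refine ⟨ρ, hρ, fun y hy => (hball y hy).1, fun r hr hrρ F hF hFi ε hε => ?_⟩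
  let χ : ContDiffBump x := ⟨r / 2, r, by positivity, by linarith⟩
  have hχ : Smooth χ := χ.contDiff
  have hχt : tsupport χ = Metric.closedBall x r := χ.tsupport_eq
  have hχc : HasCompactSupport χ := χ.hasCompactSupport
  have hχ2 : Integrable fun y => weight y * χ y ^ 2 := by
    refine (continuous_weight.mul (hχ.continuous.pow 2)).integrable_of_hasCompactSupport ?_
    simp only [sq]
    exact (hχc.mul_left (f := χ)).mul_left
  set V := volume.real (Metric.closedBall x (r / 2)) with hV
  have hVr : volume.real (Metric.closedBall x r) = 8 * V := by
    have e1 := Measure.addHaar_real_closedBall (volume : Measure SpaceTime) x hr.le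
    have e2 := Measure.addHaar_real_closedBall (volume : Measure SpaceTime) x (half_pos hr).le
    have h3 : Module.finrank ℝ SpaceTime = 3 := by simp
    rw [h3] at e1 e2
    rw [hV, e1, e2]; ring
  have hV0 : 0 < V :=
    ENNReal.toReal_pos (Metric.measure_closedBall_pos _ _ (half_pos hr)).ne'
      measure_closedBall_lt_top.ne
  have hw := weight_pos x
  have hg := pow_pos (hzU x hx).1 2
  have hQ : weight x / 2 * V ≤ ∫ y, χ y ^ 2 ∂weightMeasure := by
    rw [integral_weightMeasure]
    simp only [smul_eq_mul]
    calc weight x / 2 * V = ∫ y in Metric.closedBall x (r / 2), weight x / 2 := by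
          rw [setIntegral_const, smul_eq_mul, mul_comm]
      _ ≤ ∫ y in Metric.closedBall x (r / 2), weight y * χ y ^ 2 := by
          refine setIntegral_mono_on ?_ hχ2.integrableOn Metric.isClosed_closedBall.measurableSet
            fun y hy => ?_
          · exact integrableOn_const measure_closedBall_lt_top.ne
          · rw [χ.one_of_mem_closedBall hy]
            have := (hball y (Metric.closedBall_subset_closedBall (by linarith) hy)).2.2.2
            simpa using this
      _ ≤ ∫ y, weight y * χ y ^ 2 := by
          refine setIntegral_le_integral hχ2 (Filter.Eventually.of_forall fun y => ?_)
          exact mul_nonneg (weight_pos y).le (sq_nonneg _)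
  have hI : ∫ y in Metric.closedBall x r, gap C (z y) ^ 2 ∂weightMeasure
      ≤ 16 * (weight x * gap C (z x) ^ 2) * V := by
    rw [setIntegral_weightMeasure Metric.isClosed_closedBall.measurableSet]
    calc ∫ y in Metric.closedBall x r, weight y * gap C (z y) ^ 2
        ≤ ∫ y in Metric.closedBall x r, 2 * (weight x * gap C (z x) ^ 2) := by
          refine setIntegral_mono_on ?_ ?_ Metric.isClosed_closedBall.measurableSet fun y hy =>
            (hball y (Metric.closedBall_subset_closedBall hrρ hy)).2.2.1
          · exact (continuous_weight.mul (((continuous_gap C).comp hz).pow 2)).continuousOn.integrableOn_compact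
              (isCompact_closedBall x r)
          · exact integrableOn_const measure_closedBall_lt_top.ne
      _ = 16 * (weight x * gap C (z x) ^ 2) * V := by
          rw [setIntegral_const, smul_eq_mul, hVr]; ring
  have hm0 : 0 < ‖s • waveAmp ℓ‖ ^ 2 := lt_of_lt_of_le (by positivity) hlen
  have hQ0 : 0 < ∫ y, χ y ^ 2 ∂weightMeasure := lt_of_lt_of_le (by positivity) hQ
  have ev1 := eventually_norm_wave_sub_le hχ hχc ℓ s hδ
  have ev2 := eventually_le_integral_norm_wave_sq hχ hχc hℓ s (mul_pos hm0 hQ0)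
  have ev3 : ∀ᶠ N in Filter.atTop, ∀ f ∈ F,
      |∫ y, inner ℝ (wave χ ℓ s N y) (f y) ∂weightMeasure| ≤ ε := by
    rw [Filter.eventually_all_finite hF]
    intro f hf
    have := Metric.tendsto_nhds.1 (tendsto_integral_inner_wave hχ hχc hℓ s (hFi f hf)) ε hε
    filter_upwards [this] with N hN
    rw [dist_zero_right] at hN
    exact hN.le
  obtain ⟨N, h1, h2, h3⟩ := (ev1.and (ev2.and ev3)).exists
  have hsub : tsupport (wavePotential (fun y => s * χ y) ℓ N) ⊆ Metric.closedBall x r := by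
    rw [← hχt]
    exact (tsupport_wavePotential_subset _ ℓ N).trans (tsupport_mul_subset_right)
  refine ⟨wavePotential (fun y => s * χ y) ℓ N,
    smooth_wavePotential (contDiff_const.mul hχ) ℓ N, hsub, fun y hy => ?_, h3, ?_⟩
  · by_cases hyr : y ∈ Metric.closedBall x r
    · have h4 := (hball y (Metric.closedBall_subset_closedBall hrρ hyr)).2.1
        (χ y * Real.cos (N * ℓ y)) ?_ _ (h1 y)
      · rwa [add_sub_cancel] at h4
      · rw [abs_mul, abs_of_nonneg χ.nonneg]
        exact mul_le_one₀ χ.le_one (abs_nonneg _) (Real.abs_cos_le_one _)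
    · rw [waveOp_eq_zero fun h => hyr (hsub h), add_zero]
      exact hzU y hy
  · refine hI.trans ?_
    have h5 : gap C (z x) ^ 2 / (64 * C) * (weight x / 2 * V)
        ≤ ‖s • waveAmp ℓ‖ ^ 2 * ∫ y, χ y ^ 2 ∂weightMeasure :=
      mul_le_mul hlen hQ (by positivity) hm0.le
    have h6 : 16 * (weight x * gap C (z x) ^ 2) * V
        = 16384 * C * (gap C (z x) ^ 2 / (64 * C) * (weight x / 2 * V) / 8) := by
      field_simp; ring
    rw [h6]
    refine mul_le_mul_of_nonneg_left ?_ (by positivity)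
    exact (by linarith : _ ≤ _).trans h2

/-- `h` is a potential supported in `A` whose field keeps `z` inside the strict subsolution states
over `Ω`, is `ε`-weakly small against the functions of `F`, and has energy controlling `b`. -/
structure IsPerturbation (C : ℝ) (Ω : Set SpaceTime) (z : SpaceTime → State)
    (F : Set (SpaceTime → State)) (ε : ℝ) (A : Set SpaceTime) (b : ℝ) (h : SpaceTime → ℝ) :
    Prop where
  smooth : Smooth h
  tsupport_subset : tsupport h ⊆ A
  mem_subStates : ∀ y ∈ Ω, z y + waveOp h y ∈ subStates C
  abs_integral_inner_le : ∀ f ∈ F, |∫ y, inner ℝ (waveOp h y) (f y) ∂weightMeasure| ≤ ε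
  le_energy : b ≤ 16384 * C * ∫ y, ‖waveOp h y‖ ^ 2 ∂weightMeasure

theorem waveOp_zero : waveOp (fun _ => 0) = 0 := by
  funext y
  refine waveOp_eq_zero ?_
  have h : Function.support (fun _ : SpaceTime => (0 : ℝ)) = ∅ := by ext; simp
  rw [tsupport, h]
  simp

theorem isPerturbation_zero {C : ℝ} {Ω : Set SpaceTime} {z : SpaceTime → State}
    (hzU : ∀ y ∈ Ω, z y ∈ subStates C) (F : Set (SpaceTime → State)) {ε : ℝ} (hε : 0 ≤ ε)
    (A : Set SpaceTime) : IsPerturbation C Ω z F ε A 0 fun _ => 0 where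
  smooth := contDiff_const
  tsupport_subset := by
    have h : Function.support (fun _ : SpaceTime => (0 : ℝ)) = ∅ := by ext; simp
    rw [tsupport, h]
    simp
  mem_subStates := by simpa [waveOp_zero] using hzU
  abs_integral_inner_le := by simpa [waveOp_zero] using fun _ _ => hε
  le_energy := by simp [waveOp_zero]

theorem integrable_inner_waveOp {h : SpaceTime → ℝ} (hh : Smooth h) (hc : HasCompactSupport h)
    {f : SpaceTime → State} (hf : Integrable f weightMeasure) :
    Integrable (fun y => inner ℝ (waveOp h y) (f y)) weightMeasure := by
  obtain ⟨C, hC⟩ :=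
    (hasCompactSupport_waveOp hc).exists_bound_of_continuous (continuous_waveOp hh)
  refine (hf.norm.const_mul C).mono ((continuous_waveOp hh).aestronglyMeasurable.inner hf.1)
    (Filter.Eventually.of_forall fun y => (norm_inner_le_norm _ _).trans ?_)
  rw [Real.norm_eq_abs]
  exact (mul_le_mul_of_nonneg_right (hC y) (norm_nonneg _)).trans (le_abs_self _)

theorem integrable_norm_waveOp_sq {h : SpaceTime → ℝ} (hh : Smooth h) (hc : HasCompactSupport h) :
    Integrable (fun y => ‖waveOp h y‖ ^ 2) weightMeasure := by
  refine ((continuous_waveOp hh).norm.pow 2).integrable_of_hasCompactSupport ?_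
  simp only [sq]
  exact (hasCompactSupport_waveOp hc).norm.mul_left

theorem IsPerturbation.add {C : ℝ} {Ω : Set SpaceTime} {z : SpaceTime → State}
    {F : Set (SpaceTime → State)} (hFi : ∀ f ∈ F, Integrable f weightMeasure) {ε₁ ε₂ b₁ b₂ : ℝ}
    {A B : Set SpaceTime} (hA : IsCompact A) (hB : IsCompact B) (hAB : Disjoint A B)
    {h k : SpaceTime → ℝ} (hh : IsPerturbation C Ω z F ε₁ A b₁ h)
    (hk : IsPerturbation C Ω z F ε₂ B b₂ k) :
    IsPerturbation C Ω z F (ε₁ + ε₂) (A ∪ B) (b₁ + b₂) fun y => h y + k y := by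
  have hz : ∀ y, waveOp h y = 0 ∨ waveOp k y = 0 := by
    intro y
    by_cases hy : y ∈ A
    · exact Or.inr (waveOp_eq_zero fun hyk =>
        Set.disjoint_left.1 hAB hy (hk.tsupport_subset hyk))
    · exact Or.inl (waveOp_eq_zero fun hyh => hy (hh.tsupport_subset hyh))
  have hadd := waveOp_add hh.smooth hk.smooth
  have hhc : HasCompactSupport h := hA.of_isClosed_subset (isClosed_tsupport _) hh.tsupport_subset
  have hkc : HasCompactSupport k := hB.of_isClosed_subset (isClosed_tsupport _) hk.tsupport_subset
  refine ⟨hh.smooth.add hk.smooth, ?_, fun y hy => ?_, fun f hf => ?_, ?_⟩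
  · exact (tsupport_add h k).trans (Set.union_subset_union hh.tsupport_subset hk.tsupport_subset)
  · rw [hadd]
    rcases hz y with h0 | h0
    · simpa [h0] using hk.mem_subStates y hy
    · simpa [h0] using hh.mem_subStates y hy
  · simp only [hadd, inner_add_left]
    rw [integral_add (integrable_inner_waveOp hh.smooth hhc (hFi f hf))
      (integrable_inner_waveOp hk.smooth hkc (hFi f hf))]
    exact (abs_add_le _ _).trans
      (add_le_add (hh.abs_integral_inner_le f hf) (hk.abs_integral_inner_le f hf))
  · have e : ∀ y, ‖waveOp (fun y => h y + k y) y‖ ^ 2 = ‖waveOp h y‖ ^ 2 + ‖waveOp k y‖ ^ 2 := by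
      intro y
      rw [hadd]
      rcases hz y with h0 | h0 <;> simp [h0]
    simp only [e]
    rw [integral_add (integrable_norm_waveOp_sq hh.smooth hhc)
      (integrable_norm_waveOp_sq hk.smooth hkc), mul_add]
    exact add_le_add hh.le_energy hk.le_energy

theorem exists_isPerturbation_biUnion {C : ℝ} {Ω : Set SpaceTime} {z : SpaceTime → State}
    (hzU : ∀ y ∈ Ω, z y ∈ subStates C) {F : Set (SpaceTime → State)}
    (hFi : ∀ f ∈ F, Integrable f weightMeasure) {ι : Type*} {A : ι → Set SpaceTime} {b : ι → ℝ}
    (hA : ∀ i, IsCompact (A i)) (hdisj : Pairwise (Function.onFun Disjoint A))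
    (hloc : ∀ i, ∀ ε > 0, ∃ h, IsPerturbation C Ω z F ε (A i) (b i) h) (s : Finset ι) :
    ∀ ε > 0, ∃ h, IsPerturbation C Ω z F ε (⋃ i ∈ s, A i) (∑ i ∈ s, b i) h := by
  classical
  induction s using Finset.induction_on with
  | empty => exact fun ε hε => ⟨_, by simpa using isPerturbation_zero hzU F hε.le ∅⟩
  | insert i s hi ih =>
    intro ε hε
    obtain ⟨h, hh⟩ := hloc i (ε / 2) (half_pos hε)
    obtain ⟨k, hk⟩ := ih (ε / 2) (half_pos hε)
    refine ⟨fun y => h y + k y, ?_⟩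
    rw [Finset.sum_insert hi, Finset.set_biUnion_insert, ← add_halves ε]
    refine hh.add hFi (hA i) (s.isCompact_biUnion fun j _ => hA j) ?_ hk
    refine Set.disjoint_iUnion₂_right.2 fun j hj => hdisj ?_
    rintro rfl
    exact hi hj

theorem sq_gap_le {C : ℝ} {z : State} (hz : z ∈ subStates C) : gap C z ^ 2 ≤ C ^ 2 :=
  pow_le_pow_left₀ hz.1.le (gap_le C z) 2

theorem integrableOn_gap_sq {C : ℝ} {Ω : Set SpaceTime} (hΩ : IsOpen Ω) {z : SpaceTime → State}
    (hz : Continuous z) (hzU : ∀ y ∈ Ω, z y ∈ subStates C) :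
    IntegrableOn (fun y => gap C (z y) ^ 2) Ω weightMeasure := by
  refine Measure.integrableOn_of_bounded (M := C ^ 2) (measure_ne_top _ _)
    (((continuous_gap C).comp hz).pow 2).aestronglyMeasurable ?_
  filter_upwards [ae_restrict_mem hΩ.measurableSet] with y hy
  rw [Real.norm_eq_abs, abs_of_nonneg (sq_nonneg _)]
  exact sq_gap_le (hzU y hy)

/-- One step of convex integration: a weakly small perturbation whose energy controls the gap. -/
theorem exists_perturbation {C : ℝ} {Ω : Set SpaceTime} (hΩ : IsOpen Ω)
    {z : SpaceTime → State} (hz : Continuous z) (hzU : ∀ y ∈ Ω, z y ∈ subStates C)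
    {F : Set (SpaceTime → State)} (hF : F.Finite) (hFi : ∀ f ∈ F, Integrable f weightMeasure)
    {ε : ℝ} (hε : 0 < ε) :
    ∃ (h : SpaceTime → ℝ) (A : Set SpaceTime), IsCompact A ∧ A ⊆ Ω ∧
      IsPerturbation C Ω z F ε A ((∫ y in Ω, gap C (z y) ^ 2 ∂weightMeasure) / 2) h := by
  set I := ∫ y in Ω, gap C (z y) ^ 2 ∂weightMeasure with hI
  have hI0 : 0 ≤ I := integral_nonneg fun _ => sq_nonneg _
  rcases hI0.eq_or_lt with h0 | hIpos
  · refine ⟨fun _ => 0, ∅, isCompact_empty, Set.empty_subset _, ?_⟩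
    rw [← h0, zero_div]
    exact isPerturbation_zero hzU F hε.le ∅
  have hex : ∀ x, ∃ ρ : ℝ, 0 < ρ ∧ (x ∈ Ω → Metric.closedBall x ρ ⊆ Ω ∧ ∀ r, 0 < r → r ≤ ρ →
      ∀ ε > 0, ∃ h, IsPerturbation C Ω z F ε (Metric.closedBall x r)
        (∫ y in Metric.closedBall x r, gap C (z y) ^ 2 ∂weightMeasure) h) := by
    intro x
    by_cases hx : x ∈ Ω
    · obtain ⟨ρ, hρ, hρΩ, hρh⟩ := exists_local_perturbation hΩ hz hzU hx
      refine ⟨ρ, hρ, fun _ => ⟨hρΩ, fun r hr hrρ ε hε => ?_⟩⟩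
      obtain ⟨h, h1, h2, h3, h4, h5⟩ := hρh r hr hrρ F hF hFi ε hε
      exact ⟨h, h1, h2, h3, h4, h5⟩
    · exact ⟨1, one_pos, fun h => absurd h hx⟩
  choose ρ hρ hρΩ using hex
  obtain ⟨t, r, htc, htΩ, hr, hcov, hdisj⟩ := Besicovitch.exists_disjoint_closedBall_covering_ae
    weightMeasure (fun _ => Set.univ) Ω
    (fun x _ δ hδ => ⟨δ / 2, trivial, half_pos hδ, half_lt_self hδ⟩) ρ fun x _ => hρ x
  have hcount : Countable t := htc.to_subtype
  have hpos : ∀ i : t, 0 < r i := fun i => (hr i i.2).2.1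
  have hle : ∀ i : t, r i ≤ ρ i := fun i => (hr i i.2).2.2.le
  have hsub : (⋃ i : t, Metric.closedBall (i : SpaceTime) (r i)) ⊆ Ω :=
    Set.iUnion_subset fun i =>
      (Metric.closedBall_subset_closedBall (hle i)).trans (hρΩ i (htΩ i.2)).1
  have hdisj' : Pairwise (Function.onFun Disjoint
      fun i : t => Metric.closedBall (i : SpaceTime) (r i)) :=
    (hdisj.subtype _ _)
  have hsum := hasSum_integral_iUnion (μ := weightMeasure)
    (f := fun y => gap C (z y) ^ 2) (fun i : t => Metric.isClosed_closedBall.measurableSet)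
    hdisj' ((integrableOn_gap_sq hΩ hz hzU).mono_set hsub)
  have hIeq : ∫ y in ⋃ i : t, Metric.closedBall (i : SpaceTime) (r i), gap C (z y) ^ 2
      ∂weightMeasure = I := by
    refine setIntegral_congr_set ?_
    refine (hsub.eventuallyLE).antisymm (ae_le_set.2 ?_)
    rwa [← Set.biUnion_eq_iUnion (s := t) (t := fun x _ => Metric.closedBall x (r x))]
  rw [hIeq] at hsum
  obtain ⟨s, hs⟩ := (hsum.eventually (lt_mem_nhds (half_lt_self hIpos))).exists
  obtain ⟨h, hh⟩ := exists_isPerturbation_biUnion hzU hFi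
    (fun i : t => isCompact_closedBall (i : SpaceTime) (r i)) hdisj'
    (fun i ε hε => (hρΩ i (htΩ i.2)).2 (r i) (hpos i) (hle i) ε hε) s ε hε
  refine ⟨h, _, s.isCompact_biUnion fun i _ => isCompact_closedBall (i : SpaceTime) (r i),
    (Set.iUnion₂_subset fun i _ => (Set.subset_iUnion _ i).trans hsub), ?_⟩
  exact ⟨hh.1, hh.2, hh.3, hh.4, hs.le.trans hh.5⟩

/-- A bounded sequence whose increments are almost orthogonal to all previous terms is Cauchy. -/
theorem cauchySeq_of_almost_orthogonal {H : Type*} [NormedAddCommGroup H] [InnerProductSpace ℝ H]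
    {x : ℕ → H} {B : ℝ} (hB : ∀ k, ‖x k‖ ≤ B)
    (hx : ∀ j, ∀ k ≤ j, |inner ℝ (x (j + 1) - x j) (x k)| ≤ (1 / 2) ^ j) : CauchySeq x := by
  have hin : ∀ k n, |inner ℝ (x (k + n) - x k) (x k)| ≤ 2 * (1 / 2) ^ k * (1 - (1 / 2) ^ n) := by
    intro k n
    induction n with
    | zero => simp
    | succ n ih =>
      have h1 := hx (k + n) k (Nat.le_add_right _ _)
      have e : x (k + (n + 1)) - x k = (x (k + n + 1) - x (k + n)) + (x (k + n) - x k) := by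
        rw [← add_assoc]; abel
      rw [e, inner_add_left]
      refine (abs_add_le _ _).trans ((add_le_add h1 ih).trans (le_of_eq ?_))
      rw [pow_add, pow_succ]; ring
  have hle : ∀ k m, k ≤ m → ‖x m - x k‖ ^ 2 ≤ ‖x m‖ ^ 2 - ‖x k‖ ^ 2 + 4 * (1 / 2) ^ k := by
    intro k m hkm
    obtain ⟨n, rfl⟩ := Nat.exists_eq_add_of_le hkm
    have h1 := (abs_le.1 (hin k n)).1
    have h2 : 2 * (1 / 2 : ℝ) ^ k * (1 - (1 / 2) ^ n) ≤ 2 * (1 / 2) ^ k := by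
      have : (0 : ℝ) < 2 * (1 / 2) ^ k * (1 / 2) ^ n := by positivity
      linarith
    have h3 : ‖x (k + n)‖ ^ 2 = ‖x (k + n) - x k‖ ^ 2
        + 2 * inner ℝ (x (k + n) - x k) (x k) + ‖x k‖ ^ 2 := by
      rw [← norm_add_sq_real, sub_add_cancel]
    linarith
  have hmono : Monotone fun k => ‖x k‖ ^ 2 - 4 * (1 / 2 : ℝ) ^ k := by
    refine monotone_nat_of_le_succ fun k => ?_
    have h1 := (abs_le.1 (hx k k le_rfl)).1
    have h3 : ‖x (k + 1)‖ ^ 2 = ‖x (k + 1) - x k‖ ^ 2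
        + 2 * inner ℝ (x (k + 1) - x k) (x k) + ‖x k‖ ^ 2 := by
      rw [← norm_add_sq_real, sub_add_cancel]
    have h4 : (1 / 2 : ℝ) ^ (k + 1) = (1 / 2) ^ k / 2 := by rw [pow_succ]; ring
    rw [h4]
    linarith [sq_nonneg ‖x (k + 1) - x k‖]
  have hbdd : BddAbove (Set.range fun k => ‖x k‖ ^ 2 - 4 * (1 / 2 : ℝ) ^ k) := by
    refine ⟨B ^ 2, ?_⟩
    rintro _ ⟨k, rfl⟩
    have := pow_le_pow_left₀ (norm_nonneg _) (hB k) 2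
    have h2 : (0 : ℝ) < 4 * (1 / 2) ^ k := by positivity
    simp only
    linarith
  have hpow : Filter.Tendsto (fun k : ℕ => 4 * (1 / 2 : ℝ) ^ k) Filter.atTop (nhds 0) := by
    simpa using (tendsto_pow_atTop_nhds_zero_of_lt_one (r := (1 / 2 : ℝ)) (by norm_num)
      (by norm_num)).const_mul 4
  have hlim := (tendsto_atTop_ciSup hmono hbdd).add hpow
  simp only [sub_add_cancel] at hlim
  have hcau := hlim.cauchySeq
  rw [Metric.cauchySeq_iff] at hcau
  rw [Metric.cauchySeq_iff']
  intro ε hε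
  obtain ⟨N₁, h₁⟩ := hcau (ε ^ 2 / 2) (by positivity)
  obtain ⟨N₂, h₂⟩ := (hpow.eventually (gt_mem_nhds (show 0 < ε ^ 2 / 2 by positivity))).exists_forall_of_atTop
  refine ⟨max N₁ N₂, fun n hn => ?_⟩
  have h3 := hle _ _ hn
  have h4 := h₁ n ((le_max_left _ _).trans hn) (max N₁ N₂) (le_max_left _ _)
  have h5 := h₂ (max N₁ N₂) (le_max_right _ _)
  rw [Real.dist_eq] at h4
  rw [dist_eq_norm]
  refine lt_of_pow_lt_pow_left₀ 2 hε.le ?_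
  linarith [le_abs_self (‖x n‖ ^ 2 - ‖x (max N₁ N₂)‖ ^ 2)]

/-- `g` is a compactly supported potential in `Ω` whose field keeps the constant state `zbar`
inside the strict subsolution states over `Ω`. -/
structure IsAdmissiblePotential (C : ℝ) (Ω : Set SpaceTime) (zbar : State) (g : SpaceTime → ℝ) :
    Prop where
  smooth : Smooth g
  hasCompactSupport : HasCompactSupport g
  tsupport_subset : tsupport g ⊆ Ω
  mem_subStates : ∀ y ∈ Ω, zbar + waveOp g y ∈ subStates C

theorem isAdmissiblePotential_zero {C : ℝ} (Ω : Set SpaceTime) {zbar : State}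
    (hz : zbar ∈ subStates C) : IsAdmissiblePotential C Ω zbar fun _ => 0 where
  smooth := contDiff_const
  hasCompactSupport := HasCompactSupport.zero
  tsupport_subset := by
    have h : Function.support (fun _ : SpaceTime => (0 : ℝ)) = ∅ := by ext; simp
    rw [tsupport, h]
    simp
  mem_subStates := by simpa [waveOp_zero] using fun _ _ _ => hz

theorem IsAdmissiblePotential.integrable_waveOp {C : ℝ} {Ω : Set SpaceTime} {zbar : State}
    {g : SpaceTime → ℝ} (hg : IsAdmissiblePotential C Ω zbar g) :
    Integrable (waveOp g) weightMeasure :=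
  (continuous_waveOp hg.smooth).integrable_of_hasCompactSupport
    (hasCompactSupport_waveOp hg.hasCompactSupport)

theorem IsAdmissiblePotential.exists_succ {C : ℝ} {Ω : Set SpaceTime} (hΩ : IsOpen Ω)
    {zbar : State} {g : SpaceTime → ℝ} (hg : IsAdmissiblePotential C Ω zbar g)
    {G : Set (SpaceTime → State)} (hG : G.Finite) (hGi : ∀ f ∈ G, Integrable f weightMeasure)
    {ε : ℝ} (hε : 0 < ε) :
    ∃ g', IsAdmissiblePotential C Ω zbar g' ∧
      (∀ f ∈ G, |∫ y, inner ℝ (waveOp g' y - waveOp g y) (f y) ∂weightMeasure| ≤ ε) ∧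
      (∫ y in Ω, gap C (zbar + waveOp g y) ^ 2 ∂weightMeasure) / 2
        ≤ 16384 * C * ∫ y, ‖waveOp g' y - waveOp g y‖ ^ 2 ∂weightMeasure := by
  obtain ⟨h, A, hA, hAΩ, hh⟩ := exists_perturbation hΩ
    (continuous_const.add (continuous_waveOp hg.smooth)) hg.mem_subStates hG hGi hε
  have hadd := waveOp_add hg.smooth hh.smooth
  have hhc : HasCompactSupport h := hA.of_isClosed_subset (isClosed_tsupport _) hh.tsupport_subset
  refine ⟨fun y => g y + h y, ⟨hg.smooth.add hh.smooth, hg.hasCompactSupport.add hhc, ?_,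
    fun y hy => ?_⟩, fun f hf => ?_, ?_⟩
  · exact (tsupport_add g h).trans
      (Set.union_subset hg.tsupport_subset (hh.tsupport_subset.trans hAΩ))
  · rw [hadd, ← add_assoc]
    exact hh.mem_subStates y hy
  · simp only [hadd, add_sub_cancel_left]
    exact hh.abs_integral_inner_le f hf
  · simp only [hadd, add_sub_cancel_left]
    exact hh.le_energy

theorem exists_potential_seq {C : ℝ} {Ω : Set SpaceTime} (hΩ : IsOpen Ω)
    {zbar : State} (hz : zbar ∈ subStates C) {F : Set (SpaceTime → State)} (hF : F.Finite)
    (hFi : ∀ f ∈ F, Integrable f weightMeasure) {ε : ℝ} (hε : 0 < ε) :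
    ∃ g : ℕ → SpaceTime → ℝ, (∀ k, IsAdmissiblePotential C Ω zbar (g k)) ∧
      (∀ k, ∀ f ∈ F, |∫ y, inner ℝ (waveOp (g k) y) (f y) ∂weightMeasure| ≤ ε) ∧
      (∀ j, ∀ k ≤ j, |∫ y, inner ℝ (waveOp (g (j + 1)) y - waveOp (g j) y) (waveOp (g k) y)
        ∂weightMeasure| ≤ (1 / 2) ^ j) ∧
      ∀ k, (∫ y in Ω, gap C (zbar + waveOp (g k) y) ^ 2 ∂weightMeasure) / 2
        ≤ 16384 * C * ∫ y, ‖waveOp (g (k + 1)) y - waveOp (g k) y‖ ^ 2 ∂weightMeasure := by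
  let T := {p : (SpaceTime → ℝ) × Set (SpaceTime → State) //
    IsAdmissiblePotential C Ω zbar p.1 ∧ p.2.Finite ∧ ∀ f ∈ p.2, Integrable f weightMeasure}
  have hstep : ∀ (n : ℕ) (s : T), ∃ s' : T, s'.1.2 = insert (waveOp s'.1.1) s.1.2 ∧
      (∀ f ∈ s.1.2, |∫ y, inner ℝ (waveOp s'.1.1 y - waveOp s.1.1 y) (f y) ∂weightMeasure|
        ≤ min ε 1 * (1 / 2) ^ (n + 1)) ∧
      (∫ y in Ω, gap C (zbar + waveOp s.1.1 y) ^ 2 ∂weightMeasure) / 2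
        ≤ 16384 * C * ∫ y, ‖waveOp s'.1.1 y - waveOp s.1.1 y‖ ^ 2 ∂weightMeasure := by
    rintro n ⟨⟨g, G⟩, hg, hG, hGi⟩
    obtain ⟨g', hg', h1, h2⟩ := hg.exists_succ hΩ hG hGi
      (ε := min ε 1 * (1 / 2) ^ (n + 1)) (by positivity)
    refine ⟨⟨⟨g', insert (waveOp g') G⟩, hg', hG.insert _, ?_⟩, rfl, h1, h2⟩
    rintro f (rfl | hf)
    exacts [hg'.integrable_waveOp, hGi f hf]
  choose next hnext using hstep
  let s₀ : T := ⟨⟨fun _ => 0, insert (waveOp fun _ => 0) F⟩, isAdmissiblePotential_zero Ω hz,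
    hF.insert _, by
      rintro f (rfl | hf)
      exacts [(isAdmissiblePotential_zero Ω hz).integrable_waveOp, hFi f hf]⟩
  let s : ℕ → T := fun n => Nat.rec s₀ next n
  have hs : ∀ n, s (n + 1) = next n (s n) := fun _ => rfl
  have hmono : ∀ n, (s n).1.2 ⊆ (s (n + 1)).1.2 := fun n => by
    rw [hs, (hnext n (s n)).1]
    exact Set.subset_insert _ _
  have hmono' : ∀ {k j}, k ≤ j → (s k).1.2 ⊆ (s j).1.2 := fun h =>
    monotone_nat_of_le_succ (f := fun n => (s n).1.2) hmono h
  have hself : ∀ n, waveOp (s n).1.1 ∈ (s n).1.2 := by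
    rintro (_ | n)
    · exact Set.mem_insert _ _
    · rw [hs, (hnext n (s n)).1]
      exact Set.mem_insert _ _
  have hFs : ∀ n, F ⊆ (s n).1.2 := fun n =>
    (Set.subset_insert _ _).trans (hmono' (k := 0) (Nat.zero_le n))
  refine ⟨fun n => (s n).1.1, fun n => (s n).2.1, fun k f hf => ?_, fun j k hk => ?_,
    fun k => (hnext k (s k)).2.2⟩
  · have : |∫ y, inner ℝ (waveOp (s k).1.1 y) (f y) ∂weightMeasure| ≤ ε * (1 - (1 / 2) ^ k) := by
      induction k with
      | zero =>
        have : waveOp (s 0).1.1 = 0 := waveOp_zero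
        simp [this]
      | succ k ih =>
        have h1 := (hnext k (s k)).2.1 f (hFs k hf)
        rw [← hs] at h1
        have hi : ∀ n, Integrable (fun y => inner ℝ (waveOp (s n).1.1 y) (f y)) weightMeasure :=
          fun n => integrable_inner_waveOp (s n).2.1.smooth (s n).2.1.hasCompactSupport (hFi f hf)
        have h2 : ∫ y, inner ℝ (waveOp (s (k + 1)).1.1 y) (f y) ∂weightMeasure
            = (∫ y, inner ℝ (waveOp (s (k + 1)).1.1 y - waveOp (s k).1.1 y) (f y) ∂weightMeasure)
              + ∫ y, inner ℝ (waveOp (s k).1.1 y) (f y) ∂weightMeasure := by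
          simp only [inner_sub_left]
          rw [integral_sub (hi (k + 1)) (hi k), sub_add_cancel]
        rw [h2]
        refine (abs_add_le _ _).trans ((add_le_add h1 ih).trans ?_)
        have h3 : min ε 1 * (1 / 2 : ℝ) ^ (k + 1) ≤ ε * (1 / 2) ^ (k + 1) :=
          mul_le_mul_of_nonneg_right (min_le_left _ _) (by positivity)
        have h4 : (1 / 2 : ℝ) ^ k = 2 * (1 / 2) ^ (k + 1) := by rw [pow_succ]; ring
        rw [h4]
        linarith
    refine this.trans (mul_le_of_le_one_right hε.le ?_)
    have : (0 : ℝ) < (1 / 2) ^ k := by positivity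
    linarith
  · refine ((hnext j (s j)).2.1 _ (hmono' hk (hself k))).trans ?_
    have h3 : min ε 1 * (1 / 2 : ℝ) ^ (j + 1) ≤ 1 * (1 / 2) ^ (j + 1) :=
      mul_le_mul_of_nonneg_right (min_le_right _ _) (by positivity)
    have h4 : (1 / 2 : ℝ) ^ j = 2 * (1 / 2) ^ (j + 1) := by rw [pow_succ]; ring
    have h5 : (0 : ℝ) < (1 / 2) ^ (j + 1) := by positivity
    linarith

theorem isDistribSolution_of_tendsto {Z : ℕ → SpaceTime → State} {ζ : SpaceTime → State}
    (hZ : ∀ n, IsDistribSolution (Z n)) (hm : ∀ n, Measurable (Z n)) {D : ℝ}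
    (hD : ∀ n y, ‖Z n y‖ ≤ D)
    (hlim : ∀ᵐ y, Filter.Tendsto (fun n => Z n y) Filter.atTop (nhds (ζ y))) :
    IsDistribSolution ζ := by
  rintro φ hφ
  have hcoord : ∀ (i : Fin 4) n y, |Z n y i| ≤ D := fun i n y =>
    (PiLp.norm_apply_le (Z n y) i).trans (hD n y)
  have hmi : ∀ (i : Fin 4) n, Measurable fun y => Z n y i := fun i n =>
    ((EuclideanSpace.proj (𝕜 := ℝ) i).continuous.measurable).comp (hm n)
  have hi : ∀ w, Integrable (fun y => D * ‖dirDeriv w φ y‖) := fun w =>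
    (((Smooth.dirDeriv hφ.1 w).continuous.integrable_of_hasCompactSupport
      (hasCompactSupport_dirDeriv hφ.2 w)).norm.const_mul D)
  have hd : ∀ w, Measurable (dirDeriv w φ) := fun w => (Smooth.dirDeriv hφ.1 w).continuous.measurable
  have hbd : ∀ (i : Fin 4) w n y, ‖Z n y i * dirDeriv w φ y‖ ≤ D * ‖dirDeriv w φ y‖ :=
    fun i w n y => by
      rw [norm_mul]
      exact mul_le_mul_of_nonneg_right (hcoord i n y) (norm_nonneg _)
  have htend : ∀ {y}, Filter.Tendsto (fun n => Z n y) Filter.atTop (nhds (ζ y)) →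
      ∀ (i : Fin 4) w, Filter.Tendsto (fun n => Z n y i * dirDeriv w φ y) Filter.atTop
        (nhds (ζ y i * dirDeriv w φ y)) := fun {y} h i w =>
    (((EuclideanSpace.proj (𝕜 := ℝ) i).continuous.tendsto (ζ y)).comp h).mul_const _
  refine ⟨?_, ?_, ?_⟩
  · refine tendsto_nhds_unique (f := fun n => ∫ y, (Z n y 0 * dirDeriv dirX φ y
      + Z n y 1 * dirDeriv dirY φ y)) (tendsto_integral_of_dominated_convergence
      (fun y => D * ‖dirDeriv dirX φ y‖ + D * ‖dirDeriv dirY φ y‖) (fun n => ?_)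
      ((hi dirX).add (hi dirY)) (fun n => Filter.Eventually.of_forall fun y => ?_) ?_) ?_
    · exact (((hmi 0 n).mul (hd _)).add ((hmi 1 n).mul (hd _))).aestronglyMeasurable
    · exact (norm_add_le _ _).trans (add_le_add (hbd _ _ _ _) (hbd _ _ _ _))
    · filter_upwards [hlim] with y hy using (htend hy 0 dirX).add (htend hy 1 dirY)
    · simp only [fun n => ((hZ n) φ hφ).1]
      exact tendsto_const_nhds
  · refine tendsto_nhds_unique (f := fun n => ∫ y, (Z n y 0 * dirDeriv dirT φ y
      + Z n y 2 * dirDeriv dirX φ y + Z n y 3 * dirDeriv dirY φ y))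
      (tendsto_integral_of_dominated_convergence
      (fun y => D * ‖dirDeriv dirT φ y‖ + D * ‖dirDeriv dirX φ y‖ + D * ‖dirDeriv dirY φ y‖)
      (fun n => ?_) (((hi dirT).add (hi dirX)).add (hi dirY))
      (fun n => Filter.Eventually.of_forall fun y => ?_) ?_) ?_
    · exact ((((hmi 0 n).mul (hd _)).add ((hmi 2 n).mul (hd _))).add
        ((hmi 3 n).mul (hd _))).aestronglyMeasurable
    · exact (norm_add₃_le).trans
        (add_le_add (add_le_add (hbd _ _ _ _) (hbd _ _ _ _)) (hbd _ _ _ _))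
    · filter_upwards [hlim] with y hy using
        ((htend hy 0 dirT).add (htend hy 2 dirX)).add (htend hy 3 dirY)
    · simp only [fun n => ((hZ n) φ hφ).2.1]
      exact tendsto_const_nhds
  · refine tendsto_nhds_unique (f := fun n => ∫ y, (Z n y 1 * dirDeriv dirT φ y
      + Z n y 3 * dirDeriv dirX φ y - Z n y 2 * dirDeriv dirY φ y))
      (tendsto_integral_of_dominated_convergence
      (fun y => D * ‖dirDeriv dirT φ y‖ + D * ‖dirDeriv dirX φ y‖ + D * ‖dirDeriv dirY φ y‖)
      (fun n => ?_) (((hi dirT).add (hi dirX)).add (hi dirY))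
      (fun n => Filter.Eventually.of_forall fun y => ?_) ?_) ?_
    · exact ((((hmi 1 n).mul (hd _)).add ((hmi 3 n).mul (hd _))).sub
        ((hmi 2 n).mul (hd _))).aestronglyMeasurable
    · exact ((norm_sub_le _ _).trans (add_le_add (norm_add_le _ _) le_rfl)).trans
        (add_le_add (add_le_add (hbd _ _ _ _) (hbd _ _ _ _)) (hbd _ _ _ _))
    · filter_upwards [hlim] with y hy using
        ((htend hy 1 dirT).add (htend hy 3 dirX)).sub (htend hy 2 dirY)
    · simp only [fun n => ((hZ n) φ hφ).2.2]
      exact tendsto_const_nhds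

theorem IsAdmissiblePotential.norm_waveOp_le {C : ℝ} {Ω : Set SpaceTime} {zbar : State}
    (hz : zbar ∈ subStates C) {g : SpaceTime → ℝ} (hg : IsAdmissiblePotential C Ω zbar g)
    (y : SpaceTime) : ‖waveOp g y‖ ≤ 2 * (C + 1) + ‖zbar‖ := by
  by_cases hy : y ∈ Ω
  · have h := norm_le_of_mem_subStates (hg.mem_subStates y hy)
    calc ‖waveOp g y‖ = ‖(zbar + waveOp g y) - zbar‖ := by rw [add_sub_cancel_left]
      _ ≤ _ := (norm_sub_le _ _).trans (add_le_add h le_rfl)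
  · rw [waveOp_eq_zero fun h => hy (hg.tsupport_subset h), norm_zero]
    have := norm_nonneg zbar
    have := (norm_nonneg _).trans (norm_le_of_mem_subStates hz)
    linarith

/-- Convex integration: near any strict subsolution state there is a bounded distributional
solution supported in `Ω` that brings the state to the extreme set `|v|² = C`, `u = v ⊗ v - C/2`. -/
theorem exists_exact_solution {C : ℝ} {Ω : Set SpaceTime} (hΩ : IsOpen Ω)
    {zbar : State} (hz : zbar ∈ subStates C) {F : Set (SpaceTime → State)} (hF : F.Finite)
    (hFi : ∀ f ∈ F, Integrable f weightMeasure) {ε : ℝ} (hε : 0 < ε) :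
    ∃ ζ : SpaceTime → State, Measurable ζ ∧ (∃ D, ∀ y, ‖ζ y‖ ≤ D) ∧ (∀ y ∉ Ω, ζ y = 0) ∧
      IsDistribSolution ζ ∧
      (∀ᵐ y, y ∈ Ω → gap C (zbar + ζ y) = 0 ∧ defect (zbar + ζ y) = 0) ∧
      ∀ f ∈ F, |∫ y, inner ℝ (ζ y) (f y) ∂weightMeasure| ≤ ε := by
  obtain ⟨g, hg, hgF, hgg, hge⟩ := exists_potential_seq hΩ hz hF hFi hε
  set D := 2 * (C + 1) + ‖zbar‖ with hD
  have hgD : ∀ k y, ‖waveOp (g k) y‖ ≤ D := fun k y => (hg k).norm_waveOp_le hz y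
  have hD0 : 0 ≤ D := (norm_nonneg _).trans (hgD 0 0)
  have hcont : ∀ k, Continuous (waveOp (g k)) := fun k => continuous_waveOp (hg k).smooth
  have hmem : ∀ k, MemLp (waveOp (g k)) 2 weightMeasure := fun k =>
    (hcont k).memLp_of_hasCompactSupport (hasCompactSupport_waveOp (hg k).hasCompactSupport)
  let X : ℕ → Lp State 2 weightMeasure := fun k => (hmem k).toLp _
  have hinner : ∀ {f h : SpaceTime → State} (hf : MemLp f 2 weightMeasure)
      (hh : MemLp h 2 weightMeasure),
      inner ℝ (hf.toLp f) (hh.toLp h) = ∫ y, inner ℝ (f y) (h y) ∂weightMeasure := by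
    intro f h hf hh
    rw [L2.inner_def]
    refine integral_congr_ae ?_
    filter_upwards [hf.coeFn_toLp, hh.coeFn_toLp] with y h1 h2
    rw [h1, h2]
  have hsub : ∀ j k, X j - X k = ((hmem j).sub (hmem k)).toLp _ := fun j k => rfl
  have hcau : CauchySeq X := by
    refine cauchySeq_of_almost_orthogonal (B := measureUnivNNReal weightMeasure ^ (2 : ENNReal).toReal⁻¹ * D)
      (fun k => ?_) fun j k hk => ?_
    · refine Lp.norm_le_of_ae_bound hD0 ?_
      filter_upwards [(hmem k).coeFn_toLp] with y hy
      rw [hy]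
      exact hgD k y
    · rw [hsub, hinner]
      exact hgg j k hk
  obtain ⟨X', hX'⟩ := cauchySeq_tendsto_of_complete hcau
  obtain ⟨ns, hns, hae⟩ := (tendstoInMeasure_of_tendsto_Lp hX').exists_seq_tendsto_ae
  have hall : ∀ᵐ y ∂weightMeasure, ∀ k, X k y = waveOp (g k) y :=
    ae_all_iff.2 fun k => (hmem k).coeFn_toLp
  have hXm : Measurable (X' : SpaceTime → State) := (Lp.stronglyMeasurable X').measurable
  let ζ : SpaceTime → State := (Ω ∩ {y | ‖X' y‖ ≤ D}).indicator X'
  have hζm : Measurable ζ := hXm.indicator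
    (hΩ.measurableSet.inter (measurableSet_le hXm.norm measurable_const))
  have hζD : ∀ y, ‖ζ y‖ ≤ D := fun y => by
    by_cases hy : y ∈ Ω ∩ {y | ‖X' y‖ ≤ D}
    · simp only [ζ, Set.indicator_of_mem hy]
      exact hy.2
    · simp only [ζ, Set.indicator_of_notMem hy, norm_zero]
      exact hD0
  have hζΩ : ∀ y ∉ Ω, ζ y = 0 := fun y hy => Set.indicator_of_notMem (fun h => hy h.1) _
  have hlimw : ∀ᵐ y ∂weightMeasure, Filter.Tendsto (fun n => waveOp (g (ns n)) y) Filter.atTop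
      (nhds (ζ y)) := by
    filter_upwards [hae, hall] with y h1 h2
    simp only [h2] at h1
    by_cases hy : y ∈ Ω
    · have hX'y : y ∈ Ω ∩ {y | ‖X' y‖ ≤ D} :=
        ⟨hy, le_of_tendsto h1.norm (Filter.Eventually.of_forall fun n => hgD _ y)⟩
      rwa [show ζ y = X' y from Set.indicator_of_mem hX'y _]
    · rw [hζΩ y hy]
      refine tendsto_const_nhds.congr fun n => (waveOp_eq_zero fun h => hy ?_).symm
      exact (hg _).tsupport_subset h
  have hlim : ∀ᵐ y, Filter.Tendsto (fun n => waveOp (g (ns n)) y) Filter.atTop (nhds (ζ y)) :=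
    volume_absolutelyContinuous_weightMeasure.ae_le hlimw
  have hgap0 : Filter.Tendsto (fun k => ∫ y in Ω, gap C (zbar + waveOp (g k) y) ^ 2 ∂weightMeasure)
      Filter.atTop (nhds 0) := by
    have h1 : ∀ k, ∫ y, ‖waveOp (g (k + 1)) y - waveOp (g k) y‖ ^ 2 ∂weightMeasure
        = ‖X (k + 1) - X k‖ ^ 2 := fun k => by
      rw [← real_inner_self_eq_norm_sq, hsub, hinner]
      simp only [Pi.sub_apply, real_inner_self_eq_norm_sq]
    have h2 : Filter.Tendsto (fun k => 2 * (16384 * C * ‖X (k + 1) - X k‖ ^ 2)) Filter.atTop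
        (nhds 0) := by
      have h3 := ((hX'.comp (Filter.tendsto_add_atTop_nat 1)).sub hX').norm.pow 2
      have := (h3.const_mul (16384 * C)).const_mul 2
      simpa using this
    refine squeeze_zero (fun k => integral_nonneg fun y => sq_nonneg _) (fun k => ?_) h2
    have := hge k
    rw [h1] at this
    linarith
  have hgapint : ∫ y in Ω, gap C (zbar + ζ y) ^ 2 ∂weightMeasure = 0 := by
    refine tendsto_nhds_unique (tendsto_integral_of_dominated_convergence
      (F := fun n y => gap C (zbar + waveOp (g (ns n)) y) ^ 2) (fun _ => C ^ 2) (fun n => ?_)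
      (integrable_const _) (fun n => ?_) ?_) (hgap0.comp hns.tendsto_atTop)
    · exact (((continuous_gap C).comp (continuous_const.add (hcont _))).pow 2).aestronglyMeasurable
    · filter_upwards [ae_restrict_mem hΩ.measurableSet] with y hy
      rw [Real.norm_eq_abs, abs_of_nonneg (sq_nonneg _)]
      exact sq_gap_le ((hg _).mem_subStates y hy)
    · filter_upwards [ae_restrict_of_ae hlimw] with y hy
      exact (((continuous_gap C).tendsto _).comp (hy.const_add zbar)).pow 2
  have hζgap : ∀ᵐ y, y ∈ Ω → gap C (zbar + ζ y) = 0 := by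
    have hm : Measurable fun y => gap C (zbar + ζ y) ^ 2 :=
      (((continuous_gap C).measurable.comp (hζm.const_add zbar)).pow_const 2)
    have hint : IntegrableOn (fun y => gap C (zbar + ζ y) ^ 2) Ω weightMeasure := by
      refine Measure.integrableOn_of_bounded (M := C ^ 2) (measure_ne_top _ _)
        hm.aestronglyMeasurable ?_
      filter_upwards [ae_restrict_mem hΩ.measurableSet, ae_restrict_of_ae hlimw] with y hy hl
      rw [Real.norm_eq_abs, abs_of_nonneg (sq_nonneg _)]
      exact le_of_tendsto ((((continuous_gap C).tendsto _).comp (hl.const_add zbar)).pow 2)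
        (Filter.Eventually.of_forall fun n => sq_gap_le ((hg _).mem_subStates y hy))
    have h0 := (setIntegral_eq_zero_iff_of_nonneg_ae
      (Filter.Eventually.of_forall fun y => sq_nonneg _) hint).1 hgapint
    have h1 := (ae_restrict_iff' hΩ.measurableSet).1 h0
    filter_upwards [volume_absolutelyContinuous_weightMeasure.ae_le h1] with y hy hyΩ
    exact pow_eq_zero_iff (two_ne_zero) |>.1 (hy hyΩ)
  refine ⟨ζ, hζm, ⟨D, hζD⟩, hζΩ, ?_, ?_, fun f hf => ?_⟩
  · exact isDistribSolution_of_tendsto (fun n => isDistribSolution_waveOp (hg (ns n)).smooth)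
      (fun n => (hcont _).measurable) (fun n => hgD _) hlim
  · filter_upwards [hζgap, hlim] with y h1 h2 hy
    refine ⟨h1 hy, le_antisymm ?_ (defect_nonneg _)⟩
    have h3 := h2.const_add zbar
    have h4 := le_of_tendsto_of_tendsto' ((continuous_defect.tendsto _).comp h3)
      ((((continuous_gap C).tendsto _).comp h3).div_const 2 |>.pow 2)
      fun n => ((hg (ns n)).mem_subStates y hy).2.le
    simpa [h1 hy] using h4
  · refine le_of_tendsto (tendsto_integral_of_dominated_convergence
      (F := fun n y => inner ℝ (waveOp (g (ns n)) y) (f y)) (fun y => D * ‖f y‖) (fun n => ?_)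
      ((hFi f hf).norm.const_mul D) (fun n => Filter.Eventually.of_forall fun y => ?_) ?_).abs
      (Filter.Eventually.of_forall fun n => hgF (ns n) f hf)
    · exact (hcont _).aestronglyMeasurable.inner (hFi f hf).1
    · exact (norm_inner_le_norm _ _).trans
        (mul_le_mul_of_nonneg_right (hgD _ y) (norm_nonneg _))
    · filter_upwards [hlimw] with y hy using hy.inner tendsto_const_nhds

theorem integrable_mul_of_bounded {a ψ : SpaceTime → ℝ} (ha : Measurable a) {M : ℝ}
    (hM : ∀ q, |a q| ≤ M) (hψ : Continuous ψ) (hc : HasCompactSupport ψ) :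
    Integrable (fun q => a q * ψ q) :=
  (hψ.integrable_of_hasCompactSupport hc).bdd_mul ha.aestronglyMeasurable
    (Filter.Eventually.of_forall hM)

theorem tendsto_integral_slice {e : SpaceTime → ℝ} {e₀ : (Fin 2 → ℝ) → ℝ} (he : Measurable e)
    {M : ℝ} (hM : ∀ q, |e q| ≤ M)
    (hlim : ∀ᵐ x, Filter.Tendsto (fun t => e (x, t)) (nhdsWithin 0 (Set.Ioi 0)) (nhds (e₀ x)))
    {φ : SpaceTime → ℝ} (hφ : Continuous φ) (hc : HasCompactSupport φ) :
    Filter.Tendsto (fun t => ∫ x, e (x, t) * φ (x, t)) (nhdsWithin 0 (Set.Ioi 0))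
      (nhds (∫ x, e₀ x * φ (x, 0))) := by
  obtain ⟨B, hB⟩ := hc.exists_bound_of_continuous hφ
  have hK : IsCompact (Prod.fst '' tsupport φ) := IsCompact.image hc continuous_fst
  refine tendsto_integral_filter_of_dominated_convergence
    ((Prod.fst '' tsupport φ).indicator fun _ => M * B)
    (Filter.Eventually.of_forall fun t => ?_) (Filter.Eventually.of_forall fun t =>
      Filter.Eventually.of_forall fun x => ?_) ?_ ?_
  · exact ((he.comp measurable_prodMk_right).mul
      (hφ.measurable.comp measurable_prodMk_right)).aestronglyMeasurable
  · by_cases hx : x ∈ Prod.fst '' tsupport φ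
    · rw [Set.indicator_of_mem hx, norm_mul]
      exact mul_le_mul (hM _) (hB _) (norm_nonneg _) ((abs_nonneg _).trans (hM 0))
    · have : φ (x, t) = 0 := by
        by_contra h
        exact hx ⟨(x, t), subset_tsupport _ h, rfl⟩
      rw [Set.indicator_of_notMem hx, this, mul_zero, norm_zero]
  · exact (integrable_indicator_iff hK.measurableSet).2 (integrableOn_const hK.measure_ne_top)
  · filter_upwards [hlim] with x hx
    refine hx.mul ?_
    exact ((hφ.comp (Continuous.prodMk_right x)).tendsto 0).mono_left nhdsWithin_le_nhds

/-- A smooth monotone function vanishing for `t ≤ δ` and equal to one for `t ≥ 2δ`. -/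
def timeCutoff (δ t : ℝ) : ℝ := Real.smoothTransition (t / δ - 1)

theorem contDiff_timeCutoff (δ : ℝ) : ContDiff ℝ (⊤ : ℕ∞) (timeCutoff δ) :=
  Real.smoothTransition.contDiff.comp ((contDiff_id.div_const δ).sub contDiff_const)

theorem timeCutoff_eq_zero {δ t : ℝ} (hδ : 0 < δ) (ht : t ≤ δ) : timeCutoff δ t = 0 :=
  Real.smoothTransition.zero_of_nonpos (sub_nonpos.2 ((div_le_one hδ).2 ht))

theorem timeCutoff_eq_one {δ t : ℝ} (hδ : 0 < δ) (ht : 2 * δ ≤ t) : timeCutoff δ t = 1 := by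
  refine Real.smoothTransition.one_of_one_le ?_
  have : 2 ≤ t / δ := (le_div_iff₀ hδ).2 ht
  linarith

theorem monotone_timeCutoff {δ : ℝ} (hδ : 0 < δ) : Monotone (timeCutoff δ) := fun _ _ h =>
  Real.smoothTransition.monotone (sub_le_sub_right (div_le_div_of_nonneg_right h hδ.le) 1)

theorem hasDerivAt_timeCutoff (δ t : ℝ) :
    HasDerivAt (timeCutoff δ) (deriv (timeCutoff δ) t) t :=
  (((contDiff_timeCutoff δ).differentiable (by simp)) t).hasDerivAt

theorem deriv_timeCutoff_nonneg {δ : ℝ} (hδ : 0 < δ) (t : ℝ) : 0 ≤ deriv (timeCutoff δ) t :=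
  (monotone_timeCutoff hδ).deriv_nonneg

theorem deriv_timeCutoff_eq_zero {δ t : ℝ} (hδ : 0 < δ) (ht : 2 * δ < t) :
    deriv (timeCutoff δ) t = 0 := by
  have : timeCutoff δ =ᶠ[nhds t] fun _ => 1 := by
    filter_upwards [lt_mem_nhds ht] with s hs using timeCutoff_eq_one hδ hs.le
  rw [this.deriv_eq, deriv_const]

theorem abs_timeCutoff_le_one (δ t : ℝ) : |timeCutoff δ t| ≤ 1 :=
  (abs_of_nonneg (Real.smoothTransition.nonneg _)).trans_le (Real.smoothTransition.le_one _)

theorem tendsto_timeCutoff_atTop {δ : ℝ} (hδ : 0 < δ) :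
    Filter.Tendsto (timeCutoff δ) Filter.atTop (nhds 1) := by
  refine tendsto_const_nhds.congr' ?_
  filter_upwards [Filter.eventually_ge_atTop (2 * δ)] with t ht
  exact (timeCutoff_eq_one hδ ht).symm

theorem integral_deriv_timeCutoff {δ : ℝ} (hδ : 0 < δ) :
    ∫ t in Set.Ioi 0, deriv (timeCutoff δ) t = 1 := by
  rw [integral_Ioi_of_hasDerivAt_of_nonneg (contDiff_timeCutoff δ).continuous.continuousWithinAt
    (fun t _ => hasDerivAt_timeCutoff δ t) (fun t _ => deriv_timeCutoff_nonneg hδ t)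
    (tendsto_timeCutoff_atTop hδ), timeCutoff_eq_zero hδ hδ.le, sub_zero]

theorem integrableOn_deriv_timeCutoff {δ : ℝ} (hδ : 0 < δ) :
    IntegrableOn (deriv (timeCutoff δ)) (Set.Ioi 0) :=
  integrableOn_Ioi_deriv_of_nonneg (contDiff_timeCutoff δ).continuous.continuousWithinAt
    (fun t _ => hasDerivAt_timeCutoff δ t) (fun t _ => deriv_timeCutoff_nonneg hδ t)
    (tendsto_timeCutoff_atTop hδ)

theorem fderiv_mul_timeCutoff {φ : SpaceTime → ℝ} (hφ : Smooth φ) (δ : ℝ) (q w : SpaceTime) :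
    fderiv ℝ (fun q => φ q * timeCutoff δ q.2) q w
      = fderiv ℝ φ q w * timeCutoff δ q.2 + φ q * (deriv (timeCutoff δ) q.2 * w.2) := by
  have h1 : HasFDerivAt (fun q : SpaceTime => timeCutoff δ q.2)
      (deriv (timeCutoff δ) q.2 • ContinuousLinearMap.snd ℝ (Fin 2 → ℝ) ℝ) q :=
    (hasDerivAt_timeCutoff δ q.2).comp_hasFDerivAt q hasFDerivAt_snd
  rw [((hφ.differentiableAt q).hasFDerivAt.fun_mul h1).fderiv]
  simp
  ring

theorem posTime_eq_prod : posTime = (Set.univ : Set (Fin 2 → ℝ)) ×ˢ Set.Ioi (0 : ℝ) := by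
  ext; simp [posTime]

theorem measurableSet_posTime : MeasurableSet posTime :=
  measurableSet_lt measurable_const measurable_snd

/-- An inequality in divergence form on `t > 0` extends up to `t = 0` with a boundary term given
by the trace of the density. -/
theorem divergence_inequality_with_trace {e : SpaceTime → ℝ} {f : Fin 2 → SpaceTime → ℝ}
    {e₀ : (Fin 2 → ℝ) → ℝ} (he : Measurable e) (hf : ∀ i, Measurable (f i)) {M : ℝ}
    (heM : ∀ q, |e q| ≤ M) (hfM : ∀ i q, |f i q| ≤ M)
    (hlim : ∀ᵐ x, Filter.Tendsto (fun t => e (x, t)) (nhdsWithin 0 (Set.Ioi 0)) (nhds (e₀ x)))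
    (hineq : ∀ φ : SpaceTime → ℝ, IsTest φ → (∀ q, 0 ≤ φ q) → tsupport φ ⊆ posTime →
      0 ≤ ∫ q in posTime, (e q * pdt φ q + ∑ i, f i q * pdx i φ q))
    {φ : SpaceTime → ℝ} (hφ : IsTest φ) (hφ0 : ∀ q, 0 ≤ φ q) :
    0 ≤ (∫ q in posTime, (e q * pdt φ q + ∑ i, f i q * pdx i φ q))
      + ∫ x, e₀ x * φ (x, 0) := by
  obtain ⟨hφs, hφc⟩ := hφ
  replace hφs : Smooth φ := hφs
  have hint : Integrable fun q => e q * pdt φ q + ∑ i, f i q * pdx i φ q := by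
    refine (integrable_mul_of_bounded he heM (hφs.dirDeriv dirT).continuous
      (hasCompactSupport_dirDeriv hφc _)).add (integrable_finsetSum _ fun i _ => ?_)
    exact integrable_mul_of_bounded (hf i) (hfM i) (hφs.dirDeriv (Pi.single i 1, 0)).continuous
      (hasCompactSupport_dirDeriv hφc _)
  have hslice := tendsto_integral_slice he heM hlim hφs.continuous hφc
  have hA : Filter.Tendsto (fun δ => ∫ q in posTime,
      (e q * pdt φ q + ∑ i, f i q * pdx i φ q) * timeCutoff δ q.2)
      (nhdsWithin 0 (Set.Ioi 0))
      (nhds (∫ q in posTime, (e q * pdt φ q + ∑ i, f i q * pdx i φ q))) := by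
    refine tendsto_integral_filter_of_dominated_convergence _
      (Filter.Eventually.of_forall fun δ => ?_) (Filter.Eventually.of_forall fun δ =>
      Filter.Eventually.of_forall fun q => ?_) hint.norm.integrableOn ?_
    · exact hint.1.restrict.mul
        ((contDiff_timeCutoff δ).continuous.comp continuous_snd).aestronglyMeasurable
    · rw [norm_mul]
      exact mul_le_of_le_one_right (norm_nonneg _) (abs_timeCutoff_le_one _ _)
    · filter_upwards [ae_restrict_mem measurableSet_posTime] with q hq
      refine tendsto_const_nhds.congr' ?_
      have h0 : (0 : ℝ) < q.2 / 2 := half_pos hq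
      filter_upwards [self_mem_nhdsWithin, nhdsWithin_le_nhds (gt_mem_nhds h0)] with δ h1 h2
      rw [timeCutoff_eq_one h1 (by linarith), mul_one]
  have key : ∀ η > 0, ∀ᶠ δ in nhdsWithin (0 : ℝ) (Set.Ioi 0), 0 ≤ (∫ q in posTime,
      (e q * pdt φ q + ∑ i, f i q * pdx i φ q) * timeCutoff δ q.2)
        + ((∫ x, e₀ x * φ (x, 0)) + η) := by
    intro η hη
    have h1 := hslice.eventually (gt_mem_nhds (lt_add_of_pos_right _ hη))
    obtain ⟨r, hr, hr'⟩ := mem_nhdsGT_iff_exists_Ioc_subset.1 h1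
    have hr2 : (0 : ℝ) < r / 2 := half_pos hr
    filter_upwards [self_mem_nhdsWithin, nhdsWithin_le_nhds (gt_mem_nhds hr2)] with δ hδ hδr
    replace hδ : 0 < δ := hδ
    have hkc : Continuous fun q : SpaceTime => deriv (timeCutoff δ) q.2 :=
      ((contDiff_timeCutoff δ).continuous_deriv (by simp)).comp continuous_snd
    have hint2 : Integrable fun q => e q * (φ q * deriv (timeCutoff δ) q.2) :=
      integrable_mul_of_bounded he heM (hφs.continuous.mul hkc) hφc.mul_right
    have hcut : Smooth fun q : SpaceTime => timeCutoff δ q.2 :=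
      (contDiff_timeCutoff δ).comp contDiff_snd
    have h3 := hineq (fun q => φ q * timeCutoff δ q.2) ⟨hφs.mul hcut, hφc.mul_right⟩
      (fun q => mul_nonneg (hφ0 q) (Real.smoothTransition.nonneg _)) (by
        have : tsupport (fun q : SpaceTime => φ q * timeCutoff δ q.2) ⊆ {q | δ ≤ q.2} := by
          refine closure_minimal (fun q hq => ?_) (isClosed_le continuous_const continuous_snd)
          by_contra hc
          exact hq (by simp [timeCutoff_eq_zero hδ (not_le.1 hc).le])
        exact this.trans fun q hq => hδ.trans_le hq)
    have h4 : ∀ q, e q * pdt (fun q => φ q * timeCutoff δ q.2) q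
        + ∑ i, f i q * pdx i (fun q => φ q * timeCutoff δ q.2) q
        = (e q * pdt φ q + ∑ i, f i q * pdx i φ q) * timeCutoff δ q.2
          + e q * (φ q * deriv (timeCutoff δ) q.2) := by
      intro q
      simp only [pdt, pdx, fderiv_mul_timeCutoff hφs, Fin.sum_univ_two]
      ring
    simp only [h4] at h3
    rw [integral_add (hint.mul_bdd (c := 1) hcut.continuous.aestronglyMeasurable
      (Filter.Eventually.of_forall fun q => abs_timeCutoff_le_one _ _)).integrableOn hint2.integrableOn] at h3
    refine h3.trans (add_le_add le_rfl ?_)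
    have h5 : IntegrableOn (fun q => e q * (φ q * deriv (timeCutoff δ) q.2)) posTime :=
      hint2.integrableOn
    have hres : (volume : Measure SpaceTime).restrict posTime
        = (volume : Measure (Fin 2 → ℝ)).prod ((volume : Measure ℝ).restrict (Set.Ioi 0)) := by
      rw [posTime_eq_prod, Measure.volume_eq_prod, ← Measure.prod_restrict, Measure.restrict_univ]
    rw [IntegrableOn, hres] at h5
    rw [hres, integral_prod_symm _ h5]
    have h6 : ∀ t, ∫ x, e (x, t) * (φ (x, t) * deriv (timeCutoff δ) t)
        = (∫ x, e (x, t) * φ (x, t)) * deriv (timeCutoff δ) t := fun t => by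
      simp only [← mul_assoc]
      exact integral_mul_const _ _
    have h7 := h5.integral_prod_right
    simp only [h6] at h7 ⊢
    refine (setIntegral_mono_on h7 ((integrableOn_deriv_timeCutoff hδ).const_mul
      ((∫ x, e₀ x * φ (x, 0)) + η)) measurableSet_Ioi fun t ht => ?_).trans_eq ?_
    · rcases le_or_gt t (2 * δ) with h | h
      · refine mul_le_mul_of_nonneg_right (le_of_lt ?_) (deriv_timeCutoff_nonneg hδ t)
        exact hr' ⟨ht, by linarith⟩
      · rw [deriv_timeCutoff_eq_zero hδ h, mul_zero, mul_zero]
    · rw [integral_const_mul, integral_deriv_timeCutoff hδ, mul_one]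
  refine le_of_forall_pos_le_add fun η hη => ?_
  rw [add_assoc]
  exact ge_of_tendsto (hA.add_const _) (key η hη)

theorem setIntegral_posTime_eq_of_ae_eq_add {F G A₁ A₂ : SpaceTime → ℝ} {c₁ c₂ : ℝ}
    (h₁ : Integrable A₁) (h₂ : Integrable A₂) (hi₁ : ∫ q, A₁ q = 0) (hi₂ : ∫ q, A₂ q = 0)
    (hz₁ : ∀ q ∉ posTime, A₁ q = 0) (hz₂ : ∀ q ∉ posTime, A₂ q = 0)
    (h : ∀ᵐ q, q ∈ posTime → F q = G q + (c₁ * A₁ q + c₂ * A₂ q)) :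
    ∫ q in posTime, F q = ∫ q in posTime, G q := by
  have hH : IntegrableOn (fun q => c₁ * A₁ q + c₂ * A₂ q) posTime :=
    ((h₁.const_mul c₁).add (h₂.const_mul c₂)).integrableOn
  have hH0 : ∫ q in posTime, (c₁ * A₁ q + c₂ * A₂ q) = 0 := by
    rw [setIntegral_eq_integral_of_forall_compl_eq_zero fun q hq => by
        rw [hz₁ q hq, hz₂ q hq]; simp,
      integral_add (h₁.const_mul c₁) (h₂.const_mul c₂), integral_const_mul, integral_const_mul,
      hi₁, hi₂]
    simp
  have hae : F =ᵐ[volume.restrict posTime] fun q => G q + (c₁ * A₁ q + c₂ * A₂ q) :=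
    (ae_restrict_iff' measurableSet_posTime).2 h
  rw [integral_congr_ae hae]
  by_cases hG : IntegrableOn G posTime
  · rw [integral_add hG hH, hH0, add_zero]
  · rw [integral_undef hG, integral_undef]
    intro hc
    refine hG ((hc.sub hH).congr (Filter.Eventually.of_forall fun q => ?_))
    simp

theorem IsDistribSolution.integral_velocity {ζ : SpaceTime → State} (h : IsDistribSolution ζ)
    {φ : SpaceTime → ℝ} (hφ : IsTest φ) : ∫ y, (ζ y 0 * pdx 0 φ y + ζ y 1 * pdx 1 φ y) = 0 :=
  (h φ hφ).1

theorem IsDistribSolution.integral_momentum_zero {ζ : SpaceTime → State} (h : IsDistribSolution ζ)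
    {φ : SpaceTime → ℝ} (hφ : IsTest φ) :
    ∫ y, (ζ y 0 * pdt φ y + ζ y 2 * pdx 0 φ y + ζ y 3 * pdx 1 φ y) = 0 :=
  (h φ hφ).2.1

theorem IsDistribSolution.integral_momentum_one {ζ : SpaceTime → State} (h : IsDistribSolution ζ)
    {φ : SpaceTime → ℝ} (hφ : IsTest φ) :
    ∫ y, (ζ y 1 * pdt φ y + ζ y 3 * pdx 0 φ y - ζ y 2 * pdx 1 φ y) = 0 :=
  (h φ hφ).2.2

theorem integrable_coord_mul_fderiv {ζ : SpaceTime → State} (hm : Measurable ζ) {D : ℝ}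
    (hD : ∀ y, ‖ζ y‖ ≤ D) {φ : SpaceTime → ℝ} (hφ : IsTest φ) (i : Fin 4) (w : SpaceTime) :
    Integrable fun y => ζ y i * fderiv ℝ φ y w :=
  integrable_mul_of_bounded (((EuclideanSpace.proj (𝕜 := ℝ) i).continuous.measurable).comp hm)
    (fun y => (PiLp.norm_apply_le (ζ y) i).trans (hD y)) (Smooth.dirDeriv hφ.1 w).continuous
    (hasCompactSupport_dirDeriv hφ.2 w)

theorem isOpen_fanP1 (νm ν1 : ℝ) : IsOpen (fanP1 νm ν1) := by
  have h1 : Continuous fun q : SpaceTime => q.1 1 := (continuous_apply 1).comp continuous_fst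
  exact (isOpen_lt continuous_const continuous_snd).inter
    ((isOpen_lt (continuous_const.mul continuous_snd) h1).inter
      (isOpen_lt h1 (continuous_const.mul continuous_snd)))

theorem isOpen_fanP2 (ν1 νp : ℝ) : IsOpen (fanP2 ν1 νp) := isOpen_fanP1 ν1 νp

theorem measurable_fanField {α : Type} [MeasurableSpace α] (νm ν1 νp : ℝ) (am a1 a2 ap : α) :
    Measurable (fanField νm ν1 νp am a1 a2 ap) := by
  have h1 : Measurable fun q : SpaceTime => q.1 1 := (measurable_pi_apply 1).comp measurable_fst
  have h2 : ∀ ν : ℝ, MeasurableSet {q : SpaceTime | q.1 1 < ν * q.2} := fun ν =>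
    measurableSet_lt h1 (measurable_snd.const_mul ν)
  exact Measurable.ite (h2 _) measurable_const (Measurable.ite (h2 _) measurable_const
    (Measurable.ite (h2 _) measurable_const measurable_const))

theorem abs_fanField_le (νm ν1 νp : ℝ) (am a1 a2 ap : ℝ) (q : SpaceTime) :
    |fanField νm ν1 νp am a1 a2 ap q| ≤ |am| + |a1| + |a2| + |ap| := by
  have := abs_nonneg am
  have := abs_nonneg a1
  have := abs_nonneg a2
  have := abs_nonneg ap
  unfold fanField
  split_ifs <;> linarith

theorem fanField_of_mem_fanP1 {α : Type} {νm ν1 : ℝ} {q : SpaceTime} (hq : q ∈ fanP1 νm ν1)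
    (νp : ℝ) (am a1 a2 ap : α) : fanField νm ν1 νp am a1 a2 ap q = a1 := by
  rw [fanField, if_neg hq.2.1.not_gt, if_pos hq.2.2]

theorem fanField_of_mem_fanP2 {α : Type} {νm ν1 νp : ℝ} (h : νm < ν1) {q : SpaceTime}
    (hq : q ∈ fanP2 ν1 νp) (am a1 a2 ap : α) : fanField νm ν1 νp am a1 a2 ap q = a2 := by
  have := mul_lt_mul_of_pos_right h hq.1
  rw [fanField, if_neg (this.trans hq.2.1).not_gt, if_neg hq.2.1.not_gt, if_pos hq.2.2]

theorem disjoint_fanP (νm ν1 νp : ℝ) : Disjoint (fanP1 νm ν1) (fanP2 ν1 νp) :=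
  Set.disjoint_left.2 fun _ h1 h2 => (h1.2.2.trans h2.2.1).false

theorem ae_ne_interface (ν : ℝ) : ∀ᵐ q : SpaceTime, q.1 1 ≠ ν * q.2 := by
  let L : SpaceTime →ₗ[ℝ] ℝ :=
    (LinearMap.proj 1).comp (LinearMap.fst ℝ (Fin 2 → ℝ) ℝ) - ν • LinearMap.snd ℝ (Fin 2 → ℝ) ℝ
  have hL : LinearMap.ker L ≠ ⊤ := by
    intro h
    have : (Pi.single 1 1, 0) ∈ LinearMap.ker L := h ▸ Submodule.mem_top
    simp [L] at this
  filter_upwards [compl_mem_ae_iff.2 (Measure.addHaar_submodule volume _ hL)] with q hq h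
  exact hq (by simp [L, h])

theorem fan_ae_cases {νm ν1 νp : ℝ} (h1 : νm < ν1) (h2 : ν1 < νp) :
    ∀ᵐ q : SpaceTime, q ∈ posTime →
      (q ∉ fanP1 νm ν1 ∧ q ∉ fanP2 ν1 νp ∧
        ∀ {α : Type} (am a1 a2 ap : α), fanField νm ν1 νp am a1 a2 ap q = am) ∨
      (q ∈ fanP1 νm ν1 ∧ q ∉ fanP2 ν1 νp ∧
        ∀ {α : Type} (am a1 a2 ap : α), fanField νm ν1 νp am a1 a2 ap q = a1) ∨
      (q ∉ fanP1 νm ν1 ∧ q ∈ fanP2 ν1 νp ∧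
        ∀ {α : Type} (am a1 a2 ap : α), fanField νm ν1 νp am a1 a2 ap q = a2) ∨
      (q ∉ fanP1 νm ν1 ∧ q ∉ fanP2 ν1 νp ∧
        ∀ {α : Type} (am a1 a2 ap : α), fanField νm ν1 νp am a1 a2 ap q = ap) := by
  filter_upwards [ae_ne_interface νm, ae_ne_interface ν1] with q hm hn hq
  have h1q : νm * q.2 < ν1 * q.2 := mul_lt_mul_of_pos_right h1 hq
  have h2q : ν1 * q.2 < νp * q.2 := mul_lt_mul_of_pos_right h2 hq
  rcases lt_or_gt_of_ne hm with hm | hm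
  · refine Or.inl ⟨fun h => (h.2.1.trans hm).false, fun h => ?_, fun am a1 a2 ap => if_pos hm⟩
    exact (h.2.1.trans (hm.trans h1q)).false
  rcases lt_or_gt_of_ne hn with hn | hn
  · have hP : q ∈ fanP1 νm ν1 := ⟨hq, hm, hn⟩
    exact Or.inr (Or.inl ⟨hP, Set.disjoint_left.1 (disjoint_fanP νm ν1 νp) hP,
      fanField_of_mem_fanP1 hP νp⟩)
  rcases lt_or_ge (q.1 1) (νp * q.2) with hp | hp
  · have hP : q ∈ fanP2 ν1 νp := ⟨hq, hn, hp⟩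
    exact Or.inr (Or.inr (Or.inl ⟨Set.disjoint_right.1 (disjoint_fanP νm ν1 νp) hP, hP,
      fanField_of_mem_fanP2 h1 hP⟩))
  · refine Or.inr (Or.inr (Or.inr ⟨fun h => (h.2.2.trans hn).false,
      fun h => (h.2.2.trans_le hp).false, fun am a1 a2 ap => ?_⟩))
    rw [fanField, if_neg hm.not_gt, if_neg hn.not_gt, if_neg hp.not_gt]

theorem tendsto_fanField (νm ν1 νp am a1 a2 ap : ℝ) :
    ∀ᵐ x : Fin 2 → ℝ, Filter.Tendsto (fun t => fanField νm ν1 νp am a1 a2 ap (x, t))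
      (nhdsWithin 0 (Set.Ioi 0)) (nhds (if x 1 < 0 then am else ap)) := by
  have hne : ∀ᵐ x : Fin 2 → ℝ, x 1 ≠ 0 := by
    rw [volume_pi]
    exact compl_mem_ae_iff.2 (Measure.pi_hyperplane (fun _ => volume) 1 0)
  have hν : ∀ ν : ℝ, Filter.Tendsto (fun t => ν * t) (nhdsWithin 0 (Set.Ioi 0)) (nhds 0) := by
    intro ν
    have : Filter.Tendsto (fun t => ν * t) (nhds 0) (nhds (ν * 0)) :=
      (continuous_const.mul continuous_id).tendsto 0
    rw [mul_zero] at this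
    exact this.mono_left nhdsWithin_le_nhds
  filter_upwards [hne] with x hx
  rcases lt_or_gt_of_ne hx with hx | hx
  · rw [if_pos hx]
    refine tendsto_const_nhds.congr' ?_
    filter_upwards [(hν νm).eventually (lt_mem_nhds hx)] with t ht
    exact (if_pos ht).symm
  · rw [if_neg hx.not_gt]
    refine tendsto_const_nhds.congr' ?_
    filter_upwards [(hν νm).eventually (gt_mem_nhds hx), (hν ν1).eventually (gt_mem_nhds hx),
      (hν νp).eventually (gt_mem_nhds hx)] with t h1 h2 h3
    simp [fanField, h1.not_gt, h2.not_gt, h3.not_gt]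

/-- The state with velocity `v` and symmetric trace-free stress `u`. -/
def toState (v : Fin 2 → ℝ) (u : Matrix (Fin 2) (Fin 2) ℝ) : State :=
  !₂[v 0, v 1, u 0 0, u 0 1]

theorem toState_mem_subStates {C : ℝ} {v : Fin 2 → ℝ} {u : Matrix (Fin 2) (Fin 2) ℝ}
    (hu : IsS0 u)
    (hpd : ((C / 2) • (1 : Matrix (Fin 2) (Fin 2) ℝ) - outer v + u).PosDef) :
    toState v u ∈ subStates C := by
  have hdet := hpd.det_pos
  have h0 := hpd.diag_pos (i := 0)
  have h1 := hpd.diag_pos (i := 1)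
  have hs : u 1 0 = u 0 1 := hu.1.apply 0 1
  have ht : u 1 1 = -u 0 0 := by
    have := hu.2
    rw [Matrix.trace_fin_two] at this
    linarith
  rw [Matrix.det_fin_two] at hdet
  simp [outer, vecMulVec_apply, hs, ht] at hdet h0 h1
  refine ⟨?_, ?_⟩
  · simp [gap, toState]
    linarith
  · simp [gap, defect, toState]
    linarith

/-- `ζ` is a bounded distributional solution supported in `P` which moves the state of velocity `v`
and stress `u` onto the extreme set `|v|² = C`, `u = v ⊗ v - C/2`. -/
structure IsExactPerturbation (C : ℝ) (P : Set SpaceTime) (v : Fin 2 → ℝ)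
    (u : Matrix (Fin 2) (Fin 2) ℝ) (ζ : SpaceTime → State) : Prop where
  measurable : Measurable ζ
  bounded : ∃ D, ∀ y, ‖ζ y‖ ≤ D
  eq_zero : ∀ y ∉ P, ζ y = 0
  isDistribSolution : IsDistribSolution ζ
  speed : ∀ᵐ y, y ∈ P → (v 0 + ζ y 0) ^ 2 + (v 1 + ζ y 1) ^ 2 = C
  stress_diag : ∀ᵐ y, y ∈ P → u 0 0 + ζ y 2 = ((v 0 + ζ y 0) ^ 2 - (v 1 + ζ y 1) ^ 2) / 2
  stress_off_diag : ∀ᵐ y, y ∈ P → u 0 1 + ζ y 3 = (v 0 + ζ y 0) * (v 1 + ζ y 1)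

theorem exists_isExactPerturbation {C : ℝ} {P : Set SpaceTime} (hP : IsOpen P) {v : Fin 2 → ℝ}
    {u : Matrix (Fin 2) (Fin 2) ℝ} (hu : IsS0 u)
    (hpd : ((C / 2) • (1 : Matrix (Fin 2) (Fin 2) ℝ) - outer v + u).PosDef)
    {F : Set (SpaceTime → State)} (hF : F.Finite) (hFi : ∀ f ∈ F, Integrable f weightMeasure)
    {ε : ℝ} (hε : 0 < ε) :
    ∃ ζ, IsExactPerturbation C P v u ζ ∧
      ∀ f ∈ F, |∫ y, inner ℝ (ζ y) (f y) ∂weightMeasure| ≤ ε := by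
  obtain ⟨ζ, hm, hb, hz, hd, hex, hf⟩ :=
    exists_exact_solution hP (toState_mem_subStates hu hpd) hF hFi hε
  have key : ∀ᵐ y, y ∈ P → (v 0 + ζ y 0) ^ 2 + (v 1 + ζ y 1) ^ 2 = C ∧
      u 0 0 + ζ y 2 = ((v 0 + ζ y 0) ^ 2 - (v 1 + ζ y 1) ^ 2) / 2 ∧
      u 0 1 + ζ y 3 = (v 0 + ζ y 0) * (v 1 + ζ y 1) := by
    filter_upwards [hex] with y hy hyP
    obtain ⟨h1, h2⟩ := hy hyP
    simp only [gap, defect, toState, PiLp.add_apply] at h1 h2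
    simp at h1 h2
    have h3 := (add_eq_zero_iff_of_nonneg (sq_nonneg _) (sq_nonneg _)).1 h2
    refine ⟨by linarith, ?_, ?_⟩
    · linarith [pow_eq_zero_iff two_ne_zero |>.1 h3.1]
    · linarith [pow_eq_zero_iff two_ne_zero |>.1 h3.2]
  refine ⟨ζ, ⟨hm, hb, hz, hd, ?_, ?_, ?_⟩, hf⟩
  · filter_upwards [key] with y hy hyP using (hy hyP).1
  · filter_upwards [key] with y hy hyP using (hy hyP).2.1
  · filter_upwards [key] with y hy hyP using (hy hyP).2.2

/-- The fan velocity field perturbed by the velocity components of `ζ₁` and `ζ₂`. -/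
def perturbedVelocity (νm ν1 νp : ℝ) (vm v1 v2 vp : Fin 2 → ℝ) (ζ₁ ζ₂ : SpaceTime → State)
    (q : SpaceTime) : Fin 2 → ℝ :=
  fanField νm ν1 νp vm v1 v2 vp q + ![ζ₁ q 0, ζ₁ q 1] + ![ζ₂ q 0, ζ₂ q 1]

section

variable {p ε : ℝ → ℝ} {ρm ρp : ℝ} {vm vp : Fin 2 → ℝ} {νm ν1 νp ρ1 ρ2 : ℝ} {v1 v2 : Fin 2 → ℝ}
  {u1 u2 : Matrix (Fin 2) (Fin 2) ℝ} {C1 C2 : ℝ} {ζ₁ ζ₂ : SpaceTime → State}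

/-- Almost everywhere description of the perturbed velocity on the four regions of the fan. -/
theorem perturbedVelocity_cases (h1 : νm < ν1) (h2 : ν1 < νp)
    (hζ₁ : IsExactPerturbation C1 (fanP1 νm ν1) v1 u1 ζ₁)
    (hζ₂ : IsExactPerturbation C2 (fanP2 ν1 νp) v2 u2 ζ₂) :
    ∀ᵐ q : SpaceTime, q ∈ posTime →
      (ζ₁ q = 0 ∧ ζ₂ q = 0 ∧ perturbedVelocity νm ν1 νp vm v1 v2 vp ζ₁ ζ₂ q = vm ∧
        ∀ {α : Type} (am a1 a2 ap : α), fanField νm ν1 νp am a1 a2 ap q = am) ∨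
      (q ∈ fanP1 νm ν1 ∧ ζ₂ q = 0 ∧
        perturbedVelocity νm ν1 νp vm v1 v2 vp ζ₁ ζ₂ q = ![v1 0 + ζ₁ q 0, v1 1 + ζ₁ q 1] ∧
        ∀ {α : Type} (am a1 a2 ap : α), fanField νm ν1 νp am a1 a2 ap q = a1) ∨
      (q ∈ fanP2 ν1 νp ∧ ζ₁ q = 0 ∧
        perturbedVelocity νm ν1 νp vm v1 v2 vp ζ₁ ζ₂ q = ![v2 0 + ζ₂ q 0, v2 1 + ζ₂ q 1] ∧
        ∀ {α : Type} (am a1 a2 ap : α), fanField νm ν1 νp am a1 a2 ap q = a2) ∨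
      (ζ₁ q = 0 ∧ ζ₂ q = 0 ∧ perturbedVelocity νm ν1 νp vm v1 v2 vp ζ₁ ζ₂ q = vp ∧
        ∀ {α : Type} (am a1 a2 ap : α), fanField νm ν1 νp am a1 a2 ap q = ap) := by
  filter_upwards [fan_ae_cases h1 h2] with q hq hqt
  rcases hq hqt with ⟨n1, n2, h⟩ | ⟨m1, n2, h⟩ | ⟨n1, m2, h⟩ | ⟨n1, n2, h⟩
  · refine Or.inl ⟨hζ₁.eq_zero q n1, hζ₂.eq_zero q n2, ?_, h⟩
    ext i; fin_cases i <;> simp [perturbedVelocity, vecHead, vecTail, h, hζ₁.eq_zero q n1, hζ₂.eq_zero q n2]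
  · refine Or.inr (Or.inl ⟨m1, hζ₂.eq_zero q n2, ?_, h⟩)
    ext i; fin_cases i <;> simp [perturbedVelocity, vecHead, vecTail, h, hζ₂.eq_zero q n2]
  · refine Or.inr (Or.inr (Or.inl ⟨m2, hζ₁.eq_zero q n1, ?_, h⟩))
    ext i; fin_cases i <;> simp [perturbedVelocity, vecHead, vecTail, h, hζ₁.eq_zero q n1]
  · refine Or.inr (Or.inr (Or.inr ⟨hζ₁.eq_zero q n1, hζ₂.eq_zero q n2, ?_, h⟩))
    ext i; fin_cases i <;> simp [perturbedVelocity, vecHead, vecTail, h, hζ₁.eq_zero q n1, hζ₂.eq_zero q n2]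

theorem IsExactPerturbation.eq_zero_of_notMem_posTime {C : ℝ} {P : Set SpaceTime}
    {v : Fin 2 → ℝ} {u : Matrix (Fin 2) (Fin 2) ℝ} {ζ : SpaceTime → State}
    (h : IsExactPerturbation C P v u ζ) (hP : P ⊆ posTime) {q : SpaceTime} (hq : q ∉ posTime) :
    ζ q = 0 :=
  h.eq_zero q fun hqP => hq (hP hqP)

theorem IsExactPerturbation.integrable {C : ℝ} {P : Set SpaceTime}
    {v : Fin 2 → ℝ} {u : Matrix (Fin 2) (Fin 2) ℝ} {ζ : SpaceTime → State}
    (h : IsExactPerturbation C P v u ζ) {φ : SpaceTime → ℝ} (hφ : IsTest φ) (i : Fin 4)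
    (w : SpaceTime) : Integrable fun y => ζ y i * fderiv ℝ φ y w := by
  obtain ⟨D, hD⟩ := h.bounded
  exact integrable_coord_mul_fderiv h.measurable hD hφ i w

theorem integral_perturbed_continuity (h1 : νm < ν1) (h2 : ν1 < νp)
    (hζ₁ : IsExactPerturbation C1 (fanP1 νm ν1) v1 u1 ζ₁)
    (hζ₂ : IsExactPerturbation C2 (fanP2 ν1 νp) v2 u2 ζ₂) {φ : SpaceTime → ℝ} (hφ : IsTest φ) :
    (∫ q in posTime, (fanField νm ν1 νp ρm ρ1 ρ2 ρp q * pdt φ q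
        + ∑ i, fanField νm ν1 νp ρm ρ1 ρ2 ρp q
            * perturbedVelocity νm ν1 νp vm v1 v2 vp ζ₁ ζ₂ q i * pdx i φ q))
      = ∫ q in posTime, (fanField νm ν1 νp ρm ρ1 ρ2 ρp q * pdt φ q
        + ∑ i, fanField νm ν1 νp (ρm * vm i) (ρ1 * v1 i) (ρ2 * v2 i) (ρp * vp i) q
            * pdx i φ q) := by
  refine setIntegral_posTime_eq_of_ae_eq_add (c₁ := ρ1) (c₂ := ρ2)
    ((hζ₁.integrable hφ 0 _).add (hζ₁.integrable hφ 1 _))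
    ((hζ₂.integrable hφ 0 _).add (hζ₂.integrable hφ 1 _))
    (hζ₁.isDistribSolution.integral_velocity hφ) (hζ₂.isDistribSolution.integral_velocity hφ)
    (fun q hq => by simp [hζ₁.eq_zero_of_notMem_posTime (fun _ h => h.1) hq])
    (fun q hq => by simp [hζ₂.eq_zero_of_notMem_posTime (fun _ h => h.1) hq]) ?_
  filter_upwards [perturbedVelocity_cases (vm := vm) (vp := vp) h1 h2 hζ₁ hζ₂] with q hq hqt
  rcases hq hqt with ⟨e1, e2, e3, h⟩ | ⟨m1, e2, e3, h⟩ | ⟨m2, e1, e3, h⟩ | ⟨e1, e2, e3, h⟩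
  · simp [e1, e2, e3, h]
  · simp [e2, e3, h, pdx]; ring
  · simp [e1, e3, h, pdx]; ring
  · simp [e1, e2, e3, h]

theorem integral_perturbed_momentum (h1 : νm < ν1) (h2 : ν1 < νp) (hu1 : IsS0 u1) (hu2 : IsS0 u2)
    (hζ₁ : IsExactPerturbation C1 (fanP1 νm ν1) v1 u1 ζ₁)
    (hζ₂ : IsExactPerturbation C2 (fanP2 ν1 νp) v2 u2 ζ₂) (j : Fin 2)
    {φ : SpaceTime → ℝ} (hφ : IsTest φ) :
    (∫ q in posTime,
        (fanField νm ν1 νp ρm ρ1 ρ2 ρp q * perturbedVelocity νm ν1 νp vm v1 v2 vp ζ₁ ζ₂ q j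
            * pdt φ q
          + (∑ i, fanField νm ν1 νp ρm ρ1 ρ2 ρp q
              * perturbedVelocity νm ν1 νp vm v1 v2 vp ζ₁ ζ₂ q j
              * perturbedVelocity νm ν1 νp vm v1 v2 vp ζ₁ ζ₂ q i * pdx i φ q)
          + p (fanField νm ν1 νp ρm ρ1 ρ2 ρp q) * pdx j φ q))
      = ∫ q in posTime,
        (fanField νm ν1 νp (ρm * vm j) (ρ1 * v1 j) (ρ2 * v2 j) (ρp * vp j) q * pdt φ q
          + (∑ i, fanField νm ν1 νp (ρm * uPM vm j i) (ρ1 * u1 j i) (ρ2 * u2 j i)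
                (ρp * uPM vp j i) q * pdx i φ q)
          + fanField νm ν1 νp (p ρm + ρm * sq2 vm / 2) (p ρ1 + C1 * ρ1 / 2)
              (p ρ2 + C2 * ρ2 / 2) (p ρp + ρp * sq2 vp / 2) q * pdx j φ q) := by
  have hs : ∀ {u : Matrix (Fin 2) (Fin 2) ℝ}, IsS0 u → u 1 0 = u 0 1 ∧ u 1 1 = -u 0 0 :=
    fun {u} hu => ⟨hu.1.apply 0 1, by
      have := hu.2
      rw [Matrix.trace_fin_two] at this
      linarith⟩
  obtain ⟨s1, t1⟩ := hs hu1
  obtain ⟨s2, t2⟩ := hs hu2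
  fin_cases j
  · refine setIntegral_posTime_eq_of_ae_eq_add (c₁ := ρ1) (c₂ := ρ2)
      (((hζ₁.integrable hφ 0 _).add (hζ₁.integrable hφ 2 _)).add (hζ₁.integrable hφ 3 _))
      (((hζ₂.integrable hφ 0 _).add (hζ₂.integrable hφ 2 _)).add (hζ₂.integrable hφ 3 _))
      (hζ₁.isDistribSolution.integral_momentum_zero hφ)
      (hζ₂.isDistribSolution.integral_momentum_zero hφ)
      (fun q hq => by simp [hζ₁.eq_zero_of_notMem_posTime (fun _ h => h.1) hq])
      (fun q hq => by simp [hζ₂.eq_zero_of_notMem_posTime (fun _ h => h.1) hq]) ?_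
    filter_upwards [perturbedVelocity_cases (vm := vm) (vp := vp) h1 h2 hζ₁ hζ₂, hζ₁.speed,
      hζ₁.stress_diag, hζ₁.stress_off_diag, hζ₂.speed, hζ₂.stress_diag, hζ₂.stress_off_diag]
      with q hq a1 a2 a3 b1 b2 b3 hqt
    rcases hq hqt with ⟨e1, e2, e3, h⟩ | ⟨m1, e2, e3, h⟩ | ⟨m2, e1, e3, h⟩ | ⟨e1, e2, e3, h⟩
    · simp [e1, e2, e3, h, uPM, outer, vecMulVec_apply, sq2]; ring
    · simp [e2, e3, h, pdx, pdt]
      linear_combination (ρ1 / 2 * fderiv ℝ φ q (Pi.single 0 1, 0)) * a1 m1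
        - (ρ1 * fderiv ℝ φ q (Pi.single 0 1, 0)) * a2 m1
        - (ρ1 * fderiv ℝ φ q (Pi.single 1 1, 0)) * a3 m1
    · simp [e1, e3, h, pdx, pdt]
      linear_combination (ρ2 / 2 * fderiv ℝ φ q (Pi.single 0 1, 0)) * b1 m2
        - (ρ2 * fderiv ℝ φ q (Pi.single 0 1, 0)) * b2 m2
        - (ρ2 * fderiv ℝ φ q (Pi.single 1 1, 0)) * b3 m2
    · simp [e1, e2, e3, h, uPM, outer, vecMulVec_apply, sq2]; ring
  · refine setIntegral_posTime_eq_of_ae_eq_add (c₁ := ρ1) (c₂ := ρ2)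
      (((hζ₁.integrable hφ 1 _).add (hζ₁.integrable hφ 3 _)).sub (hζ₁.integrable hφ 2 _))
      (((hζ₂.integrable hφ 1 _).add (hζ₂.integrable hφ 3 _)).sub (hζ₂.integrable hφ 2 _))
      (hζ₁.isDistribSolution.integral_momentum_one hφ)
      (hζ₂.isDistribSolution.integral_momentum_one hφ)
      (fun q hq => by simp [hζ₁.eq_zero_of_notMem_posTime (fun _ h => h.1) hq])
      (fun q hq => by simp [hζ₂.eq_zero_of_notMem_posTime (fun _ h => h.1) hq]) ?_
    filter_upwards [perturbedVelocity_cases (vm := vm) (vp := vp) h1 h2 hζ₁ hζ₂, hζ₁.speed,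
      hζ₁.stress_diag, hζ₁.stress_off_diag, hζ₂.speed, hζ₂.stress_diag, hζ₂.stress_off_diag]
      with q hq a1 a2 a3 b1 b2 b3 hqt
    rcases hq hqt with ⟨e1, e2, e3, h⟩ | ⟨m1, e2, e3, h⟩ | ⟨m2, e1, e3, h⟩ | ⟨e1, e2, e3, h⟩
    · simp [e1, e2, e3, h, uPM, outer, vecMulVec_apply, sq2]; ring
    · simp [e2, e3, h, pdx, pdt, s1, t1]
      linear_combination (ρ1 / 2 * fderiv ℝ φ q (Pi.single 1 1, 0)) * a1 m1
        + (ρ1 * fderiv ℝ φ q (Pi.single 1 1, 0)) * a2 m1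
        - (ρ1 * fderiv ℝ φ q (Pi.single 0 1, 0)) * a3 m1
    · simp [e1, e3, h, pdx, pdt, s2, t2]
      linear_combination (ρ2 / 2 * fderiv ℝ φ q (Pi.single 1 1, 0)) * b1 m2
        + (ρ2 * fderiv ℝ φ q (Pi.single 1 1, 0)) * b2 m2
        - (ρ2 * fderiv ℝ φ q (Pi.single 0 1, 0)) * b3 m2
    · simp [e1, e2, e3, h, uPM, outer, vecMulVec_apply, sq2]; ring

theorem integral_perturbed_energy (h1 : νm < ν1) (h2 : ν1 < νp)
    (hζ₁ : IsExactPerturbation C1 (fanP1 νm ν1) v1 u1 ζ₁)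
    (hζ₂ : IsExactPerturbation C2 (fanP2 ν1 νp) v2 u2 ζ₂) {φ : SpaceTime → ℝ} (hφ : IsTest φ)
    {ρ : SpaceTime → ℝ} {V : SpaceTime → Fin 2 → ℝ}
    (hρ : ρ = fanField νm ν1 νp ρm ρ1 ρ2 ρp)
    (hV : V = perturbedVelocity νm ν1 νp vm v1 v2 vp ζ₁ ζ₂) :
    (∫ q in posTime,
        ((ρ q * ε (ρ q) + ρ q * sq2 (V q) / 2) * pdt φ q
          + ∑ i, (ρ q * ε (ρ q) + ρ q * sq2 (V q) / 2 + p (ρ q)) * V q i * pdx i φ q))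
      = ∫ q in posTime,
        (fanEnergy ε ρm ρp vm vp νm ν1 νp ρ1 ρ2 C1 C2 q * pdt φ q
          + ∑ i, (fanEnergy ε ρm ρp vm vp νm ν1 νp ρ1 ρ2 C1 C2 q
                + fanField νm ν1 νp (p ρm) (p ρ1) (p ρ2) (p ρp) q)
              * fanField νm ν1 νp (vm i) (v1 i) (v2 i) (vp i) q * pdx i φ q) := by
  subst hρ hV
  refine setIntegral_posTime_eq_of_ae_eq_add (c₁ := ρ1 * ε ρ1 + ρ1 * C1 / 2 + p ρ1)
    (c₂ := ρ2 * ε ρ2 + ρ2 * C2 / 2 + p ρ2)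
    ((hζ₁.integrable hφ 0 _).add (hζ₁.integrable hφ 1 _))
    ((hζ₂.integrable hφ 0 _).add (hζ₂.integrable hφ 1 _))
    (hζ₁.isDistribSolution.integral_velocity hφ) (hζ₂.isDistribSolution.integral_velocity hφ)
    (fun q hq => by simp [hζ₁.eq_zero_of_notMem_posTime (fun _ h => h.1) hq])
    (fun q hq => by simp [hζ₂.eq_zero_of_notMem_posTime (fun _ h => h.1) hq]) ?_
  filter_upwards [perturbedVelocity_cases (vm := vm) (vp := vp) h1 h2 hζ₁ hζ₂, hζ₁.speed,
    hζ₂.speed] with q hq a b hqt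
  rcases hq hqt with ⟨e1, e2, e3, h⟩ | ⟨m1, e2, e3, h⟩ | ⟨m2, e1, e3, h⟩ | ⟨e1, e2, e3, h⟩
  · simp [e1, e2, e3, h, fanEnergy]
  · simp [e2, e3, h, pdx, fanEnergy, sq2, a m1]; ring
  · simp [e1, e3, h, pdx, fanEnergy, sq2, b m2]; ring
  · simp [e1, e2, e3, h, fanEnergy]

end

section

variable {p ε : ℝ → ℝ} {ρm ρp : ℝ} {vm vp : Fin 2 → ℝ} {νm ν1 νp ρ1 ρ2 : ℝ} {v1 v2 : Fin 2 → ℝ}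
  {u1 u2 : Matrix (Fin 2) (Fin 2) ℝ} {C1 C2 : ℝ} {ζ₁ ζ₂ : SpaceTime → State}

theorem measurable_perturbedVelocity (hζ₁ : Measurable ζ₁) (hζ₂ : Measurable ζ₂) :
    Measurable (perturbedVelocity νm ν1 νp vm v1 v2 vp ζ₁ ζ₂) := by
  have h : ∀ {ζ : SpaceTime → State}, Measurable ζ → Measurable fun q => ![ζ q 0, ζ q 1] := by
    intro ζ hζ
    have hc : ∀ i : Fin 4, Measurable fun q => ζ q i := fun i =>
      ((EuclideanSpace.proj (𝕜 := ℝ) i).continuous.measurable).comp hζ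
    refine measurable_pi_iff.2 fun i => ?_
    fin_cases i
    · exact hc 0
    · exact hc 1
  exact ((measurable_fanField νm ν1 νp vm v1 v2 vp).add (h hζ₁)).add (h hζ₂)

theorem abs_perturbedVelocity_le {D₁ D₂ : ℝ} (h₁ : ∀ y, ‖ζ₁ y‖ ≤ D₁) (h₂ : ∀ y, ‖ζ₂ y‖ ≤ D₂)
    (q : SpaceTime) (i : Fin 2) :
    |perturbedVelocity νm ν1 νp vm v1 v2 vp ζ₁ ζ₂ q i|
      ≤ ‖vm‖ + ‖v1‖ + ‖v2‖ + ‖vp‖ + D₁ + D₂ := by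
  have hv : |fanField νm ν1 νp vm v1 v2 vp q i| ≤ ‖vm‖ + ‖v1‖ + ‖v2‖ + ‖vp‖ := by
    have e1 := norm_le_pi_norm vm i
    have e2 := norm_le_pi_norm v1 i
    have e3 := norm_le_pi_norm v2 i
    have e4 := norm_le_pi_norm vp i
    rw [Real.norm_eq_abs] at e1 e2 e3 e4
    have := norm_nonneg vm
    have := norm_nonneg v1
    have := norm_nonneg v2
    have := norm_nonneg vp
    unfold fanField
    split_ifs <;> linarith
  have hc : ∀ {ζ : SpaceTime → State} {D : ℝ}, (∀ y, ‖ζ y‖ ≤ D) →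
      |(![ζ q 0, ζ q 1] : Fin 2 → ℝ) i| ≤ D := by
    intro ζ D h
    fin_cases i
    · exact (PiLp.norm_apply_le (ζ q) 0).trans (h q)
    · exact (PiLp.norm_apply_le (ζ q) 1).trans (h q)
  have a1 := hc h₁
  have a2 := hc h₂
  rw [perturbedVelocity, Pi.add_apply, Pi.add_apply]
  exact (abs_add_three _ _ _).trans (by linarith)

theorem perturbed_isWeakSolution
    (hsub : IsFanSubsolution p ρm ρp vm vp νm ν1 νp ρ1 ρ2 v1 v2 u1 u2 C1 C2)
    (hζ₁ : IsExactPerturbation C1 (fanP1 νm ν1) v1 u1 ζ₁)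
    (hζ₂ : IsExactPerturbation C2 (fanP2 ν1 νp) v2 u2 ζ₂) :
    IsWeakSolution p (riemannRho ρm ρp) (riemannV vm vp) (fanField νm ν1 νp ρm ρ1 ρ2 ρp)
      (perturbedVelocity νm ν1 νp vm v1 v2 vp ζ₁ ζ₂) := by
  obtain ⟨h1, h2, -, -, hu1, hu2, -, -, -, -, hc, hm⟩ := hsub
  refine ⟨fun φ hφ => ?_, fun j φ hφ => ?_⟩
  · rw [integral_perturbed_continuity h1 h2 hζ₁ hζ₂ hφ]
    exact hc φ hφ
  · rw [integral_perturbed_momentum h1 h2 hu1 hu2 hζ₁ hζ₂ j hφ]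
    exact hm j φ hφ

theorem perturbed_isAdmissibleSolution
    (hsub : IsAdmissibleFanSubsolution p ε ρm ρp vm vp νm ν1 νp ρ1 ρ2 v1 v2 u1 u2 C1 C2)
    (hζ₁ : IsExactPerturbation C1 (fanP1 νm ν1) v1 u1 ζ₁)
    (hζ₂ : IsExactPerturbation C2 (fanP2 ν1 νp) v2 u2 ζ₂) :
    IsAdmissibleSolution p ε (riemannRho ρm ρp) (riemannV vm vp)
      (fanField νm ν1 νp ρm ρ1 ρ2 ρp) (perturbedVelocity νm ν1 νp vm v1 v2 vp ζ₁ ζ₂) := by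
  intro φ hφ hφ0
  rw [integral_perturbed_energy hsub.1.1 hsub.1.2.1 hζ₁ hζ₂ hφ rfl rfl]
  have hem : Measurable (fanEnergy ε ρm ρp vm vp νm ν1 νp ρ1 ρ2 C1 C2) :=
    measurable_fanField νm ν1 νp _ _ _ _
  obtain ⟨M, hM⟩ : ∃ M, ∀ q, |fanEnergy ε ρm ρp vm vp νm ν1 νp ρ1 ρ2 C1 C2 q| ≤ M :=
    ⟨_, abs_fanField_le νm ν1 νp _ _ _ _⟩
  obtain ⟨N, hN⟩ : ∃ N, ∀ q, |fanField νm ν1 νp (p ρm) (p ρ1) (p ρ2) (p ρp) q| ≤ N :=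
    ⟨_, abs_fanField_le νm ν1 νp _ _ _ _⟩
  have hW : ∀ i : Fin 2, ∃ K, ∀ q, |fanField νm ν1 νp (vm i) (v1 i) (v2 i) (vp i) q| ≤ K :=
    fun i => ⟨_, abs_fanField_le νm ν1 νp _ _ _ _⟩
  choose K hK using hW
  have hM0 : 0 ≤ M := (abs_nonneg _).trans (hM 0)
  have hN0 : 0 ≤ N := (abs_nonneg _).trans (hN 0)
  have hK0 : ∀ i, 0 ≤ K i := fun i => (abs_nonneg _).trans (hK i 0)
  refine divergence_inequality_with_trace (M := M + (M + N) * (K 0 + K 1)) hem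
    (f := fun i q => (fanEnergy ε ρm ρp vm vp νm ν1 νp ρ1 ρ2 C1 C2 q
      + fanField νm ν1 νp (p ρm) (p ρ1) (p ρ2) (p ρp) q)
      * fanField νm ν1 νp (vm i) (v1 i) (v2 i) (vp i) q)
    (fun i => (hem.add (measurable_fanField νm ν1 νp _ _ _ _)).mul
      (measurable_fanField νm ν1 νp _ _ _ _))
    (fun q => (hM q).trans (le_add_of_nonneg_right
      (mul_nonneg (add_nonneg hM0 hN0) (add_nonneg (hK0 0) (hK0 1)))))
    (fun i q => ?_) ?_ hsub.2 hφ hφ0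
  · have hKi : K i ≤ K 0 + K 1 := by
      have := hK0 0
      have := hK0 1
      fin_cases i <;> simp <;> assumption
    rw [abs_mul]
    refine (mul_le_mul ((abs_add_le _ _).trans (add_le_add (hM q) (hN q))) ((hK i q).trans hKi)
      (abs_nonneg _) (add_nonneg hM0 hN0)).trans (le_add_of_nonneg_left hM0)
  · filter_upwards [tendsto_fanField νm ν1 νp (ρm * ε ρm + ρm * sq2 vm / 2)
      (ρ1 * ε ρ1 + ρ1 * C1 / 2) (ρ2 * ε ρ2 + ρ2 * C2 / 2) (ρp * ε ρp + ρp * sq2 vp / 2)] with x hx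
    unfold riemannRho riemannV
    split_ifs with h <;> simp only [h, if_true, if_false] at hx <;> exact hx

theorem sq2_perturbedVelocity_fanP1
    (hζ₁ : IsExactPerturbation C1 (fanP1 νm ν1) v1 u1 ζ₁)
    (hζ₂ : IsExactPerturbation C2 (fanP2 ν1 νp) v2 u2 ζ₂) :
    ∀ᵐ q : SpaceTime, q ∈ fanP1 νm ν1 →
      sq2 (perturbedVelocity νm ν1 νp vm v1 v2 vp ζ₁ ζ₂ q) = C1 := by
  filter_upwards [hζ₁.speed] with q hq hqP
  rw [← hq hqP]
  simp [sq2, perturbedVelocity, vecHead, vecTail, fanField_of_mem_fanP1 hqP,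
    hζ₂.eq_zero q (Set.disjoint_left.1 (disjoint_fanP νm ν1 νp) hqP)]

theorem sq2_perturbedVelocity_fanP2 (h1 : νm < ν1)
    (hζ₁ : IsExactPerturbation C1 (fanP1 νm ν1) v1 u1 ζ₁)
    (hζ₂ : IsExactPerturbation C2 (fanP2 ν1 νp) v2 u2 ζ₂) :
    ∀ᵐ q : SpaceTime, q ∈ fanP2 ν1 νp →
      sq2 (perturbedVelocity νm ν1 νp vm v1 v2 vp ζ₁ ζ₂ q) = C2 := by
  filter_upwards [hζ₂.speed] with q hq hqP
  rw [← hq hqP]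
  simp [sq2, perturbedVelocity, vecHead, vecTail, fanField_of_mem_fanP2 h1 hqP,
    hζ₁.eq_zero q (Set.disjoint_right.1 (disjoint_fanP νm ν1 νp) hqP)]

theorem exists_solution_nearly_orthogonal (hρm : 0 < ρm) (hρp : 0 < ρp)
    (hsub : IsAdmissibleFanSubsolution p ε ρm ρp vm vp νm ν1 νp ρ1 ρ2 v1 v2 u1 u2 C1 C2)
    {F : Set (SpaceTime → State)} (hF : F.Finite) (hFi : ∀ f ∈ F, Integrable f weightMeasure)
    {δ : ℝ} (hδ : 0 < δ) :
    ∃ s ∈ {s : (SpaceTime → ℝ) × (SpaceTime → Fin 2 → ℝ) |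
      IsBddAdmissibleSolutionGen p ε (riemannRho ρm ρp) (riemannV vm vp) s.1 s.2 ∧
      (∀ᵐ q : SpaceTime, q ∈ posTime → s.1 q = fanField νm ν1 νp ρm ρ1 ρ2 ρp q) ∧
      (∀ᵐ q : SpaceTime, q ∈ fanP1 νm ν1 → sq2 (s.2 q) = C1) ∧
      (∀ᵐ q : SpaceTime, q ∈ fanP2 ν1 νp → sq2 (s.2 q) = C2)},
      ∃ ζ : SpaceTime → State,
        (∀ q ∈ fanP1 νm ν1, s.2 q 0 = v1 0 + ζ q 0 ∧ s.2 q 1 = v1 1 + ζ q 1) ∧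
        ∀ f ∈ F, |∫ y, inner ℝ (ζ y) (f y) ∂weightMeasure| ≤ δ := by
  obtain ⟨h1, -, hρ1, hρ2, hu1, hu2, -, -, hpd1, hpd2, -, -⟩ := hsub.1
  obtain ⟨ζ₁, hζ₁, hFζ⟩ := exists_isExactPerturbation (isOpen_fanP1 νm ν1) hu1 hpd1 hF hFi hδ
  obtain ⟨ζ₂, hζ₂, -⟩ := exists_isExactPerturbation (isOpen_fanP2 ν1 νp) hu2 hpd2
    Set.finite_empty (fun f hf => absurd hf (Set.notMem_empty f)) one_pos
  obtain ⟨D₁, hD₁⟩ := hζ₁.bounded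
  obtain ⟨D₂, hD₂⟩ := hζ₂.bounded
  refine ⟨(fanField νm ν1 νp ρm ρ1 ρ2 ρp, perturbedVelocity νm ν1 νp vm v1 v2 vp ζ₁ ζ₂),
    ⟨⟨measurable_fanField _ _ _ _ _ _ _,
      measurable_perturbedVelocity hζ₁.measurable hζ₂.measurable, fun q => ?_,
      ⟨max (|ρm| + |ρ1| + |ρ2| + |ρp|) (‖vm‖ + ‖v1‖ + ‖v2‖ + ‖vp‖ + D₁ + D₂), fun q =>
        ⟨((le_abs_self _).trans (abs_fanField_le νm ν1 νp ρm ρ1 ρ2 ρp q)).trans (le_max_left _ _),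
          fun i => (abs_perturbedVelocity_le hD₁ hD₂ q i).trans (le_max_right _ _)⟩⟩,
      perturbed_isWeakSolution hsub.1 hζ₁ hζ₂, perturbed_isAdmissibleSolution hsub hζ₁ hζ₂⟩,
      Filter.Eventually.of_forall fun _ _ => rfl, sq2_perturbedVelocity_fanP1 hζ₁ hζ₂,
      sq2_perturbedVelocity_fanP2 h1 hζ₁ hζ₂⟩, ζ₁, fun q hq => ?_, hFζ⟩
  · simp only [fanField]
    split_ifs <;> assumption
  · simp [perturbedVelocity, vecHead, vecTail, fanField_of_mem_fanP1 hq,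
      hζ₂.eq_zero q (Set.disjoint_left.1 (disjoint_fanP νm ν1 νp) hq)]

end

/-- The deviation of a velocity field from the constant `v` on `P`, as a state field. -/
def velocityDeviation (P : Set SpaceTime) (v : Fin 2 → ℝ) (V : SpaceTime → Fin 2 → ℝ) :
    SpaceTime → State :=
  P.indicator fun q => !₂[V q 0 - v 0, V q 1 - v 1, 0, 0]

theorem integrable_velocityDeviation {P : Set SpaceTime} (hP : MeasurableSet P) (v : Fin 2 → ℝ)
    {V : SpaceTime → Fin 2 → ℝ} (hV : Measurable V) {M : ℝ} (hM : ∀ q i, |V q i| ≤ M) :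
    Integrable (velocityDeviation P v V) weightMeasure := by
  have hV' : ∀ i, Measurable fun q => V q i := fun i => (measurable_pi_apply i).comp hV
  have hi : ∀ i, Integrable (fun q => V q i - v i) weightMeasure := fun i =>
    (Integrable.of_bound (hV' i).aestronglyMeasurable M
      (Filter.Eventually.of_forall fun q => hM q i)).sub (integrable_const _)
  refine Integrable.indicator ?_ hP
  have : (fun q => (!₂[V q 0 - v 0, V q 1 - v 1, 0, 0] : State)) = fun q =>
      (V q 0 - v 0) • EuclideanSpace.single (0 : Fin 4) (1 : ℝ)
        + (V q 1 - v 1) • EuclideanSpace.single (1 : Fin 4) (1 : ℝ) := by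
    funext q
    ext i
    fin_cases i <;> simp
  rw [this]
  exact ((hi 0).smul_const _).add ((hi 1).smul_const _)

theorem setIntegral_weight_deviation_pos {P : Set SpaceTime} (hP : IsOpen P) (hne : P.Nonempty)
    {v : Fin 2 → ℝ} {V : SpaceTime → Fin 2 → ℝ} (hV : Measurable V) {M : ℝ}
    (hM : ∀ q i, |V q i| ≤ M) {C : ℝ} (hC : sq2 v < C) (hVC : ∀ᵐ q, q ∈ P → sq2 (V q) = C) :
    0 < ∫ q in P, ((V q 0 - v 0) ^ 2 + (V q 1 - v 1) ^ 2) ∂weightMeasure := by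
  have hV' : ∀ i, Measurable fun q => V q i := fun i => (measurable_pi_apply i).comp hV
  have hi : ∀ i, Integrable (fun q => (V q i - v i) ^ 2) (weightMeasure.restrict P) := by
    intro i
    refine Integrable.of_bound (((hV' i).sub_const _).pow_const 2).aestronglyMeasurable
      ((M + |v i|) ^ 2) (Filter.Eventually.of_forall fun q => ?_)
    rw [Real.norm_eq_abs, abs_pow]
    exact pow_le_pow_left₀ (abs_nonneg _) ((abs_sub _ _).trans (add_le_add (hM q i) le_rfl)) 2
  have h0 : ∀ q, 0 ≤ (V q 0 - v 0) ^ 2 + (V q 1 - v 1) ^ 2 := fun q => by positivity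
  refine lt_of_le_of_ne (integral_nonneg h0) fun heq => ?_
  have hz := (integral_eq_zero_iff_of_nonneg h0 ((hi 0).add (hi 1))).1 heq.symm
  have hz' : ∀ᵐ q, q ∈ P → (V q 0 - v 0) ^ 2 + (V q 1 - v 1) ^ 2 = 0 :=
    volume_absolutelyContinuous_weightMeasure.ae_le
      ((ae_restrict_iff' hP.measurableSet).1 hz)
  have hnull : ∀ᵐ q : SpaceTime, q ∉ P := by
    filter_upwards [hz', hVC] with q h1 h2 hq
    have h3 := (add_eq_zero_iff_of_nonneg (sq_nonneg _) (sq_nonneg _)).1 (h1 hq)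
    have h4 := sub_eq_zero.1 (pow_eq_zero_iff two_ne_zero |>.1 h3.1)
    have h5 := sub_eq_zero.1 (pow_eq_zero_iff two_ne_zero |>.1 h3.2)
    have h6 := h2 hq
    rw [sq2, Fin.sum_univ_two] at h6 hC
    rw [h4, h5] at h6
    linarith
  exact (hP.measure_pos volume hne).ne' (by simpa using ae_iff.1 hnull)

theorem sq2_lt_of_posDef {C : ℝ} {v : Fin 2 → ℝ} {u : Matrix (Fin 2) (Fin 2) ℝ} (hu : IsS0 u)
    (hpd : ((C / 2) • (1 : Matrix (Fin 2) (Fin 2) ℝ) - outer v + u).PosDef) : sq2 v < C := by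
  have h0 := hpd.diag_pos (i := 0)
  have h1 := hpd.diag_pos (i := 1)
  have ht := hu.2
  rw [Matrix.trace_fin_two] at ht
  simp [outer, vecMulVec_apply] at h0 h1
  rw [sq2, Fin.sum_univ_two]
  nlinarith

theorem fanP1_nonempty {νm ν1 : ℝ} (h : νm < ν1) : (fanP1 νm ν1).Nonempty :=
  ⟨(fun _ => (νm + ν1) / 2, 1), by simp [fanP1]; constructor <;> linarith⟩

/-- **Proposition (subsolution criterion).** If `p` is a `C¹` pressure law (with internal
energy `ε` satisfying `p(r) = r²ε'(r)`) and there exists an admissible fan subsolution for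
the Riemann data `(ρ₋,v₋)`, `(ρ₊,v₊)`, then there exist infinitely many bounded admissible
weak solutions `(ρ, v)` of the Euler system with the same Riemann data such that
`ρ = ρ̄` a.e. and `|v|² = Cᵢ` a.e. on `Pᵢ`, `i = 1, 2`. -/
theorem subsolution_implies_infinitely_many_solutions
    (p ε : ℝ → ℝ) (hp : ContDiffOn ℝ 1 p (Set.Ioi 0))
    (hε : ∀ r : ℝ, 0 < r → HasDerivAt ε (p r / r ^ 2) r)
    (ρm ρp : ℝ) (hρm : 0 < ρm) (hρp : 0 < ρp) (vm vp : Fin 2 → ℝ)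
    (νm ν1 νp ρ1 ρ2 : ℝ) (v1 v2 : Fin 2 → ℝ) (u1 u2 : Matrix (Fin 2) (Fin 2) ℝ) (C1 C2 : ℝ)
    (hsub : IsAdmissibleFanSubsolution p ε ρm ρp vm vp νm ν1 νp ρ1 ρ2 v1 v2 u1 u2 C1 C2) :
    {s : (SpaceTime → ℝ) × (SpaceTime → Fin 2 → ℝ) |
      IsBddAdmissibleSolutionGen p ε (riemannRho ρm ρp) (riemannV vm vp) s.1 s.2 ∧
      (∀ᵐ q : SpaceTime, q ∈ posTime → s.1 q = fanField νm ν1 νp ρm ρ1 ρ2 ρp q) ∧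
      (∀ᵐ q : SpaceTime, q ∈ fanP1 νm ν1 → sq2 (s.2 q) = C1) ∧
      (∀ᵐ q : SpaceTime, q ∈ fanP2 ν1 νp → sq2 (s.2 q) = C2)}.Infinite := by
  intro hfin
  have hopen := isOpen_fanP1 νm ν1
  obtain ⟨h1, -, -, -, hu1, -, -, -, hpd1, -⟩ := hsub.1
  obtain ⟨δ, hδ, hδ0⟩ := (((Filter.eventually_all_finite hfin).2 fun s hs => by
    obtain ⟨M, hM⟩ := hs.1.2.2.2.1
    exact Ioo_mem_nhdsGT (setIntegral_weight_deviation_pos hopen (fanP1_nonempty h1)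
      hs.1.2.1 (fun q => (hM q).2) (sq2_lt_of_posDef hu1 hpd1) hs.2.2.1)).and
    (self_mem_nhdsWithin (s := Set.Ioi (0 : ℝ)))).exists
  obtain ⟨s, hs, ζ, hζ, hζF⟩ := exists_solution_nearly_orthogonal hρm hρp hsub
    (hfin.image fun s => velocityDeviation (fanP1 νm ν1) v1 s.2) (by
      rintro _ ⟨s, hs, rfl⟩
      obtain ⟨M, hM⟩ := hs.1.2.2.2.1
      exact integrable_velocityDeviation hopen.measurableSet v1 hs.1.2.1 fun q => (hM q).2) hδ0
  have hle := hζF _ (Set.mem_image_of_mem _ hs)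
  have hinner : ∀ y, inner ℝ (ζ y) (velocityDeviation (fanP1 νm ν1) v1 s.2 y)
      = (fanP1 νm ν1).indicator
        (fun q => (s.2 q 0 - v1 0) ^ 2 + (s.2 q 1 - v1 1) ^ 2) y := by
    intro y
    by_cases hy : y ∈ fanP1 νm ν1
    · obtain ⟨e0, e1⟩ := hζ y hy
      rw [velocityDeviation, Set.indicator_of_mem hy, Set.indicator_of_mem hy, e0, e1]
      simp [PiLp.inner_apply, Fin.sum_univ_four]
      ring
    · rw [velocityDeviation, Set.indicator_of_notMem hy, Set.indicator_of_notMem hy,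
        inner_zero_right]
  simp_rw [hinner] at hle
  rw [integral_indicator hopen.measurableSet] at hle
  exact ((le_abs_self _).trans hle).not_gt (hδ s hs).2

end
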